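/- arXiv:1408.5266 — 2 statements merged into one kernel-verified Lean document; each statement's English description precedes it below -/
import Mathlib

section
/- The unique continuous non-negative solution with at most linear growth of the Volterra integral equation φ(t,s,i,y) = ((1−F(T−t+y|i))/(1−F(y|i))) η_i(t,s) + ∫₀^{T−t} e^{−r(i)v} (f(y+v|i)/(1−F(y|i))) Σ_j p_{ij} ∫₀^∞ φ(t+v,x,j,0) α(x;s,i,v) dx dv, φ(t,0,i,y) = 0, also solves the initial-boundary value problem: on D it satisfies ∂φ/∂t + ∂φ/∂y + r(i) s ∂φ/∂s + ½ σ(i)² s² ∂²φ/∂s² + (f(y|i)/(1−F(y|i))) Σ_{j≠i} p_{ij} (φ(t,s,j,0) − φ(t,s,i,y)) = r(i) φ(t,s,i,y), and it satisfies the conditions φ(t,0,i,y) = 0 for all t ∈ [0,T] and φ(T,s,i,y) = (s−K)⁺ for all s > 0, 0 ≤ y ≤ T and every i. -/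
open MeasureTheory Real Set Finset

/-- Standard normal cumulative distribution function. -/
noncomputable def stdNormalCDF (x : ℝ) : ℝ :=
  ∫ u in Set.Iic x, Real.exp (-u ^ 2 / 2) / Real.sqrt (2 * Real.pi)

/-- Black–Scholes price of a European call with rate `r`, volatility `σ`,
strike `K`, maturity `T`, evaluated at time `t` and stock price `s`;
with `η(t,0)=0` and `η(T,s)=(s-K)⁺`. -/
noncomputable def bsPrice (r σ K T t s : ℝ) : ℝ :=
  if s ≤ 0 then 0
  else if t < T then
    s * stdNormalCDF ((Real.log (s / K) + (r + σ ^ 2 / 2) * (T - t)) / (σ * Real.sqrt (T - t)))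
      - K * Real.exp (-r * (T - t)) *
        stdNormalCDF ((Real.log (s / K) + (r + σ ^ 2 / 2) * (T - t)) / (σ * Real.sqrt (T - t))
          - σ * Real.sqrt (T - t))
  else max (s - K) 0

/-- `L(x,s,i,v)` of the lognormal kernel. -/
noncomputable def lnL (r σ x s v : ℝ) : ℝ :=
  (Real.log (x / s) - (r - σ ^ 2 / 2) * v) / (σ * Real.sqrt v)

/-- The lognormal kernel `α(x; s, i, v)`. -/
noncomputable def lnKernel (r σ x s v : ℝ) : ℝ :=
  Real.exp (-(lnL r σ x s v) ^ 2 / 2) / (Real.sqrt (2 * Real.pi) * x * σ * Real.sqrt v)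

/-- The domain `D` (in the variables `(t, s, y)`, the regime being kept separate). -/
def domD (T : ℝ) : Set (ℝ × ℝ × ℝ) :=
  {q | 0 < q.1 ∧ q.1 < T ∧ 0 < q.2.1 ∧ 0 < q.2.2 ∧ q.2.2 < q.1}

/-- The closure of the domain `D`. -/
def domDbar (T : ℝ) : Set (ℝ × ℝ × ℝ) :=
  {q | 0 ≤ q.1 ∧ q.1 ≤ T ∧ 0 ≤ q.2.1 ∧ 0 ≤ q.2.2 ∧ q.2.2 ≤ q.1}

/-- The right hand side of the Volterra integral equation. -/
noncomputable def ieRHS {k : ℕ} (r σ : Fin k → ℝ) (p : Fin k → Fin k → ℝ)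
    (f F : Fin k → ℝ → ℝ) (K T : ℝ) (φ : ℝ → ℝ → Fin k → ℝ → ℝ)
    (t s : ℝ) (i : Fin k) (y : ℝ) : ℝ :=
  (1 - F i (T - t + y)) / (1 - F i y) * bsPrice (r i) (σ i) K T t s
    + ∫ v in Set.Ioo (0 : ℝ) (T - t),
        Real.exp (-(r i) * v) * (f i (y + v) / (1 - F i y)) *
          ∑ j, p i j * ∫ x in Set.Ioi (0 : ℝ), φ (t + v) x j 0 * lnKernel (r i) (σ i) x s v

/-- Continuity on the closure of `D`. -/
def ContOnClosure (T : ℝ) {k : ℕ} (φ : ℝ → ℝ → Fin k → ℝ → ℝ) : Prop :=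
  ∀ i, ContinuousOn (fun q : ℝ × ℝ × ℝ => φ q.1 q.2.1 i q.2.2) (domDbar T)

/-- At most linear growth in the stock variable: `sup_D |φ|/(1+s) < ∞`. -/
def LinGrowth (T : ℝ) {k : ℕ} (φ : ℝ → ℝ → Fin k → ℝ → ℝ) : Prop :=
  ∃ C : ℝ, ∀ t s y : ℝ, (t, s, y) ∈ domD T → ∀ i, |φ t s i y| ≤ C * (1 + s)

/-- `φ` solves the Volterra integral equation together with boundary condition
`φ(t,0,i,y) = 0`. -/
def SolvesIE {k : ℕ} (r σ : Fin k → ℝ) (p : Fin k → Fin k → ℝ)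
    (f F : Fin k → ℝ → ℝ) (K T : ℝ) (φ : ℝ → ℝ → Fin k → ℝ → ℝ) : Prop :=
  (∀ t s y : ℝ, (t, s, y) ∈ domD T → ∀ i,
      φ t s i y = ieRHS r σ p f F K T φ t s i y) ∧
  (∀ t y : ℝ, ∀ i, 0 ≤ t → t ≤ T → 0 ≤ y → y ≤ t → φ t 0 i y = 0)


section Part1
open ProbabilityTheory Filter Topology


/-- weighted differentiation under the integral for exponential families -/
lemma hasDerivAt_weighted {α : Type*} [MeasurableSpace α] {μ : Measure α} (w X : α → ℝ)
    (hw : Measurable w) (hw0 : ∀ a, 0 ≤ w a)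
    (U : Set ℝ) (hU : IsOpen U) (hint : ∀ t ∈ U, Integrable (fun a => w a * exp (t * X a)) μ)
    (n : ℕ) (t : ℝ) (ht : t ∈ U) :
    HasDerivAt (fun t => ∫ a, w a * (X a ^ n * exp (t * X a)) ∂μ)
      (∫ a, w a * (X a ^ (n+1) * exp (t * X a)) ∂μ) t := by
  have hd : Measurable (fun a => ENNReal.ofReal (w a)) := hw.ennreal_ofReal
  have hfin : ∀ᵐ a ∂μ, ENNReal.ofReal (w a) < ⊤ := by simp
  have hconv : ∀ g : α → ℝ, ∫ a, w a * g a ∂μ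
      = ∫ a, g a ∂(μ.withDensity (fun a => ENNReal.ofReal (w a))) := by
    intro g
    rw [integral_withDensity_eq_integral_toReal_smul hd hfin]
    simp [ENNReal.toReal_ofReal (hw0 _)]
  simp_rw [hconv]
  apply hasDerivAt_integral_pow_mul_exp_real
  refine mem_interior.2 ⟨U, ?_, hU, ht⟩
  intro t ht
  show Integrable _ _
  rw [integrable_withDensity_iff_integrable_smul' hd hfin]
  simpa [ENNReal.toReal_ofReal (hw0 _)] using hint t ht

noncomputable abbrev gau : Measure ℝ := gaussianReal 0 1

lemma gau_exp_pow_integrable (a : ℝ) (n : ℕ) :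
    Integrable (fun z : ℝ => exp (a * |z|) * |z| ^ n) gau := by
  have h1 : ∀ b : ℝ, Integrable (fun z : ℝ => |z| ^ n * exp (b * z)) gau := by
    intro b
    exact integrable_pow_abs_mul_exp_of_mem_interior_integrableExpSet (X := id) (μ := gau)
      (by rw [integrableExpSet_id_gaussianReal]; simp) n
  refine ((h1 a).add (h1 (-a))).mono' (by fun_prop) (ae_of_all _ fun z => ?_)
  rw [Real.norm_of_nonneg (by positivity)]
  simp only [Pi.add_apply]
  rcases abs_cases z with ⟨h, _⟩ | ⟨h, _⟩ <;> rw [h]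
  · have : 0 ≤ z^n * exp (-a*z) := by positivity
    nlinarith
  · have : 0 ≤ (-z)^n * exp (a*z) := by
      have : 0 ≤ -z := by linarith
      positivity
    have e : a * -z = -a*z := by ring
    rw [e]; nlinarith

lemma integral_gau (g : ℝ → ℝ) : ∫ z, g z ∂gau = ∫ z, (√(2*π))⁻¹ * exp (-z^2/2) * g z := by
  rw [integral_gaussianReal_eq_integral_smul (by simp)]
  simp [gaussianPDFReal]

/-- admissible sources: measurable, non-negative, linear growth. -/
structure Adm (C : ℝ) (h : ℝ → ℝ) : Prop where
  hC : 0 ≤ C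
  meas : Measurable h
  nn : ∀ x, 0 ≤ h x
  gr : ∀ x, 0 < x → h x ≤ C * (1 + x)

/-- Gaussian moments of `h` along the lognormal variable. -/
noncomputable def Mk (m σ : ℝ) (n : ℕ) (h : ℝ → ℝ) (s v : ℝ) : ℝ :=
  ∫ z, h (s * exp (m * v + σ * √v * z)) * z ^ n ∂gau

noncomputable def kap (m σ T z : ℝ) : ℝ := exp (|m| * T + σ * √T * |z|)

noncomputable def Bk (m σ T : ℝ) (n : ℕ) : ℝ := ∫ z, kap m σ T z * |z| ^ n ∂gau

lemma kap_pow_integrable (m σ T : ℝ) (n : ℕ) :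
    Integrable (fun z => kap m σ T z * |z| ^ n) gau := by
  have := (gau_exp_pow_integrable (σ * √T) n).const_mul (exp (|m| * T))
  refine this.congr (ae_of_all _ fun z => ?_)
  simp only [kap, exp_add]; ring

lemma Bk_nonneg (m σ T : ℝ) (n : ℕ) : 0 ≤ Bk m σ T n :=
  integral_nonneg fun z => by simp only [kap]; positivity

lemma exp_le_kap {m σ T v z : ℝ} (hσ : 0 < σ) (hv : 0 ≤ v) (hvT : v ≤ T) :
    exp (m * v + σ * √v * z) ≤ kap m σ T z := by
  unfold kap
  apply exp_le_exp.2
  have h1 : m * v ≤ |m| * T := by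
    calc m * v ≤ |m| * v := by gcongr; exact le_abs_self m
      _ ≤ _ := by gcongr
  have h2 : σ * √v * z ≤ σ * √T * |z| := by
    calc σ * √v * z ≤ σ * √v * |z| := by gcongr; exact le_abs_self z
      _ ≤ _ := by gcongr
  linarith

lemma one_le_kap {m σ T z : ℝ} (hσ : 0 < σ) (hT : 0 ≤ T) : 1 ≤ kap m σ T z := by
  unfold kap; apply one_le_exp; positivity

lemma growth_kap {m σ T v z C s : ℝ} {h : ℝ → ℝ} (hσ : 0 < σ) (hv : 0 ≤ v) (hvT : v ≤ T)
    (hs : 0 < s) (A : Adm C h) :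
    |h (s * exp (m * v + σ * √v * z))| ≤ C * (1 + s) * kap m σ T z := by
  rw [abs_of_nonneg (A.nn _)]
  refine (A.gr _ (by positivity)).trans ?_
  rw [mul_assoc C]
  refine mul_le_mul_of_nonneg_left ?_ A.hC
  have h1 := exp_le_kap (m := m) (z := z) hσ hv hvT
  have h2 := one_le_kap (m := m) (T := T) (z := z) hσ (hv.trans hvT)
  nlinarith

lemma Mk_integrable {m σ T v C s : ℝ} {h : ℝ → ℝ} (hσ : 0 < σ) (hv : 0 ≤ v) (hvT : v ≤ T)
    (hs : 0 < s) (A : Adm C h) (n : ℕ) :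
    Integrable (fun z => h (s * exp (m * v + σ * √v * z)) * z ^ n) gau := by
  refine ((kap_pow_integrable m σ T n).const_mul (C * (1+s))).mono'
    (by have := A.meas; fun_prop)
    (ae_of_all _ fun z => ?_)
  rw [norm_mul, norm_pow, Real.norm_eq_abs, Real.norm_eq_abs, ← mul_assoc]
  gcongr
  exact growth_kap hσ hv hvT hs A

lemma Mk_bound {m σ T v C s : ℝ} {h : ℝ → ℝ} (hσ : 0 < σ) (hv : 0 ≤ v) (hvT : v ≤ T)
    (hs : 0 < s) (A : Adm C h) (n : ℕ) :
    |Mk m σ n h s v| ≤ C * (1 + s) * Bk m σ T n := by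
  unfold Mk Bk
  rw [← integral_const_mul, ← Real.norm_eq_abs]
  refine norm_integral_le_of_norm_le ((kap_pow_integrable m σ T n).const_mul _)
    (ae_of_all _ fun z => ?_)
  rw [norm_mul, norm_pow, Real.norm_eq_abs, Real.norm_eq_abs, ← mul_assoc]
  gcongr
  exact growth_kap hσ hv hvT hs A

/-- Cameron-Martin shift. -/
lemma gau_shift (g : ℝ → ℝ) (κ : ℝ) :
    ∫ z, g (z + κ) ∂gau = ∫ z, g z * exp (κ * z - κ ^ 2 / 2) ∂gau := by
  rw [integral_gau, integral_gau]
  rw [← integral_add_right_eq_self (fun z => (√(2*π))⁻¹ * exp (-z^2/2) * (g z * exp (κ * z - κ ^ 2 / 2))) κ]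
  congr 1; ext z
  have : exp (-z^2/2) = exp (-(z+κ)^2/2) * exp (κ * (z+κ) - κ^2/2) := by
    rw [← exp_add]; congr 1; ring
  rw [this]; ring

end Part1

section Part2
open ProbabilityTheory Filter Topology

lemma W_exp_integrable {m σ v C s : ℝ} {h : ℝ → ℝ} (hσ : 0 < σ) (hv : 0 < v)
    (hs : 0 < s) (A : Adm C h) (n : ℕ) (t : ℝ) :
    Integrable (fun z => h (s * exp (m * v + σ * √v * z)) * (z ^ n * exp (t * z))) gau := by
  refine ((gau_exp_pow_integrable (σ * √v + |t|) n).const_mul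
    (C * (1+s) * exp (|m| * v))).mono' (by have := A.meas; fun_prop) (ae_of_all _ fun z => ?_)
  rw [norm_mul, norm_mul, norm_pow, Real.norm_eq_abs, Real.norm_eq_abs, Real.norm_eq_abs,
    abs_exp]
  have h1 := growth_kap (m := m) (z := z) hσ hv.le le_rfl hs A
  have h2 : exp (t * z) ≤ exp (|t| * |z|) := by
    apply exp_le_exp.2; rw [← abs_mul]; exact le_abs_self _
  have h3 := (abs_nonneg _).trans h1
  calc _ ≤ (C * (1 + s) * kap m σ v z) * (|z| ^ n * exp (|t| * |z|)) := by gcongr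
    _ = _ := by
      simp only [kap, add_mul, exp_add]; ring

lemma Mk_shift {m σ v s0 s : ℝ} (h : ℝ → ℝ) (hσ : 0 < σ) (hv : 0 < v) (hs0 : 0 < s0) (hs : 0 < s)
    (n : ℕ) :
    Mk m σ n h s v = ∫ z, h (s0 * exp (m * v + σ * √v * z)) *
      (z - log (s / s0) / (σ * √v)) ^ n *
        exp (log (s / s0) / (σ * √v) * z - (log (s / s0) / (σ * √v)) ^ 2 / 2) ∂gau := by
  rw [← gau_shift (fun z => h (s0 * exp (m * v + σ * √v * z)) *
      (z - log (s / s0) / (σ * √v)) ^ n)]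
  unfold Mk
  congr 1; ext z
  have ha : 0 < σ * √v := by positivity
  have : s0 * exp (m * v + σ * √v * (z + log (s / s0) / (σ * √v)))
      = s * exp (m * v + σ * √v * z) := by
    have e : m * v + σ * √v * (z + log (s / s0) / (σ * √v))
      = log (s / s0) + (m * v + σ * √v * z) := by field_simp; ring
    rw [e, exp_add, exp_log (by positivity)]
    field_simp
  rw [this]; simp


lemma kappa_deriv {s : ℝ} (a : ℝ) (hs : 0 < s) : HasDerivAt (fun x => log (x / s) / a) (1 / (a * s)) s := by
  have h1 : HasDerivAt (fun x : ℝ => x / s) (1 / s) s := (hasDerivAt_id s).div_const s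
  have := (h1.log (by simp [hs.ne'])).div_const a
  convert! this using 1
  rw [div_self hs.ne', div_one, div_div, mul_comm]

lemma N_deriv {m σ v C s : ℝ} {h : ℝ → ℝ} (hσ : 0 < σ) (hv : 0 < v) (hs : 0 < s)
    (A : Adm C h) (n : ℕ) (t : ℝ) :
    HasDerivAt (fun t => ∫ z, h (s * exp (m * v + σ * √v * z)) * (z ^ n * exp (t * z)) ∂gau)
      (∫ z, h (s * exp (m * v + σ * √v * z)) * (z ^ (n+1) * exp (t * z)) ∂gau) t := by
  refine hasDerivAt_weighted (fun z => h (s * exp (m * v + σ * √v * z))) (fun z => z)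
    (by have := A.meas; fun_prop) (fun z => A.nn _) Set.univ isOpen_univ (fun t _ => ?_) n t trivial
  simpa using W_exp_integrable hσ hv hs A 0 t

lemma Mk0_deriv_s {m σ v C s : ℝ} {h : ℝ → ℝ} (hσ : 0 < σ) (hv : 0 < v) (hs : 0 < s)
    (A : Adm C h) :
    HasDerivAt (fun s => Mk m σ 0 h s v) (Mk m σ 1 h s v / (σ * √v * s)) s := by
  have ha : 0 < σ * √v := by positivity
  have hN := N_deriv (m := m) hσ hv hs A 0
  have hk := kappa_deriv (σ * √v) hs
  have hk0 : log (s / s) / (σ * √v) = 0 := by simp [hs.ne']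
  have e : (fun x => Mk m σ 0 h x v) =ᶠ[𝓝 s] fun x =>
      exp (-(log (x / s) / (σ * √v))^2/2) *
        (fun t => ∫ z, h (s * exp (m * v + σ * √v * z)) * (z ^ 0 * exp (t * z)) ∂gau)
          (log (x / s) / (σ * √v)) := by
    filter_upwards [lt_mem_nhds hs] with x hx
    rw [Mk_shift h hσ hv hs hx 0]
    rw [← integral_const_mul]
    congr 1; ext z
    generalize log (x / s) / (σ * √v) = κ
    have e : exp (κ * z - κ^2/2) = exp (-κ^2/2) * exp (κ * z) := by
      rw [← exp_add]; congr 1; ring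
    rw [e]; ring
  refine HasDerivAt.congr_of_eventuallyEq ?_ e
  have hcomp := HasDerivAt.comp s (h₂ := (fun t => ∫ z, h (s * exp (m * v + σ * √v * z)) * (z ^ 0 * exp (t * z)) ∂gau)) (hN _) hk
  have hE := (((hk.pow 2).neg.div_const 2).exp)
  convert! hE.mul hcomp using 1
  simp [Mk, hs.ne']
  ring

lemma Mk1_deriv_s {m σ v C s : ℝ} {h : ℝ → ℝ} (hσ : 0 < σ) (hv : 0 < v) (hs : 0 < s)
    (A : Adm C h) :
    HasDerivAt (fun s => Mk m σ 1 h s v) ((Mk m σ 2 h s v - Mk m σ 0 h s v) / (σ * √v * s)) s := by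
  have ha : 0 < σ * √v := by positivity
  have hN0 := N_deriv (m := m) hσ hv hs A 0
  have hN1 := N_deriv (m := m) hσ hv hs A 1
  have hk := kappa_deriv (σ * √v) hs
  have hk0 : log (s / s) / (σ * √v) = 0 := by simp [hs.ne']
  have e : (fun x => Mk m σ 1 h x v) =ᶠ[𝓝 s] fun x =>
      exp (-(log (x / s) / (σ * √v))^2/2) *
        ((fun t => ∫ z, h (s * exp (m * v + σ * √v * z)) * (z ^ 1 * exp (t * z)) ∂gau)
          (log (x / s) / (σ * √v)) - (log (x / s) / (σ * √v)) *
          (fun t => ∫ z, h (s * exp (m * v + σ * √v * z)) * (z ^ 0 * exp (t * z)) ∂gau)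
          (log (x / s) / (σ * √v))) := by
    filter_upwards [lt_mem_nhds hs] with x hx
    rw [Mk_shift h hσ hv hs hx 1]
    rw [← integral_const_mul, ← integral_sub, ← integral_const_mul]
    · congr 1; ext z
      generalize log (x / s) / (σ * √v) = κ
      have e : exp (κ * z - κ^2/2) = exp (-κ^2/2) * exp (κ * z) := by
        rw [← exp_add]; congr 1; ring
      rw [e]; ring
    · exact W_exp_integrable hσ hv hs A 1 _
    · exact (W_exp_integrable hσ hv hs A 0 _).const_mul _
  refine HasDerivAt.congr_of_eventuallyEq ?_ e
  have hcomp0 := HasDerivAt.comp s (h₂ := (fun t => ∫ z, h (s * exp (m * v + σ * √v * z)) * (z ^ 0 * exp (t * z)) ∂gau)) (hN0 _) hk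
  have hcomp1 := HasDerivAt.comp s (h₂ := (fun t => ∫ z, h (s * exp (m * v + σ * √v * z)) * (z ^ 1 * exp (t * z)) ∂gau)) (hN1 _) hk
  have hE := (((hk.pow 2).neg.div_const 2).exp)
  convert! hE.mul (hcomp1.sub (hk.mul hcomp0)) using 1
  simp [Mk, hs.ne']
  field_simp


end Part2

section Part3
open ProbabilityTheory Filter Topology

lemma integral_affine (G : ℝ → ℝ) (b : ℝ) {a : ℝ} (ha : 0 < a) :
    ∫ z, G (b + a * z) = a⁻¹ * ∫ ξ, G ξ := by
  have := Measure.integral_comp_mul_left (fun z => G (b + z)) a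
  rw [this, integral_add_left_eq_self, abs_of_pos (by positivity), smul_eq_mul]

/-- rewriting the Gaussian expectation in the additive variable -/
lemma gau_xi {m σ v s : ℝ} (h p : ℝ → ℝ) (hσ : 0 < σ) (hv : 0 < v) :
    ∫ z, h (s * exp (m * v + σ * √v * z)) * p z ∂gau
      = exp (-(m^2 * v / (2 * σ^2))) / (√(2 * π) * σ * √v) *
        ∫ ξ, h (s * exp ξ) * exp (m * ξ / σ^2) * (p ((ξ - m * v) / (σ * √v))
          * exp (-(1 / (2 * σ^2 * v)) * ξ^2)) := by
  have ha : 0 < σ * √v := by positivity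
  rw [integral_gau]
  have := integral_affine (fun ξ => h (s * exp ξ) * exp (m * ξ / σ^2) *
    (p ((ξ - m * v) / (σ * √v)) * exp (-(1 / (2 * σ^2 * v)) * ξ^2))) (m * v) ha
  have h2 : ∫ ξ, h (s * exp ξ) * exp (m * ξ / σ^2) *
    (p ((ξ - m * v) / (σ * √v)) * exp (-(1 / (2 * σ^2 * v)) * ξ^2)) = (σ * √v) * ((σ * √v)⁻¹ * 
      ∫ ξ, h (s * exp ξ) * exp (m * ξ / σ^2) *
    (p ((ξ - m * v) / (σ * √v)) * exp (-(1 / (2 * σ^2 * v)) * ξ^2))) := by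
    field_simp
  rw [h2, ← this, ← mul_assoc, ← integral_const_mul]
  congr 1; ext z
  have e1 : (m * v + σ * √v * z - m * v) / (σ * √v) = z := by field_simp; ring
  rw [e1]
  have e2 : exp (-z^2/2) = exp (-(m^2 * v / (2 * σ^2))) * exp (m * (m * v + σ * √v * z) / σ^2) *
      exp (-(1 / (2 * σ^2 * v)) * (m * v + σ * √v * z)^2) := by
    rw [← exp_add, ← exp_add]; congr 1
    have : √v ^ 2 = v := sq_sqrt hv.le
    have hv' : √v ≠ 0 := by positivity
    rw [← this]
    simp only [sqrt_sq (sqrt_nonneg v)]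
    field_simp
    ring
  rw [e2]
  field_simp

lemma xi_integrable {m σ C s : ℝ} {h : ℝ → ℝ} (hs : 0 < s) (A : Adm C h) {θ : ℝ} (hθ : 0 < θ) :
    Integrable (fun ξ => h (s * exp ξ) * exp (m * ξ / σ^2) * exp (-θ * ξ^2)) := by
  have hi : Integrable (fun ξ : ℝ => C * (1 + s) * exp ((1 + |m|/σ^2)^2/(2*θ)) *
    exp (-(θ/2) * ξ^2)) := (integrable_exp_neg_mul_sq (by positivity)).const_mul _
  refine hi.mono' (by have := A.meas; fun_prop) (ae_of_all _ fun ξ => ?_)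
  rw [norm_mul, norm_mul, Real.norm_eq_abs, abs_of_nonneg (A.nn _), Real.norm_eq_abs, abs_exp,
    Real.norm_eq_abs, abs_exp]
  have h1 : h (s * exp ξ) ≤ C * (1 + s) * exp |ξ| := by
    refine (A.gr _ (by positivity)).trans ?_
    rw [mul_assoc C]
    refine mul_le_mul_of_nonneg_left ?_ A.hC
    have : exp ξ ≤ exp |ξ| := exp_le_exp.2 (le_abs_self _)
    have : 1 ≤ exp |ξ| := one_le_exp (abs_nonneg _)
    nlinarith
  have h2 : exp (m * ξ / σ^2) ≤ exp (|m|/σ^2 * |ξ|) := by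
    apply exp_le_exp.2
    calc m * ξ / σ^2 ≤ |m * ξ| / σ^2 := by gcongr; exact le_abs_self _
      _ = _ := by rw [abs_mul]; ring
  have hC := A.hC
  calc _ ≤ C * (1 + s) * exp |ξ| * exp (|m|/σ^2 * |ξ|) * exp (-θ * ξ^2) := by gcongr
    _ = C * (1 + s) * exp ((1 + |m|/σ^2) * |ξ| - θ * ξ^2) := by
      rw [mul_assoc, mul_assoc, ← exp_add, ← exp_add]; congr 2; ring
    _ ≤ C * (1 + s) * exp ((1 + |m|/σ^2)^2/(2*θ) + -(θ/2) * ξ^2) := by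
      gcongr
      set a := 1 + |m|/σ^2
      rw [← sq_abs ξ]
      set y := |ξ|
      have : 0 ≤ (a - θ * y)^2 / (2 * θ) := by positivity
      have e : (a - θ * y)^2 / (2 * θ) = a^2/(2*θ) - a * y + θ * y^2/2 := by field_simp; ring
      rw [e] at this; linarith
    _ = _ := by rw [exp_add]; ring

lemma Mk0_deriv_v {m σ v C s : ℝ} {h : ℝ → ℝ} (hσ : 0 < σ) (hv : 0 < v) (hs : 0 < s)
    (A : Adm C h) :
    HasDerivAt (fun v => Mk m σ 0 h s v)
      ((Mk m σ 2 h s v - Mk m σ 0 h s v) / (2 * v) + m * Mk m σ 1 h s v / (σ * √v)) v := by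
  set I : ℕ → ℝ → ℝ := fun n t => ∫ ξ, h (s * exp ξ) * exp (m * ξ / σ^2) *
    ((ξ^2)^n * exp (t * ξ^2)) with hI
  have hint : ∀ t ∈ Set.Iio (0:ℝ), Integrable (fun ξ => h (s * exp ξ) * exp (m * ξ / σ^2) *
      exp (t * ξ^2)) := by
    intro t ht
    have := xi_integrable (m := m) (σ := σ) hs A (θ := -t) (by simpa using ht)
    simpa using this
  have hmeas : Measurable (fun ξ => h (s * exp ξ) * exp (m * ξ / σ^2)) := by
    have := A.meas; fun_prop
  have hnn : ∀ ξ, 0 ≤ h (s * exp ξ) * exp (m * ξ / σ^2) := fun ξ =>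
    mul_nonneg (A.nn _) (exp_pos _).le
  have hder : ∀ t < 0, HasDerivAt (I 0) (I 1 t) t := fun t ht =>
    hasDerivAt_weighted (fun ξ => h (s * exp ξ) * exp (m * ξ / σ^2)) (fun ξ => ξ^2)
      hmeas hnn (Set.Iio 0) isOpen_Iio hint 0 t ht
  have hint1 : Integrable (fun ξ => h (s * exp ξ) * exp (m * ξ / σ^2) *
      (ξ^2 * exp (-(1 / (2 * σ^2 * v)) * ξ^2))) := by
    have hθ : 0 < 1 / (2 * σ^2 * v) := by positivity
    have h3 := (xi_integrable (m := m) (σ := σ) hs A (half_pos hθ)).const_mul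
      (2 / (1 / (2 * σ^2 * v)))
    refine h3.mono' (by have := A.meas; fun_prop) (ae_of_all _ fun ξ => ?_)
    set θ := 1 / (2 * σ^2 * v)
    rw [norm_mul, Real.norm_of_nonneg (hnn ξ), Real.norm_of_nonneg (by positivity)]
    have h4 : ξ^2 * exp (-θ * ξ^2) ≤ 2 / θ * exp (-(θ/2) * ξ^2) := by
      have h5 : θ / 2 * ξ^2 ≤ exp (θ/2 * ξ^2) := by
        have := add_one_le_exp (θ/2 * ξ^2); linarith
      have h6 : exp (-θ * ξ^2) = exp (-(θ/2) * ξ^2) * exp (-(θ/2) * ξ^2) := by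
        rw [← exp_add]; congr 1; ring
      have h7 : exp (θ/2 * ξ^2) * exp (-(θ/2) * ξ^2) = 1 := by
        rw [← exp_add]; simp
      have h8 : ξ^2 * exp (-(θ/2) * ξ^2) ≤ 2 / θ := by
        rw [le_div_iff₀ hθ]
        have := mul_le_mul_of_nonneg_right h5 (exp_pos (-(θ/2) * ξ^2)).le
        nlinarith
      rw [h6, ← mul_assoc]
      gcongr
    calc _ ≤ h (s * exp ξ) * exp (m * ξ / σ^2) * (2 / θ * exp (-(θ/2) * ξ^2)) :=
          mul_le_mul_of_nonneg_left h4 (hnn ξ)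
      _ = _ := by ring
  set c : ℝ → ℝ := fun v => exp (-(m^2 * v / (2 * σ^2))) / (√(2 * π) * σ * √v) with hc
  set t : ℝ → ℝ := fun v => -(1 / (2 * σ^2 * v)) with htdef
  have e0 : ∀ w > 0, Mk m σ 0 h s w = c w * I 0 (t w) := by
    intro w hw
    unfold Mk
    rw [gau_xi h (fun z => z^0) hσ hw]
    simp [hI, hc, htdef]
  have hcd : HasDerivAt c (c v * (-(m^2/(2*σ^2)) - 1/(2*v))) v := by
    have h1 : HasDerivAt (fun v => -(m^2 * v / (2 * σ^2))) (-(m^2/(2*σ^2))) v := by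
      have := (((hasDerivAt_id v).const_mul (m^2)).div_const (2*σ^2)).neg
      convert! this using 1; simp
    have h2 : HasDerivAt (fun v => √(2 * π) * σ * √v) (√(2 * π) * σ * (1 / (2 * √v))) v :=
      (hasDerivAt_sqrt hv.ne').const_mul _
    have h3 := h1.exp.div h2 (by positivity)
    convert! h3 using 1
    have : √v ^ 2 = v := sq_sqrt hv.le
    simp only [hc]
    have hv' : √v ≠ 0 := by positivity
    have e : 1 / (2 * v) = 1 / (2 * √v ^ 2) := by rw [this]
    rw [e]
    field_simp
  have htd : HasDerivAt t (1/(2*σ^2*v^2)) v := by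
    have h1 : HasDerivAt (fun v => 2 * σ^2 * v) (2 * σ^2) v := by
      simpa using (hasDerivAt_id v).const_mul (2*σ^2)
    have := (h1.inv (by positivity)).neg
    simp only [htdef, one_div]
    convert! this using 1
    field_simp
    try ring
  have ht0 : t v < 0 := by simp only [htdef]; have : 0 < 1 / (2 * σ^2 * v) := by positivity
                           linarith
  have hcomp : HasDerivAt (fun v => I 0 (t v)) (I 1 (t v) * (1/(2*σ^2*v^2))) v :=
    HasDerivAt.comp v (hder _ ht0) htd
  have key : (Mk m σ 2 h s v - Mk m σ 0 h s v) / (2 * v) + m * Mk m σ 1 h s v / (σ * √v)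
      = c v * (-(m^2/(2*σ^2)) - 1/(2*v)) * I 0 (t v) + c v * (I 1 (t v) * (1/(2*σ^2*v^2))) := by
    have i2 := Mk_integrable (m := m) hσ hv.le le_rfl hs A 2
    have i1 := Mk_integrable (m := m) hσ hv.le le_rfl hs A 1
    have i0 := Mk_integrable (m := m) hσ hv.le le_rfl hs A 0
    have e1 : (Mk m σ 2 h s v - Mk m σ 0 h s v) / (2 * v) + m * Mk m σ 1 h s v / (σ * √v)
      = ∫ z, h (s * exp (m * v + σ * √v * z)) * ((z^2-1)/(2*v) + m * z/(σ * √v)) ∂gau := by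
      have : (fun z => h (s * exp (m * v + σ * √v * z)) * ((z^2-1)/(2*v) + m * z/(σ * √v)))
        = fun z => (h (s * exp (m * v + σ * √v * z)) * z^2 - h (s * exp (m * v + σ * √v * z)) * z^0) / (2 * v)
          + (m / (σ * √v)) * (h (s * exp (m * v + σ * √v * z)) * z^1) := by
        ext z; ring
      have i3 : Integrable (fun z => (h (s * exp (m * v + σ * √v * z)) * z^2 - h (s * exp (m * v + σ * √v * z)) * z^0) / (2 * v)) gau := (i2.sub i0).div_const _
      rw [this, integral_add i3 (i1.const_mul _), integral_div,
        integral_sub i2 i0, integral_const_mul]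
      unfold Mk; ring
    rw [e1, gau_xi h (fun z => (z^2-1)/(2*v) + m * z/(σ * √v)) hσ hv]
    have j0 : Integrable (fun ξ => h (s * exp ξ) * exp (m * ξ / σ^2) *
      ((ξ^2)^0 * exp (t v * ξ^2))) := by simpa using hint _ ht0
    have j1 : Integrable (fun ξ => h (s * exp ξ) * exp (m * ξ / σ^2) *
      ((ξ^2)^1 * exp (t v * ξ^2))) := by simpa only [pow_one] using hint1
    have e3 : (-(m^2/(2*σ^2)) - 1/(2*v)) * I 0 (t v) + (1/(2*σ^2*v^2)) * I 1 (t v)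
      = ∫ ξ, h (s * exp ξ) * exp (m * ξ / σ^2) *
        (((((ξ - m * v) / (σ * √v))^2-1)/(2*v) + m * ((ξ - m * v) / (σ * √v))/(σ * √v))
          * exp (-(1 / (2 * σ^2 * v)) * ξ^2)) := by
      simp only [hI]
      rw [← integral_const_mul, ← integral_const_mul,
        ← integral_add (j0.const_mul _) (j1.const_mul _)]
      congr 1; ext ξ
      have e4 : ((((ξ - m * v) / (σ * √v))^2-1)/(2*v) + m * ((ξ - m * v) / (σ * √v))/(σ * √v))
        = -(m^2/(2*σ^2)) - 1/(2*v) + (1/(2*σ^2*v^2)) * ξ^2 := by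
        have : √v ^ 2 = v := sq_sqrt hv.le
        have hv' : √v ≠ 0 := by positivity
        rw [← this]
        simp only [sqrt_sq (sqrt_nonneg v)]
        field_simp
        ring
      rw [e4]
      simp only [htdef]
      ring
    rw [← e3]
    ring
  rw [key]
  refine HasDerivAt.congr_of_eventuallyEq ?_ (f₁ := fun v => Mk m σ 0 h s v) (f := fun v => c v * I 0 (t v)) ?_
  · exact hcd.mul hcomp
  · filter_upwards [lt_mem_nhds hv] with w hw using e0 w hw

/-- the lognormal kernel integral is the Gaussian expectation -/
lemma kernel_eq_Mk {r σ v s : ℝ} (h : ℝ → ℝ) (hσ : 0 < σ) (hv : 0 < v) (hs : 0 < s) :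
    ∫ x in Set.Ioi (0:ℝ), h x * lnKernel r σ x s v = Mk (r - σ^2/2) σ 0 h s v := by
  set m := r - σ^2/2 with hm
  have ha : 0 < σ * √v := by positivity
  have hd : ∀ z ∈ (Set.univ : Set ℝ), HasDerivWithinAt (fun z => s * exp (m * v + σ * √v * z))
      (s * (exp (m * v + σ * √v * z) * (σ * √v))) Set.univ z := by
    intro z _
    have h1 : HasDerivAt (fun z => m * v + σ * √v * z) (σ * √v) z := by
      simpa using ((hasDerivAt_id z).const_mul (σ * √v)).const_add (m * v)
    exact (h1.exp.const_mul s).hasDerivWithinAt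
  have hinj : Set.InjOn (fun z => s * exp (m * v + σ * √v * z)) Set.univ := by
    intro a _ b _ hab
    simp only [mul_eq_mul_left_iff, hs.ne', or_false, exp_eq_exp] at hab
    have : σ * √v * a = σ * √v * b := by linarith
    exact mul_left_cancel₀ ha.ne' this
  have him : (fun z => s * exp (m * v + σ * √v * z)) '' Set.univ = Set.Ioi 0 := by
    ext x; constructor
    · rintro ⟨z, _, rfl⟩; exact mul_pos hs (exp_pos _)
    · intro hx
      have hx' : 0 < x := hx
      refine ⟨(log (x/s) - m * v) / (σ * √v), trivial, ?_⟩
      have : m * v + σ * √v * ((log (x/s) - m * v) / (σ * √v)) = log (x/s) := by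
        field_simp; ring
      simp only [this]
      rw [exp_log (by positivity)]; field_simp
  have := integral_image_eq_integral_abs_deriv_smul MeasurableSet.univ hd hinj
    (fun x => h x * lnKernel r σ x s v)
  rw [him] at this
  rw [this, Mk, integral_gau, setIntegral_univ]
  congr 1; ext z
  have hX : 0 < s * exp (m * v + σ * √v * z) := by positivity
  have hL : lnL r σ (s * exp (m * v + σ * √v * z)) s v = z := by
    unfold lnL
    rw [mul_div_assoc, mul_div_left_comm, div_self hs.ne', mul_one, log_exp, ← hm]
    field_simp; ring
  rw [lnKernel, hL, abs_of_pos (by positivity), smul_eq_mul, pow_zero]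
  have hv' : √v ≠ 0 := by positivity
  field_simp

end Part3

section Part4
open ProbabilityTheory Filter Topology

def LogLip (L : ℝ) (h : ℝ → ℝ) : Prop :=
  0 ≤ L ∧ ∀ x x', 0 < x → 0 < x' → |h x - h x'| ≤ L * |log x - log x'| * (1 + max x x')

lemma logLip_pt {m σ T v v' L s s' : ℝ} {h : ℝ → ℝ} (hσ : 0 < σ) (hv : 0 ≤ v) (hvT : v ≤ T)
    (hv' : 0 ≤ v') (hvT' : v' ≤ T) (hs : 0 < s) (hs' : 0 < s') (hL : LogLip L h) (z z' : ℝ)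
    (hz : |z'| ≤ |z|) :
    |h (s * exp (m * v + σ * √v * z)) - h (s' * exp (m * v' + σ * √v' * z'))| ≤
      L * |(log s - log s') + m * (v - v') + σ * (√v * z - √v' * z')| * (1 + max s s') * kap m σ T z := by
  have h1 := hL.2 (s * exp (m * v + σ * √v * z)) (s' * exp (m * v' + σ * √v' * z'))
    (by positivity) (by positivity)
  refine h1.trans ?_
  have e : log (s * exp (m * v + σ * √v * z)) - log (s' * exp (m * v' + σ * √v' * z'))
    = (log s - log s') + m * (v - v') + σ * (√v * z - √v' * z') := by
    rw [log_mul hs.ne' (exp_pos _).ne', log_mul hs'.ne' (exp_pos _).ne', log_exp, log_exp]; ring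
  rw [e, mul_assoc (L * _)]
  have hL0 := hL.1
  refine mul_le_mul_of_nonneg_left ?_ (by positivity)
  have k1 := exp_le_kap (m := m) (z := z) hσ hv hvT
  have k2 := exp_le_kap (m := m) (z := z') hσ hv' hvT'
  have k3 : kap m σ T z' ≤ kap m σ T z := by
    unfold kap; apply exp_le_exp.2; gcongr
  have k4 := one_le_kap (m := m) (T := T) (z := z) hσ (hv.trans hvT)
  have : max (s * exp (m * v + σ * √v * z)) (s' * exp (m * v' + σ * √v' * z'))
    ≤ max s s' * kap m σ T z := by
    apply max_le
    · exact mul_le_mul (le_max_left _ _) k1 (exp_pos _).le (by positivity)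
    · exact mul_le_mul (le_max_right _ _) (k2.trans k3) (exp_pos _).le (by positivity)
  nlinarith

section
variable {m σ T v v' C L s s' : ℝ} {h : ℝ → ℝ}

lemma Mk_lip_s (hσ : 0 < σ) (hv : 0 ≤ v) (hvT : v ≤ T) (hs : 0 < s) (hs' : 0 < s')
    (A : Adm C h) (hL : LogLip L h) :
    |Mk m σ 0 h s v - Mk m σ 0 h s' v| ≤
      L * Bk m σ T 0 * |log s - log s'| * (1 + max s s') := by
  unfold Mk
  rw [← integral_sub (Mk_integrable hσ hv hvT hs A 0) (Mk_integrable hσ hv hvT hs' A 0),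
    ← Real.norm_eq_abs]
  have : L * Bk m σ T 0 * |log s - log s'| * (1 + max s s')
    = ∫ z, (L * |log s - log s'| * (1 + max s s')) * (kap m σ T z * |z|^0) ∂gau := by
    rw [integral_const_mul]; unfold Bk; ring
  rw [this]
  refine norm_integral_le_of_norm_le ((kap_pow_integrable m σ T 0).const_mul _)
    (ae_of_all _ fun z => ?_)
  have := logLip_pt (m := m) hσ hv hvT hv hvT hs hs' hL z z le_rfl
  simpa [mul_assoc] using this

lemma abs_sub_le_sqrt {v v' T : ℝ} (hv : 0 ≤ v) (hvT : v ≤ T) (hv' : 0 ≤ v') (hvT' : v' ≤ T) :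
    |v - v'| ≤ 2 * √T * |√v - √v'| := by
  have e : v - v' = (√v + √v') * (√v - √v') := by
    have := sq_sqrt hv; have := sq_sqrt hv'; nlinarith
  rw [e, abs_mul, abs_of_nonneg (by positivity)]
  have := sqrt_le_sqrt hvT; have := sqrt_le_sqrt hvT'
  gcongr; linarith

lemma Mk_lip_v (hσ : 0 < σ) (hv : 0 ≤ v) (hvT : v ≤ T) (hv' : 0 ≤ v') (hvT' : v' ≤ T)
    (hs : 0 < s) (A : Adm C h) (hL : LogLip L h) :
    |Mk m σ 0 h s v - Mk m σ 0 h s v'| ≤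
      L * (1 + s) * (2 * √T * |m| * Bk m σ T 0 + σ * Bk m σ T 1) * |√v - √v'| := by
  unfold Mk
  rw [← integral_sub (Mk_integrable hσ hv hvT hs A 0) (Mk_integrable hσ hv' hvT' hs A 0),
    ← Real.norm_eq_abs]
  have hL0 := hL.1
  have : L * (1 + s) * (2 * √T * |m| * Bk m σ T 0 + σ * Bk m σ T 1) * |√v - √v'|
    = ∫ z, (L * (1 + s) * |√v - √v'| * (2 * √T * |m|)) * (kap m σ T z * |z|^0) + 
       (L * (1 + s) * |√v - √v'| * σ) * (kap m σ T z * |z|^1) ∂gau := by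
    rw [integral_add ((kap_pow_integrable m σ T 0).const_mul _)
      ((kap_pow_integrable m σ T 1).const_mul _), integral_const_mul, integral_const_mul]
    unfold Bk; ring
  rw [this]
  refine norm_integral_le_of_norm_le (((kap_pow_integrable m σ T 0).const_mul _).add
    ((kap_pow_integrable m σ T 1).const_mul _)) (ae_of_all _ fun z => ?_)
  have h1 := logLip_pt (m := m) hσ hv hvT hv' hvT' hs hs hL z z le_rfl
  have h2 := abs_sub_le_sqrt hv hvT hv' hvT'
  have h3 : |(log s - log s) + m * (v - v') + σ * (√v * z - √v' * z)|
    ≤ |√v - √v'| * (2 * √T * |m| + σ * |z|) := by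
    rw [sub_self, zero_add]
    refine (abs_add_le _ _).trans ?_
    rw [abs_mul, abs_mul, ← sub_mul, abs_mul, abs_of_pos hσ]
    nlinarith [abs_nonneg m]
  have hk : 0 ≤ kap m σ T z := (exp_pos _).le
  simp only [pow_zero, mul_one, pow_one, Real.norm_eq_abs]
  rw [max_self] at h1
  calc _ ≤ _ := h1
    _ ≤ L * (|√v - √v'| * (2 * √T * |m| + σ * |z|)) * (1 + s) * kap m σ T z := by gcongr
    _ = _ := by ring

lemma gau_sq : ∫ z, z^2 ∂gau = 1 := by
  have := variance_fun_id_gaussianReal (μ := 0) (v := 1)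
  rw [variance_eq_integral (by fun_prop)] at this
  simpa using this

lemma Mk_lip_2 (hσ : 0 < σ) (hv : 0 ≤ v) (hvT : v ≤ T)
    (hs : 0 < s) (A : Adm C h) (hL : LogLip L h) :
    |Mk m σ 2 h s v - Mk m σ 0 h s v| ≤
      L * (1 + s) * (Bk m σ T 3 + Bk m σ T 1) * (σ * √v) := by
  have hL0 := hL.1
  have i2 := Mk_integrable (m := m) hσ hv hvT hs A 2
  have i0 := Mk_integrable (m := m) hσ hv hvT hs A 0
  have i3 : Integrable (fun z : ℝ => z^2) gau := by
    have := gau_exp_pow_integrable 0 2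
    simpa using this
  have i4 : Integrable (fun z : ℝ => h (s * exp (m * v)) * (z^2 - 1)) gau :=
    (i3.sub (integrable_const 1)).const_mul _
  have hz : ∫ z : ℝ, h (s * exp (m * v)) * (z^2 - 1) ∂gau = 0 := by
    rw [integral_const_mul, integral_sub i3 (integrable_const 1), gau_sq]; simp
  have e : Mk m σ 2 h s v - Mk m σ 0 h s v = ∫ z, (h (s * exp (m * v + σ * √v * z))
      - h (s * exp (m * v + σ * √v * 0))) * (z^2 - 1) ∂gau := by
    unfold Mk
    have e2 : (fun z => (h (s * exp (m * v + σ * √v * z))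
      - h (s * exp (m * v + σ * √v * 0))) * (z^2 - 1)) = fun z =>
        (h (s * exp (m * v + σ * √v * z)) * z^2 - h (s * exp (m * v + σ * √v * z)) * z^0)
         - h (s * exp (m * v)) * (z^2 - 1) := by
      ext z; rw [mul_zero, add_zero]; ring
    rw [e2, ← integral_sub i2 i0]
    have i5 : Integrable (fun z => h (s * exp (m * v + σ * √v * z)) * z^2 - h (s * exp (m * v + σ * √v * z)) * z^0) gau := i2.sub i0
    rw [integral_sub i5 i4, hz, sub_zero]
  rw [e, ← Real.norm_eq_abs]
  have : L * (1 + s) * (Bk m σ T 3 + Bk m σ T 1) * (σ * √v)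
    = ∫ z, (L * (1 + s) * (σ * √v)) * (kap m σ T z * |z|^3) + 
       (L * (1 + s) * (σ * √v)) * (kap m σ T z * |z|^1) ∂gau := by
    rw [integral_add ((kap_pow_integrable m σ T 3).const_mul _)
      ((kap_pow_integrable m σ T 1).const_mul _), integral_const_mul, integral_const_mul]
    unfold Bk; ring
  rw [this]
  refine norm_integral_le_of_norm_le (((kap_pow_integrable m σ T 3).const_mul _).add
    ((kap_pow_integrable m σ T 1).const_mul _)) (ae_of_all _ fun z => ?_)
  have h1 := logLip_pt (m := m) hσ hv hvT hv hvT hs hs hL z 0 (by simp)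
  have h3 : |(log s - log s) + m * (v - v) + σ * (√v * z - √v * 0)| = σ * √v * |z| := by
    rw [sub_self, sub_self, mul_zero, mul_zero, sub_zero, zero_add, zero_add, abs_mul, abs_mul,
      abs_of_pos hσ, abs_of_nonneg (sqrt_nonneg _)]; ring
  rw [h3, max_self] at h1
  have hk : 0 ≤ kap m σ T z := (exp_pos _).le
  rw [norm_mul, Real.norm_eq_abs, Real.norm_eq_abs]
  have h4 : |z^2 - 1| ≤ |z|^2 + 1 := by
    refine (abs_sub _ _).trans ?_
    simp
  calc _ ≤ (L * (σ * √v * |z|) * (1 + s) * kap m σ T z) * (|z|^2 + 1) := by gcongr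
    _ = _ := by ring

lemma Mk_lip_growth (hσ : 0 < σ) (hv : 0 < v) (hvT : v ≤ T) (hs : 0 < s) (hs' : 0 < s')
    (A : Adm C h) :
    |Mk m σ 0 h s v - Mk m σ 0 h s' v| ≤
      C * Bk m σ T 1 / σ * |log s - log s'| * (1 + max s s') * (√v)⁻¹ := by
  have hsv : 0 < √v := by positivity
  have hmax : 0 < max s s' := lt_max_of_lt_left hs
  have hd : ∀ l ∈ Set.Iic (log (max s s')), HasDerivWithinAt (fun l => Mk m σ 0 h (exp l) v)
      (Mk m σ 1 h (exp l) v / (σ * √v)) (Set.Iic (log (max s s'))) l := by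
    intro l _
    have := HasDerivAt.comp l (h₂ := fun s => Mk m σ 0 h s v)
      (Mk0_deriv_s (m := m) hσ hv (exp_pos l) A) (Real.hasDerivAt_exp l)
    refine HasDerivAt.hasDerivWithinAt ?_
    convert! this using 1
    have := exp_pos l
    field_simp
  have hb : ∀ l ∈ Set.Iic (log (max s s')), ‖Mk m σ 1 h (exp l) v / (σ * √v)‖ ≤
      C * (1 + max s s') * Bk m σ T 1 / (σ * √v) := by
    intro l hl
    rw [norm_div, Real.norm_eq_abs, Real.norm_eq_abs, abs_of_pos (a := σ * √v) (by positivity)]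
    gcongr
    refine (Mk_bound hσ hv.le hvT (exp_pos l) A 1).trans ?_
    have : exp l ≤ max s s' := by
      rw [← exp_log hmax]; exact exp_le_exp.2 hl
    have := Bk_nonneg m σ T 1
    have := A.hC
    gcongr
  have h1 : log s ∈ Set.Iic (log (max s s')) := log_le_log hs (le_max_left _ _)
  have h2 : log s' ∈ Set.Iic (log (max s s')) := log_le_log hs' (le_max_right _ _)
  have := (convex_Iic _).norm_image_sub_le_of_norm_hasDerivWithin_le hd hb h2 h1
  simp only [exp_log hs, exp_log hs', Real.norm_eq_abs] at this
  refine this.trans (le_of_eq ?_)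
  field_simp

end

end Part4

section Part5
open ProbabilityTheory Filter Topology

noncomputable def payoff (K x : ℝ) : ℝ := max (x - K) 0

lemma payoff_adm {K : ℝ} (hK : 0 < K) : Adm 1 (payoff K) where
  hC := zero_le_one
  meas := by unfold payoff; fun_prop
  nn := fun x => le_max_right _ _
  gr := fun x hx => by unfold payoff; apply max_le <;> linarith

lemma sub_le_max_log {x x' : ℝ} (hx : 0 < x) (hx' : 0 < x') :
    |x - x'| ≤ |log x - log x'| * max x x' := by
  have key : ∀ a b : ℝ, 0 < a → 0 < b → a ≤ b → b - a ≤ (log b - log a) * b := by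
    intro a b ha hb hab
    have h1 := one_sub_inv_le_log_of_pos (x := b / a) (by positivity)
    rw [log_div hb.ne' ha.ne', inv_div] at h1
    have h2 := mul_le_mul_of_nonneg_right h1 hb.le
    have h3 : (1 - a / b) * b = b - a := by field_simp
    linarith
  rcases le_total x x' with h | h
  · rw [max_eq_right h, abs_sub_comm, abs_of_nonneg (by linarith), abs_sub_comm,
      abs_of_nonneg (sub_nonneg.2 (log_le_log hx h))]
    exact key _ _ hx hx' h
  · rw [max_eq_left h, abs_of_nonneg (by linarith),
      abs_of_nonneg (sub_nonneg.2 (log_le_log hx' h))]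
    exact key _ _ hx' hx h

lemma payoff_lip (K : ℝ) : LogLip 1 (payoff K) := by
  refine ⟨zero_le_one, fun x x' hx hx' => ?_⟩
  have h1 : |payoff K x - payoff K x'| ≤ |x - x'| := by
    unfold payoff
    have := abs_max_sub_max_le_abs (x - K) (x' - K) 0
    simpa using this
  have h2 := sub_le_max_log hx hx'
  have h3 := abs_nonneg (log x - log x')
  nlinarith

lemma cdf_eq (d : ℝ) : stdNormalCDF d = ∫ z, (Set.Ioi (-d)).indicator 1 z ∂gau := by
  rw [integral_gau]
  have e : (fun z => (√(2*π))⁻¹ * exp (-z^2/2) * (Set.Ioi (-d)).indicator (1 : ℝ → ℝ) z)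
    = (Set.Ioi (-d)).indicator (fun z => exp (-z^2/2) / √(2*π)) := by
    ext z
    by_cases hz : z ∈ Set.Ioi (-d)
    · rw [indicator_of_mem hz, indicator_of_mem hz]; simp; ring
    · rw [indicator_of_notMem hz, indicator_of_notMem hz]; simp
  rw [e, integral_indicator measurableSet_Ioi, stdNormalCDF]
  have := integral_comp_neg_Iic d (fun u => exp (-u^2/2) / √(2*π))
  rw [← this]
  simp

lemma bs_eq {r σ K T t s : ℝ} (hσ : 0 < σ) (hK : 0 < K) (hs : 0 < s) (ht : t ≤ T) :
    bsPrice r σ K T t s = exp (-r * (T - t)) * Mk (r - σ^2/2) σ 0 (payoff K) s (T - t) := by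
  rcases ht.eq_or_lt with rfl | ht
  · simp [bsPrice, hs.not_ge, Mk, payoff]
  set τ := T - t with hτ
  have hτ0 : 0 < τ := by linarith
  have hsq : √τ ^ 2 = τ := sq_sqrt hτ0.le
  set a := σ * √τ with ha
  have ha0 : 0 < a := by positivity
  set m := r - σ^2/2 with hm
  set d1 := (log (s / K) + (r + σ ^ 2 / 2) * τ) / a with hd1
  have hda : d1 * a = log (s / K) + (r + σ ^ 2 / 2) * τ := by rw [hd1]; field_simp
  have haa : a * a = σ^2 * τ := by rw [ha]; nlinarith
  have hbs : bsPrice r σ K T t s = s * stdNormalCDF d1 - K * exp (-r * τ) * stdNormalCDF (d1 - a) := by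
    simp [bsPrice, hs.not_ge, ht, hd1, ha, hτ]
  rw [hbs, cdf_eq, cdf_eq]
  have hsh := gau_shift ((Set.Ioi (-(d1 - a))).indicator 1) a
  have e1 : (fun z => (Set.Ioi (-(d1 - a))).indicator (1 : ℝ → ℝ) (z + a)) = (Set.Ioi (-d1)).indicator 1 := by
    ext z
    simp only [Set.indicator, Set.mem_Ioi]
    congr 1
    apply propext; constructor <;> intro h <;> linarith
  rw [e1] at hsh
  rw [hsh]
  have i1 : Integrable (fun z => (Set.Ioi (-(d1 - a))).indicator (1 : ℝ → ℝ) z * exp (a * z - a^2/2)) gau := by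
    have : Integrable (fun z => exp (a * z - a^2/2)) gau := by
      have := (integrable_exp_mul_gaussianReal (μ := 0) (v := 1) a).mul_const (exp (-(a^2/2)))
      refine this.congr (ae_of_all _ fun z => ?_)
      simp only [sub_eq_add_neg, exp_add]
    refine (this.indicator (s := Set.Ioi (-(d1 - a))) measurableSet_Ioi).congr (ae_of_all _ fun z => ?_)
    simp [Set.indicator]
  have i0 : Integrable ((Set.Ioi (-(d1 - a))).indicator (1 : ℝ → ℝ)) gau :=
    (integrable_const (1:ℝ)).indicator measurableSet_Ioi
  unfold Mk
  rw [← integral_const_mul, ← integral_const_mul, ← integral_const_mul,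
    ← integral_sub (i1.const_mul _) (i0.const_mul _)]
  congr 1; ext z
  have eX : s * exp (m * τ + a * z) = exp (r * τ) * (s * exp (a * z - a^2/2)) := by
    rw [mul_left_comm, ← exp_add]; congr 2
    have : a^2 = σ^2 * τ := by rw [sq]; exact haa
    rw [this, hm]; ring
  have hE : exp (-r * τ) * exp (r * τ) = 1 := by rw [← exp_add]; simp
  have hX0 : 0 < s * exp (m * τ + a * z) := by positivity
  have hlog : log (s * exp (m * τ + a * z)) - log K = a * (z + (d1 - a)) := by
    rw [log_mul hs.ne' (exp_pos _).ne', log_exp]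
    have : a * (z + (d1 - a)) = a * z + d1 * a - a * a := by ring
    rw [this, hda, haa, log_div hs.ne' hK.ne', hm]; ring
  by_cases hz : -(d1 - a) < z
  · have h1 : K ≤ s * exp (m * τ + a * z) := by
      rw [← log_le_log_iff hK hX0]
      have : 0 < a * (z + (d1 - a)) := mul_pos ha0 (by linarith)
      linarith
    rw [payoff, max_eq_left (by linarith), eX]
    simp only [Set.indicator, Set.mem_Ioi, hz, if_true, Pi.one_apply, pow_zero, mul_one]
    linear_combination (-(s * rexp (a * z - a ^ 2 / 2))) * hE
  · have h1 : s * exp (m * τ + a * z) ≤ K := by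
      rw [← log_le_log_iff hX0 hK]
      have : a * (z + (d1 - a)) ≤ 0 := mul_nonpos_of_nonneg_of_nonpos ha0.le (by linarith)
      linarith
    rw [payoff, max_eq_right (by linarith)]
    simp only [Set.indicator, Set.mem_Ioi, hz, if_false]
    ring

end Part5

section Part6
open ProbabilityTheory Filter Topology

lemma inv_sqrt_integrableOn (τ : ℝ) : IntegrableOn (fun v : ℝ => (√v)⁻¹) (Set.Ioo 0 τ) := by
  by_cases hτ : 0 ≤ τ
  · have h := intervalIntegral.intervalIntegrable_rpow' (a := 0) (b := τ) (r := -(1/2)) (by norm_num)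
    rw [intervalIntegrable_iff_integrableOn_Ioo_of_le hτ] at h
    refine h.congr_fun (fun v hv => ?_) measurableSet_Ioo
    simp only
    rw [rpow_neg hv.1.le, sqrt_eq_rpow]
  · rw [Set.Ioo_eq_empty (by intro h; exact hτ h.le)]; simp

/-- A time-dependent source. -/
structure Src (C : ℝ) (q : ℝ → ℝ → ℝ) : Prop where
  hC : 0 ≤ C
  meas : Measurable (fun z : ℝ × ℝ => q z.1 z.2)
  nn : ∀ u x, 0 ≤ q u x
  gr : ∀ u x, 0 < x → q u x ≤ C * (1 + x)

lemma Src.adm {C : ℝ} {q : ℝ → ℝ → ℝ} (S : Src C q) (u : ℝ) : Adm C (q u) where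
  hC := S.hC
  meas := S.meas.comp (measurable_const.prodMk measurable_id)
  nn := S.nn u
  gr := S.gr u

lemma Mk_measurable {C : ℝ} {q : ℝ → ℝ → ℝ} (S : Src C q) (m σ s : ℝ) (n : ℕ) {ρ θ : ℝ → ℝ}
    (hρ : Measurable ρ) (hθ : Measurable θ) :
    Measurable (fun u => Mk m σ n (q (θ u)) s (ρ u)) := by
  unfold Mk
  refine (StronglyMeasurable.integral_prod_right (f := fun u z =>
    q (θ u) (s * exp (m * ρ u + σ * √(ρ u) * z)) * z ^ n) ?_).measurable
  refine Measurable.stronglyMeasurable ?_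
  have h1 : Measurable (fun p : ℝ × ℝ => (θ p.1, s * exp (m * ρ p.1 + σ * √(ρ p.1) * p.2))) := by
    fun_prop
  have h2 := S.meas.comp h1
  exact h2.mul (by fun_prop)

/-- differentiation of the time-potential -/
lemma time_potential {T t0 C : ℝ} (ht0 : 0 < t0) (htT : t0 < T) (w w' : ℝ → ℝ → ℝ)
    (hC : 0 ≤ C)
    (hH : ∀ u ∈ Set.Ioo 0 T, ∀ v v', 0 ≤ v → v ≤ T → 0 ≤ v' → v' ≤ T →
      |w u v - w u v'| ≤ C * |√v - √v'|)
    (hder : ∀ u ∈ Set.Ioo 0 T, ∀ v, 0 < v → v < T → HasDerivAt (w u) (w' u v) v)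
    (hmeas : ∀ t, AEStronglyMeasurable (fun u => w u (max (u - t) 0)) (volume.restrict (Set.Ioo 0 T)))
    (hmeas' : AEStronglyMeasurable (fun u => w' u (u - t0)) (volume.restrict (Set.Ioo 0 T)))
    (hmeas0 : AEStronglyMeasurable (fun u => w u 0) (volume.restrict (Set.Ioo 0 T)))
    (hcont : ContinuousOn (fun u => w u 0) (Set.Ioo 0 T))
    (hbd : ∀ u ∈ Set.Ioo 0 T, |w u 0| ≤ C) :
    HasDerivAt (fun t => ∫ u in Set.Ioo t T, w u (u - t))
      (-(w t0 0) - ∫ u in Set.Ioo t0 T, w' u (u - t0)) t0 := by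
  have hT : 0 < T := ht0.trans htT
  have hwb : ∀ u ∈ Set.Ioo 0 T, ∀ v, 0 ≤ v → v ≤ T → ‖w u v‖ ≤ C * √T + C := by
    intro u hu v hv hvT
    have h1 := hH u hu v 0 hv hvT le_rfl hT.le
    have h2 := hbd u hu
    rw [sqrt_zero, sub_zero, abs_of_nonneg (sqrt_nonneg v)] at h1
    have h3 : C * √v ≤ C * √T := by gcongr
    rw [Real.norm_eq_abs]
    have := abs_sub_abs_le_abs_sub (w u v) (w u 0)
    linarith
  have hi0 : IntegrableOn (fun u => w u 0) (Set.Ioo 0 T) := by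
    refine Integrable.of_bound hmeas0 C ?_
    exact (ae_restrict_iff' measurableSet_Ioo).2 (ae_of_all _ hbd)
  have hit : ∀ t, 0 ≤ t → IntegrableOn (fun u => w u (max (u - t) 0)) (Set.Ioo 0 T) := by
    intro t ht
    refine Integrable.of_bound (hmeas t) (C * √T + C) ?_
    refine (ae_restrict_iff' measurableSet_Ioo).2 (ae_of_all _ fun u hu => ?_)
    exact hwb u hu _ (le_max_right _ _) (max_le (by linarith [hu.2]) hT.le)
  -- decomposition
  have hdec : ∀ t ∈ Set.Ioo 0 T, ∫ u in Set.Ioo t T, w u (u - t)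
      = (∫ u in Set.Ioo 0 T, w u (max (u - t) 0)) - ∫ u in (0:ℝ)..t, w u 0 := by
    intro t ht
    have h1 : Set.Ioo 0 T = Set.Ioc 0 t ∪ Set.Ioo t T := (Set.Ioc_union_Ioo_eq_Ioo ht.1.le ht.2).symm
    have hd : Disjoint (Set.Ioc 0 t) (Set.Ioo t T) := by
      rw [Set.disjoint_left]; rintro x hx hx'; exact absurd hx'.1 (not_lt.2 hx.2)
    have hi := hit t ht.1.le
    rw [h1] at hi ⊢
    rw [setIntegral_union hd measurableSet_Ioo hi.left_of_union hi.right_of_union,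
      intervalIntegral.integral_of_le ht.1.le]
    have e1 : ∫ u in Set.Ioc 0 t, w u (max (u - t) 0) = ∫ u in Set.Ioc 0 t, w u 0 :=
      setIntegral_congr_fun measurableSet_Ioc fun u hu => by
        rw [max_eq_right (by linarith [hu.2])]
    have e2 : ∫ u in Set.Ioo t T, w u (max (u - t) 0) = ∫ u in Set.Ioo t T, w u (u - t) :=
      setIntegral_congr_fun measurableSet_Ioo fun u hu => by
        rw [max_eq_left (by linarith [hu.1])]
    rw [e1, e2]; ring
  have hev : (fun t => ∫ u in Set.Ioo t T, w u (u - t)) =ᶠ[𝓝 t0] fun t =>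
      (∫ u in Set.Ioo 0 T, w u (max (u - t) 0)) - ∫ u in (0:ℝ)..t, w u 0 := by
    filter_upwards [Ioo_mem_nhds ht0 htT] with t ht using hdec t ht
  refine HasDerivAt.congr_of_eventuallyEq ?_ hev
  -- FTC part
  have hftc : HasDerivAt (fun t => ∫ u in (0:ℝ)..t, w u 0) (w t0 0) t0 := by
    apply intervalIntegral.integral_hasDerivAt_right
    · rw [intervalIntegrable_iff_integrableOn_Ioo_of_le ht0.le]
      exact hi0.mono_set (Set.Ioo_subset_Ioo le_rfl htT.le)
    · exact ⟨Set.Ioo 0 T, Ioo_mem_nhds ht0 htT, hmeas0⟩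
    · exact hcont.continuousAt (Ioo_mem_nhds ht0 htT)
  have hmain : HasDerivAt (fun t => ∫ u in Set.Ioo 0 T, w u (max (u - t) 0))
      (- ∫ u in Set.Ioo t0 T, w' u (u - t0)) t0 := by
    set G' : ℝ → ℝ := (Set.Ioi t0).indicator (fun u => - w' u (u - t0)) with hG'
    have hval : (- ∫ u in Set.Ioo t0 T, w' u (u - t0)) = ∫ u in Set.Ioo 0 T, G' u := by
      rw [hG', setIntegral_indicator measurableSet_Ioi, ← integral_neg]
      congr 2
      ext u; simp only [Set.mem_Ioo, Set.mem_inter_iff, Set.mem_Ioi]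
      constructor
      · rintro ⟨h1, h2⟩; exact ⟨⟨by linarith, h2⟩, h1⟩
      · rintro ⟨⟨h1, h2⟩, h3⟩; exact ⟨h3, h2⟩
    have hb : IntegrableOn (fun u => C * (√|u - t0|)⁻¹) (Set.Ioo 0 T) := by
      have h1 : IntegrableOn (fun u => (√(u - t0))⁻¹) (Set.Ioo t0 T) := by
        have := (inv_sqrt_integrableOn (T - t0))
        have h2 := (measurePreserving_sub_right volume t0).integrableOn_comp_preimage
          (MeasurableEquiv.subRight t0).measurableEmbedding (f := fun v : ℝ => (√v)⁻¹) (s := Set.Ioo 0 (T - t0))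
        have h3 := h2.2 this
        simpa [Function.comp_def] using h3
      have h1' : IntegrableOn (fun u => (√(t0 - u))⁻¹) (Set.Ioo 0 t0) := by
        have := (inv_sqrt_integrableOn t0)
        have h2 := (Measure.measurePreserving_sub_left volume t0).integrableOn_comp_preimage
          (MeasurableEquiv.subLeft t0).measurableEmbedding (f := fun v : ℝ => (√v)⁻¹) (s := Set.Ioo 0 t0)
        have h3 := h2.2 this
        simpa [Function.comp_def] using h3
      have hu : IntegrableOn (fun u => (√|u - t0|)⁻¹) (Set.Ioo 0 t0 ∪ Set.Ioo t0 T) := by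
        refine IntegrableOn.union ?_ ?_
        · refine h1'.congr_fun (fun u hu => ?_) measurableSet_Ioo
          simp only; rw [abs_of_nonpos (by linarith [hu.2])]; ring_nf
        · refine h1.congr_fun (fun u hu => ?_) measurableSet_Ioo
          simp only; rw [abs_of_nonneg (by linarith [hu.1])]
      have hu2 : IntegrableOn (fun u => (√|u - t0|)⁻¹) (Set.Ioo 0 T) := by
        refine hu.congr_set_ae ?_
        have hne : ∀ᵐ u ∂(volume : Measure ℝ), u ≠ t0 := by
          simp [ae_iff]
        filter_upwards [hne] with u hne
        apply propext
        show u ∈ Set.Ioo 0 T ↔ u ∈ Set.Ioo 0 t0 ∪ Set.Ioo t0 T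
        constructor
        · rintro ⟨h1, h2⟩
          rcases lt_or_gt_of_ne hne with h | h
          · exact Or.inl ⟨h1, h⟩
          · exact Or.inr ⟨h, h2⟩
        · rintro (⟨h1, h2⟩ | ⟨h1, h2⟩)
          · exact ⟨h1, by linarith⟩
          · exact ⟨by linarith, h2⟩
      exact hu2.const_mul C
    rw [hval]
    have hne : ∀ᵐ u ∂(volume.restrict (Set.Ioo 0 T)), u ∈ Set.Ioo 0 T ∧ u ≠ t0 := by
      have h1 : ∀ᵐ u ∂(volume : Measure ℝ), u ≠ t0 := by simp [ae_iff]
      filter_upwards [ae_restrict_mem measurableSet_Ioo, ae_restrict_of_ae h1] with u h1 h2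
      exact ⟨h1, h2⟩
    have key := hasFDerivAt_integral_of_dominated_loc_of_lip' (𝕜 := ℝ)
      (μ := volume.restrict (Set.Ioo 0 T)) (F := fun t u => w u (max (u - t) 0)) (x₀ := t0)
      (bound := fun u => C * (√|u - t0|)⁻¹) (s := Set.Ioo 0 T)
      (F' := fun u => ContinuousLinearMap.toSpanSingleton ℝ (G' u))
      (Ioo_mem_nhds ht0 htT) (fun t _ => hmeas t) (hit t0 ht0.le)
      ?_ ?_ hb ?_
    · have h2 := key.2
      rw [hasDerivAt_iff_hasFDerivAt]
      convert! h2 using 1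
      have hint : Integrable G' (volume.restrict (Set.Ioo 0 T)) := by
        have := key.1.norm
        have hm : AEStronglyMeasurable G' (volume.restrict (Set.Ioo 0 T)) :=
          (hmeas'.neg).indicator measurableSet_Ioi
        refine this.mono' hm (ae_of_all _ fun u => ?_)
        simp
      exact (ContinuousLinearMap.integral_comp_comm (ContinuousLinearMap.toSpanSingletonCLE (𝕜 := ℝ) (E := ℝ)).toContinuousLinearMap hint).symm
    · have hm : AEStronglyMeasurable G' (volume.restrict (Set.Ioo 0 T)) :=
          (hmeas'.neg).indicator measurableSet_Ioi
      exact (ContinuousLinearMap.toSpanSingletonCLE (𝕜 := ℝ) (E := ℝ)).continuous.comp_aestronglyMeasurable hm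
    · filter_upwards [hne] with u ⟨hu, hne⟩ t ht
      have h1 := hH u hu (max (u - t) 0) (max (u - t0) 0) (le_max_right _ _)
        (max_le (by linarith [hu.2, ht.1]) hT.le) (le_max_right _ _)
        (max_le (by linarith [hu.2]) hT.le)
      rw [Real.norm_eq_abs, Real.norm_eq_abs]
      refine h1.trans ?_
      rw [mul_assoc]
      refine mul_le_mul_of_nonneg_left ?_ hC
      have hpos : 0 < |u - t0| := abs_pos.2 (sub_ne_zero.2 hne)
      rw [inv_mul_eq_div, le_div_iff₀ (by positivity)]
      set A := √(max (u - t) 0) with hA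
      set B := √(max (u - t0) 0) with hB
      have hA2 : A^2 = max (u - t) 0 := sq_sqrt (le_max_right _ _)
      have hB2 : B^2 = max (u - t0) 0 := sq_sqrt (le_max_right _ _)
      have hA0 : 0 ≤ A := sqrt_nonneg _
      have hB0 : 0 ≤ B := sqrt_nonneg _
      rcases lt_or_gt_of_ne hne with h | h
      · -- u < t0, B = 0
        have hB00 : B = 0 := by rw [hB, max_eq_right (by linarith)]; simp
        rw [hB00, sub_zero, abs_of_nonneg hA0]
        rcases le_total (u - t) 0 with h3 | h3
        · have : A = 0 := by rw [hA, max_eq_right h3]; simp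
          rw [this, zero_mul]; positivity
        · rw [max_eq_left h3] at hA2
          have e1 : √|u - t0| = √(t0 - u) := by rw [abs_of_neg (by linarith)]; ring_nf
          rw [e1, abs_of_nonpos (by linarith)]
          set D := √(t0 - u) with hD
          have hD2 : D^2 = t0 - u := sq_sqrt (by linarith)
          have hD0 : 0 ≤ D := sqrt_nonneg _
          nlinarith [sq_nonneg (A - D)]
      · rw [max_eq_left (by linarith)] at hB2
        have e1 : √|u - t0| = B := by
          rw [hB, abs_of_pos (by linarith), max_eq_left (by linarith)]
        rw [e1]
        have h4 : |A - B| * B ≤ |A^2 - B^2| := by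
          have : A^2 - B^2 = (A - B) * (A + B) := by ring
          rw [this, abs_mul, abs_of_nonneg (add_nonneg hA0 hB0)]
          gcongr; linarith
        refine h4.trans ?_
        rw [hA2, hB2]
        have h5 : u - t0 = max (u - t0) 0 := (max_eq_left (by linarith)).symm
        rw [h5]
        refine (abs_max_sub_max_le_abs _ _ _).trans ?_
        rw [abs_sub_comm]; apply le_of_eq; congr 1; ring
    · filter_upwards [hne] with u ⟨hu, hne⟩
      have : HasDerivAt (fun t => w u (max (u - t) 0)) (G' u) t0 := by
        rcases lt_or_gt_of_ne hne with h | h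
        · have hz : G' u = 0 := by
            rw [hG', Set.indicator_of_notMem]; simpa using h.le
          rw [hz]
          refine (hasDerivAt_const t0 (w u 0)).congr_of_eventuallyEq ?_
          filter_upwards [lt_mem_nhds h] with t ht
          rw [max_eq_right (by linarith)]
        · have hz : G' u = w' u (u - t0) * (-1) := by
            rw [hG', Set.indicator_of_mem (by simpa using h)]; ring
          rw [hz]
          have hd := hder u hu (u - t0) (by linarith) (by linarith [hu.2])
          have h2 : HasDerivAt (fun t => u - t) (-1) t0 := by
            simpa using (hasDerivAt_id t0).const_sub u
          refine (HasDerivAt.comp t0 (h₂ := w u) hd h2).congr_of_eventuallyEq ?_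
          filter_upwards [gt_mem_nhds h] with t ht
          simp only [Function.comp]
          rw [max_eq_left (by linarith)]
      exact this.hasFDerivAt
  convert! hmain.sub hftc using 1
  ring

end Part6

section Part7
open ProbabilityTheory Filter Topology

/-- first space derivative of `Mk 0` -/
noncomputable def D1 (m σ : ℝ) (h : ℝ → ℝ) (s v : ℝ) : ℝ := Mk m σ 1 h s v / (σ * √v * s)
/-- second space derivative of `Mk 0` -/
noncomputable def D2 (m σ : ℝ) (h : ℝ → ℝ) (s v : ℝ) : ℝ :=
  ((Mk m σ 2 h s v - Mk m σ 0 h s v) - Mk m σ 1 h s v * (σ * √v)) / (σ * √v * s) ^ 2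

lemma D1_bound {m σ T v C s0 s : ℝ} {h : ℝ → ℝ} (hσ : 0 < σ) (hv : 0 < v) (hvT : v ≤ T)
    (hs0 : 0 < s0) (hs : s ∈ Set.Ioo (s0 / 2) (2 * s0)) (A : Adm C h) :
    |D1 m σ h s v| ≤ C * (1 + 2 * s0) * Bk m σ T 1 / (σ * (s0 / 2)) * (√v)⁻¹ := by
  have hsp : 0 < s := lt_trans (by positivity) hs.1
  have hsv : 0 < √v := sqrt_pos.2 hv
  unfold D1
  rw [abs_div, abs_of_pos (by positivity : 0 < σ * √v * s)]
  have h1 := Mk_bound (m := m) hσ hv.le hvT hsp A 1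
  have hB := Bk_nonneg m σ T 1
  have hC := A.hC
  have e : C * (1 + 2 * s0) * Bk m σ T 1 / (σ * (s0 / 2)) * (√v)⁻¹
      = C * (1 + 2 * s0) * Bk m σ T 1 / (σ * √v * (s0 / 2)) := by
    field_simp
  rw [e]
  have h2 : C * (1 + s) * Bk m σ T 1 ≤ C * (1 + 2 * s0) * Bk m σ T 1 := by
    gcongr; exact hs.2.le
  have h3 : s0 / 2 ≤ s := hs.1.le
  apply div_le_div₀ (by positivity) (h1.trans h2) (by positivity)
  gcongr

lemma D2_bound {m σ T v C L s0 s : ℝ} {h : ℝ → ℝ} (hσ : 0 < σ) (hv : 0 < v) (hvT : v ≤ T)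
    (hs0 : 0 < s0) (hs : s ∈ Set.Ioo (s0 / 2) (2 * s0)) (A : Adm C h) (hL : LogLip L h) :
    |D2 m σ h s v| ≤ (L * (1 + 2 * s0) * (Bk m σ T 3 + Bk m σ T 1) + C * (1 + 2 * s0) * Bk m σ T 1)
      / (σ * (s0 / 2) ^ 2) * (√v)⁻¹ := by
  have hsp : 0 < s := lt_trans (by positivity) hs.1
  have hsv : 0 < √v := sqrt_pos.2 hv
  unfold D2
  rw [abs_div, abs_of_pos (by positivity : 0 < (σ * √v * s) ^ 2)]
  have h1 := Mk_bound (m := m) hσ hv.le hvT hsp A 1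
  have h1' := Mk_lip_2 (m := m) hσ hv.le hvT hsp A hL
  have hB := Bk_nonneg m σ T 1
  have hB3 := Bk_nonneg m σ T 3
  have hC := A.hC
  have hL0 := hL.1
  set Q := (L * (1 + 2 * s0) * (Bk m σ T 3 + Bk m σ T 1) + C * (1 + 2 * s0) * Bk m σ T 1) with hQ
  have hQ0 : 0 ≤ Q := by positivity
  have e : Q / (σ * (s0 / 2) ^ 2) * (√v)⁻¹ = Q * (σ * √v) / (σ * √v * (s0 / 2)) ^ 2 := by
    field_simp
  rw [e]
  have h3 : s0 / 2 ≤ s := hs.1.le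
  apply div_le_div₀ (by positivity) _ (by positivity)
  · gcongr
  · have h2 : C * (1 + s) * Bk m σ T 1 ≤ C * (1 + 2 * s0) * Bk m σ T 1 := by
      gcongr; exact hs.2.le
    have h2' : L * (1 + s) * (Bk m σ T 3 + Bk m σ T 1) * (σ * √v) ≤
        L * (1 + 2 * s0) * (Bk m σ T 3 + Bk m σ T 1) * (σ * √v) := by
      gcongr; exact hs.2.le
    have h5 : |Mk m σ 1 h s v * (σ * √v)| ≤ C * (1 + 2 * s0) * Bk m σ T 1 * (σ * √v) := by
      rw [abs_mul, abs_of_pos (by positivity : 0 < σ * √v)]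
      gcongr; exact h1.trans h2
    have h6 := abs_sub (Mk m σ 2 h s v - Mk m σ 0 h s v) (Mk m σ 1 h s v * (σ * √v))
    rw [hQ, add_mul]
    linarith

lemma D1_deriv {m σ v C s : ℝ} {h : ℝ → ℝ} (hσ : 0 < σ) (hv : 0 < v) (hs : 0 < s)
    (A : Adm C h) : HasDerivAt (fun s => D1 m σ h s v) (D2 m σ h s v) s := by
  have hsv : 0 < √v := sqrt_pos.2 hv
  unfold D1 D2
  have h1 := Mk1_deriv_s (m := m) hσ hv hs A
  have h2 : HasDerivAt (fun s => σ * √v * s) (σ * √v) s := by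
    simpa using (hasDerivAt_id s).const_mul (σ * √v)
  have h3 := h1.div h2 (by positivity)
  convert! h3 using 1
  congr 1
  field_simp

lemma Mk_meas {C : ℝ} {q : ℝ → ℝ → ℝ} (S : Src C q) (m σ s t : ℝ) (n : ℕ) :
    Measurable (fun v => Mk m σ n (q (t + v)) s v) :=
  Mk_measurable S m σ s n measurable_id (measurable_const.add measurable_id)

lemma D1_meas {C : ℝ} {q : ℝ → ℝ → ℝ} (S : Src C q) (m σ s t : ℝ) :
    Measurable (fun v => D1 m σ (q (t + v)) s v) := by
  unfold D1
  exact (Mk_meas S m σ s t 1).div (by fun_prop)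

lemma D2_meas {C : ℝ} {q : ℝ → ℝ → ℝ} (S : Src C q) (m σ s t : ℝ) :
    Measurable (fun v => D2 m σ (q (t + v)) s v) := by
  unfold D2
  exact (((Mk_meas S m σ s t 2).sub (Mk_meas S m σ s t 0)).sub
    ((Mk_meas S m σ s t 1).mul (by fun_prop))).div (by fun_prop)

lemma cMk_int {C m σ T τ s t B : ℝ} {q : ℝ → ℝ → ℝ} {c : ℝ → ℝ} (hσ : 0 < σ) (hτT : τ ≤ T)
    (hs : 0 < s) (S : Src C q) (hc : Measurable c) (hcB : ∀ v ∈ Set.Ioo 0 τ, |c v| ≤ B) :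
    IntegrableOn (fun v => c v * Mk m σ 0 (q (t + v)) s v) (Set.Ioo 0 τ) := by
  refine Integrable.of_bound ((hc.mul (Mk_meas S m σ s t 0)).aestronglyMeasurable)
    (B * (C * (1 + s) * Bk m σ T 0)) ?_
  refine (ae_restrict_iff' measurableSet_Ioo).2 (ae_of_all _ fun v hv => ?_)
  rw [norm_mul, Real.norm_eq_abs, Real.norm_eq_abs]
  have h1 := hcB v hv
  have h2 := Mk_bound (m := m) hσ hv.1.le (hv.2.le.trans hτT) hs (S.adm (t + v)) 0
  exact mul_le_mul h1 h2 (abs_nonneg _) ((abs_nonneg _).trans h1)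

lemma J_deriv_s {C m σ T τ s t B : ℝ} {q : ℝ → ℝ → ℝ} {c : ℝ → ℝ} (hσ : 0 < σ) (hτT : τ ≤ T)
    (hs : 0 < s) (S : Src C q) (hc : Measurable c) (hcB : ∀ v ∈ Set.Ioo 0 τ, |c v| ≤ B) :
    IntegrableOn (fun v => c v * D1 m σ (q (t + v)) s v) (Set.Ioo 0 τ) ∧
    HasDerivAt (fun s => ∫ v in Set.Ioo 0 τ, c v * Mk m σ 0 (q (t + v)) s v)
      (∫ v in Set.Ioo 0 τ, c v * D1 m σ (q (t + v)) s v) s := by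
  refine hasDerivAt_integral_of_dominated_loc_of_deriv_le (s := Set.Ioo (s / 2) (2 * s))
    (bound := fun v => B * (C * (1 + 2 * s) * Bk m σ T 1 / (σ * (s / 2))) * (√v)⁻¹)
    (F := fun s v => c v * Mk m σ 0 (q (t + v)) s v) (F' := fun s v => c v * D1 m σ (q (t + v)) s v)
    (Ioo_mem_nhds (by linarith) (by linarith))
    (Eventually.of_forall fun s => (hc.mul (Mk_meas S m σ s t 0)).aestronglyMeasurable)
    (cMk_int hσ hτT hs S hc hcB)
    ((hc.mul (D1_meas S m σ s t)).aestronglyMeasurable) ?_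
    ((inv_sqrt_integrableOn τ).const_mul _) ?_
  · refine (ae_restrict_iff' measurableSet_Ioo).2 (ae_of_all _ fun v hv x hx => ?_)
    rw [norm_mul, Real.norm_eq_abs, Real.norm_eq_abs, mul_assoc]
    have h1 := hcB v hv
    exact mul_le_mul h1 (D1_bound hσ hv.1 (hv.2.le.trans hτT) hs hx (S.adm _))
      (abs_nonneg _) ((abs_nonneg _).trans h1)
  · refine (ae_restrict_iff' measurableSet_Ioo).2 (ae_of_all _ fun v hv x hx => ?_)
    have hxp : 0 < x := lt_trans (by positivity) hx.1
    exact (Mk0_deriv_s hσ hv.1 hxp (S.adm _)).const_mul (c v)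

lemma J_deriv_ss {C L m σ T τ s t B : ℝ} {q : ℝ → ℝ → ℝ} {c : ℝ → ℝ} (hσ : 0 < σ) (hτT : τ ≤ T)
    (hs : 0 < s) (S : Src C q) (hL : ∀ u, LogLip L (q u)) (hc : Measurable c)
    (hcB : ∀ v ∈ Set.Ioo 0 τ, |c v| ≤ B) :
    IntegrableOn (fun v => c v * D2 m σ (q (t + v)) s v) (Set.Ioo 0 τ) ∧
    HasDerivAt (fun s => ∫ v in Set.Ioo 0 τ, c v * D1 m σ (q (t + v)) s v)
      (∫ v in Set.Ioo 0 τ, c v * D2 m σ (q (t + v)) s v) s := by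
  refine hasDerivAt_integral_of_dominated_loc_of_deriv_le (s := Set.Ioo (s / 2) (2 * s))
    (bound := fun v => B * ((L * (1 + 2 * s) * (Bk m σ T 3 + Bk m σ T 1) + C * (1 + 2 * s) * Bk m σ T 1)
      / (σ * (s / 2) ^ 2)) * (√v)⁻¹)
    (F := fun s v => c v * D1 m σ (q (t + v)) s v) (F' := fun s v => c v * D2 m σ (q (t + v)) s v)
    (Ioo_mem_nhds (by linarith) (by linarith))
    (Eventually.of_forall fun s => (hc.mul (D1_meas S m σ s t)).aestronglyMeasurable)
    (J_deriv_s hσ hτT hs S hc hcB).1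
    ((hc.mul (D2_meas S m σ s t)).aestronglyMeasurable) ?_
    ((inv_sqrt_integrableOn τ).const_mul _) ?_
  · refine (ae_restrict_iff' measurableSet_Ioo).2 (ae_of_all _ fun v hv x hx => ?_)
    rw [norm_mul, Real.norm_eq_abs, Real.norm_eq_abs, mul_assoc]
    have h1 := hcB v hv
    exact mul_le_mul h1 (D2_bound hσ hv.1 (hv.2.le.trans hτT) hs hx (S.adm _) (hL _))
      (abs_nonneg _) ((abs_nonneg _).trans h1)
  · refine (ae_restrict_iff' measurableSet_Ioo).2 (ae_of_all _ fun v hv x hx => ?_)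
    have hxp : 0 < x := lt_trans (by positivity) hx.1
    exact (D1_deriv hσ hv.1 hxp (S.adm _)).const_mul (c v)

lemma J_deriv_y {C m σ T τ s t B y δ : ℝ} {q : ℝ → ℝ → ℝ} {c c' : ℝ → ℝ → ℝ} (hσ : 0 < σ)
    (hτT : τ ≤ T) (hδ : 0 < δ)
    (hs : 0 < s) (S : Src C q) (hc : ∀ y, Measurable (c y)) (hc' : ∀ y, Measurable (c' y))
    (hcB : ∀ v ∈ Set.Ioo 0 τ, |c y v| ≤ B)
    (hcB' : ∀ x ∈ Set.Ioo (y - δ) (y + δ), ∀ v ∈ Set.Ioo 0 τ, |c' x v| ≤ B)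
    (hder : ∀ x ∈ Set.Ioo (y - δ) (y + δ), ∀ v ∈ Set.Ioo 0 τ, HasDerivAt (fun x => c x v) (c' x v) x) :
    IntegrableOn (fun v => c' y v * Mk m σ 0 (q (t + v)) s v) (Set.Ioo 0 τ) ∧
    HasDerivAt (fun y => ∫ v in Set.Ioo 0 τ, c y v * Mk m σ 0 (q (t + v)) s v)
      (∫ v in Set.Ioo 0 τ, c' y v * Mk m σ 0 (q (t + v)) s v) y := by
  refine hasDerivAt_integral_of_dominated_loc_of_deriv_le (s := Set.Ioo (y - δ) (y + δ))
    (bound := fun v => B * (C * (1 + s) * Bk m σ T 0))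
    (F := fun y v => c y v * Mk m σ 0 (q (t + v)) s v) (F' := fun y v => c' y v * Mk m σ 0 (q (t + v)) s v)
    (Ioo_mem_nhds (by linarith) (by linarith))
    (Eventually.of_forall fun y => ((hc y).mul (Mk_meas S m σ s t 0)).aestronglyMeasurable)
    (cMk_int hσ hτT hs S (hc y) hcB)
    (((hc' y).mul (Mk_meas S m σ s t 0)).aestronglyMeasurable) ?_
    (integrable_const _) ?_
  · refine (ae_restrict_iff' measurableSet_Ioo).2 (ae_of_all _ fun v hv x hx => ?_)
    rw [norm_mul, Real.norm_eq_abs, Real.norm_eq_abs]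
    have h1 := hcB' x hx v hv
    have h2 := Mk_bound (m := m) hσ hv.1.le (hv.2.le.trans hτT) hs (S.adm (t + v)) 0
    exact mul_le_mul h1 h2 (abs_nonneg _) ((abs_nonneg _).trans h1)
  · refine (ae_restrict_iff' measurableSet_Ioo).2 (ae_of_all _ fun v hv x hx => ?_)
    exact (hder x hx v hv).mul_const _

lemma Mk_zero (m σ s : ℝ) (h : ℝ → ℝ) : Mk m σ 0 h s 0 = h s := by
  unfold Mk; simp [gau]

lemma shift_int (g : ℝ → ℝ → ℝ) (t T : ℝ) :
    ∫ v in Set.Ioo 0 (T - t), g (t + v) v = ∫ u in Set.Ioo t T, g u (u - t) := by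
  have h2 := (measurePreserving_sub_right volume t).setIntegral_preimage_emb
          (MeasurableEquiv.subRight t).measurableEmbedding (fun v : ℝ => g (t + v) v) (Set.Ioo 0 (T - t))
  rw [← h2]
  simp

lemma J_deriv_t {C L r σ T t s B : ℝ} {q : ℝ → ℝ → ℝ} {c c' : ℝ → ℝ} (hσ : 0 < σ)
    (ht : 0 < t) (htT : t < T)
    (hs : 0 < s) (S : Src C q) (hL : ∀ u, LogLip L (q u))
    (hq : ContinuousOn (fun u => q u s) (Set.Ioo 0 T))
    (hc : Measurable c) (hc' : Measurable c')
    (hcB : ∀ v, 0 ≤ v → v ≤ T → |c v| ≤ B) (hcB' : ∀ v, 0 < v → v < T → |c' v| ≤ B)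
    (hcL : ∀ v v', 0 ≤ v → v ≤ T → 0 ≤ v' → v' ≤ T → |c v - c v'| ≤ B * |v - v'|)
    (hder : ∀ v, 0 < v → v < T → HasDerivAt c (c' v) v) :
    HasDerivAt (fun t => ∫ v in Set.Ioo 0 (T - t), c v * Mk (r - σ^2/2) σ 0 (q (t + v)) s v)
      (-(c 0 * q t s) - (∫ v in Set.Ioo 0 (T - t), c' v * Mk (r - σ^2/2) σ 0 (q (t + v)) s v)
        - r * s * (∫ v in Set.Ioo 0 (T - t), c v * D1 (r - σ^2/2) σ (q (t + v)) s v)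
        - 1 / 2 * σ ^ 2 * s ^ 2 * ∫ v in Set.Ioo 0 (T - t), c v * D2 (r - σ^2/2) σ (q (t + v)) s v) t := by
  have hT : 0 < T := ht.trans htT
  set m := r - σ^2/2 with hm
  have hB0 : 0 ≤ B := (abs_nonneg _).trans (hcB 0 le_rfl hT.le)
  have hL0 := (hL 0).1
  have hC0 := S.hC
  have b0 := Bk_nonneg m σ T 0
  have b1 := Bk_nonneg m σ T 1
  set w : ℝ → ℝ → ℝ := fun u v => c v * Mk m σ 0 (q u) s v with hw
  set w' : ℝ → ℝ → ℝ := fun u v => c' v * Mk m σ 0 (q u) s v +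
    c v * ((Mk m σ 2 (q u) s v - Mk m σ 0 (q u) s v) / (2 * v) + m * Mk m σ 1 (q u) s v / (σ * √v)) with hw'
  set C1 := B * (L * (1 + s) * (2 * √T * |m| * Bk m σ T 0 + σ * Bk m σ T 1)) with hC1
  set C2 := B * (2 * √T) * (C * (1 + s) * Bk m σ T 0) with hC2
  set C3 := B * (C * (1 + s) * Bk m σ T 0) with hC3
  have hC10 : 0 ≤ C1 := by positivity
  have hC20 : 0 ≤ C2 := by positivity
  have hC30 : 0 ≤ C3 := by positivity
  have key := time_potential (C := C1 + C2 + C3) ht htT w w' (by positivity) ?_ ?_ ?_ ?_ ?_ ?_ ?_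
  · have e1 : (fun t => ∫ v in Set.Ioo 0 (T - t), c v * Mk m σ 0 (q (t + v)) s v)
        = fun t => ∫ u in Set.Ioo t T, w u (u - t) := by
      ext t; rw [← shift_int]
    rw [e1]
    convert! key using 1
    rw [← shift_int w' t T]
    have i1 := (J_deriv_s (m := m) (t := t) (τ := T - t) (T := T) hσ (by linarith) hs S hc
      (fun v hv => hcB v hv.1.le (by linarith [hv.2]))).1
    have i2 := (J_deriv_ss (m := m) (t := t) (τ := T - t) (T := T) hσ (by linarith) hs S hL hc
      (fun v hv => hcB v hv.1.le (by linarith [hv.2]))).1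
    have i0 := cMk_int (m := m) (t := t) (τ := T - t) (T := T) hσ (by linarith) hs S hc'
      (fun v hv => hcB' v hv.1 (by linarith [hv.2]))
    have e2 : ∫ v in Set.Ioo 0 (T - t), w' (t + v) v =
        (∫ v in Set.Ioo 0 (T - t), ((c' v * Mk m σ 0 (q (t + v)) s v) + r * s * (c v * D1 m σ (q (t + v)) s v))
          + 1 / 2 * σ ^ 2 * s ^ 2 * (c v * D2 m σ (q (t + v)) s v)) := by
      refine setIntegral_congr_fun measurableSet_Ioo fun v hv => ?_
      have hsv : 0 < √v := sqrt_pos.2 hv.1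
      have hvv : v = √v ^ 2 := (sq_sqrt hv.1.le).symm
      simp only [hw', D1, D2]
      rw [hm]
      generalize Mk (r - σ ^ 2 / 2) σ 1 (q (t + v)) s v = M1
      generalize Mk (r - σ ^ 2 / 2) σ 0 (q (t + v)) s v = M0
      generalize Mk (r - σ ^ 2 / 2) σ 2 (q (t + v)) s v = M2
      have : (M2 - M0) / (2 * v) = (M2 - M0) / (2 * √v ^ 2) := by rw [← hvv]
      rw [this]
      field_simp
      ring
    have i01 : IntegrableOn (fun v => c' v * Mk m σ 0 (q (t + v)) s v
        + r * s * (c v * D1 m σ (q (t + v)) s v)) (Set.Ioo 0 (T - t)) := i0.add (i1.const_mul _)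
    rw [e2, integral_add i01 (i2.const_mul _), integral_add i0 (i1.const_mul _),
      integral_const_mul, integral_const_mul]
    simp only [hw, Mk_zero]
    ring
  · intro u hu v v' hv hvT hv' hvT'
    have h1 := Mk_lip_v (m := m) hσ hv hvT hv' hvT' hs (S.adm u) (hL u)
    have h2 := Mk_bound (m := m) hσ hv' hvT' hs (S.adm u) 0
    have h3 := hcB v hv hvT
    have h4 := (hcL v v' hv hvT hv' hvT').trans
      (mul_le_mul_of_nonneg_left (abs_sub_le_sqrt hv hvT hv' hvT') hB0)
    have e : w u v - w u v' = c v * (Mk m σ 0 (q u) s v - Mk m σ 0 (q u) s v')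
        + (c v - c v') * Mk m σ 0 (q u) s v' := by simp only [hw]; ring
    rw [e]
    refine (abs_add_le _ _).trans ?_
    rw [abs_mul, abs_mul]
    have h5 := mul_le_mul h3 h1 (abs_nonneg _) hB0
    have h6 := mul_le_mul h4 h2 (abs_nonneg _) (by positivity)
    have h7 : 0 ≤ C3 * |√v - √v'| := by positivity
    calc _ ≤ _ := add_le_add h5 h6
      _ ≤ _ := by rw [hC1, hC2]; nlinarith [h7]
  · intro u hu v hv hvT
    exact (hder v hv hvT).mul (Mk0_deriv_v hσ hv hs (S.adm u))
  · intro t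
    exact ((hc.comp (by fun_prop : Measurable fun u : ℝ => max (u - t) 0)).mul
      (Mk_measurable S m σ s 0 (by fun_prop : Measurable fun u : ℝ => max (u - t) 0)
        measurable_id)).aestronglyMeasurable
  · have hρ : Measurable fun u : ℝ => u - t := by fun_prop
    have g0 := Mk_measurable S m σ s 0 hρ measurable_id
    have g1 := Mk_measurable S m σ s 1 hρ measurable_id
    have g2 := Mk_measurable S m σ s 2 hρ measurable_id
    refine Measurable.aestronglyMeasurable ?_
    refine ((hc'.comp hρ).mul g0).add ((hc.comp hρ).mul (((g2.sub g0).div (by fun_prop)).add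
      ((g1.const_mul m).div (by fun_prop))))
  · exact ((measurable_const (a := c 0)).mul
      (Mk_measurable S m σ s 0 (measurable_const (a := (0:ℝ)))
        measurable_id)).aestronglyMeasurable
  · simp only [hw, Mk_zero]
    exact continuousOn_const.mul hq
  · intro u hu
    have h2 := Mk_bound (m := m) hσ le_rfl hT.le hs (S.adm u) 0
    have h3 := hcB 0 le_rfl hT.le
    have h5 := mul_le_mul h3 h2 (abs_nonneg _) hB0
    simp only [hw]; rw [abs_mul]
    linarith

end Part7

section Part8
open ProbabilityTheory Filter Topology

lemma V_eq {r σ s v : ℝ} (h : ℝ → ℝ) (hσ : 0 < σ) (hv : 0 < v) (hs : 0 < s) :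
    (Mk (r - σ^2/2) σ 2 h s v - Mk (r - σ^2/2) σ 0 h s v) / (2 * v)
      + (r - σ^2/2) * Mk (r - σ^2/2) σ 1 h s v / (σ * √v)
    = r * s * D1 (r - σ^2/2) σ h s v + 1 / 2 * σ ^ 2 * s ^ 2 * D2 (r - σ^2/2) σ h s v := by
  have hsv : 0 < √v := sqrt_pos.2 hv
  have hvv : v = √v ^ 2 := (sq_sqrt hv.le).symm
  simp only [D1, D2]
  generalize Mk (r - σ ^ 2 / 2) σ 1 h s v = M1
  generalize Mk (r - σ ^ 2 / 2) σ 0 h s v = M0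
  generalize Mk (r - σ ^ 2 / 2) σ 2 h s v = M2
  have : (M2 - M0) / (2 * v) = (M2 - M0) / (2 * √v ^ 2) := by rw [← hvv]
  rw [this]
  field_simp
  ring

/-- value function with regular data, in terms of `Mk` -/
noncomputable def Jf (r σ T : ℝ) (g : ℝ → ℝ) (q : ℝ → ℝ → ℝ) (t s y : ℝ) : ℝ :=
  ∫ v in Set.Ioo 0 (T - t), (exp (-r * v) * g (y + v)) * Mk (r - σ^2/2) σ 0 (q (t + v)) s v

noncomputable def Rf (r σ K T : ℝ) (g F : ℝ → ℝ) (q : ℝ → ℝ → ℝ) (t s y : ℝ) : ℝ :=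
  (1 - F (T - t + y)) / (1 - F y) * bsPrice r σ K T t s + Jf r σ T g q t s y / (1 - F y)

lemma bs_derivs {r σ K T t s : ℝ} (hσ : 0 < σ) (hK : 0 < K) (hs : 0 < s) (ht : t < T) :
    ∃ b c : ℝ → ℝ, ∃ a, HasDerivAt (fun t => bsPrice r σ K T t s) a t ∧
      (∀ s > 0, HasDerivAt (fun s => bsPrice r σ K T t s) (b s) s) ∧
      (∀ s > 0, HasDerivAt b (c s) s) ∧
      a + r * s * b s + 1 / 2 * σ ^ 2 * s ^ 2 * c s = r * bsPrice r σ K T t s := by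
  have hτ : 0 < T - t := by linarith
  have A := payoff_adm hK
  refine ⟨fun s => exp (-r * (T - t)) * D1 (r - σ^2/2) σ (payoff K) s (T - t),
    fun s => exp (-r * (T - t)) * D2 (r - σ^2/2) σ (payoff K) s (T - t), ?_, ?_, ?_, ?_, ?_⟩
  · exact exp (-r * (T - t)) * r * Mk (r - σ^2/2) σ 0 (payoff K) s (T - t)
      + exp (-r * (T - t)) * (((Mk (r - σ^2/2) σ 2 (payoff K) s (T - t) - Mk (r - σ^2/2) σ 0 (payoff K) s (T - t)) / (2 * (T - t))
      + (r - σ^2/2) * Mk (r - σ^2/2) σ 1 (payoff K) s (T - t) / (σ * √(T - t))) * (-1))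
  · have h0 : HasDerivAt (fun t => T - t) (-1) t := by simpa using (hasDerivAt_id t).const_sub T
    have h1 := HasDerivAt.comp t (h₂ := fun v => Mk (r - σ^2/2) σ 0 (payoff K) s v)
      (Mk0_deriv_v (m := r - σ^2/2) hσ hτ hs A) h0
    have h2 : HasDerivAt (fun t => exp (-r * (T - t))) (exp (-r * (T - t)) * r) t := by
      have := (h0.const_mul (-r)).exp
      convert! this using 1; ring
    refine (h2.mul h1).congr_of_eventuallyEq ?_
    filter_upwards [gt_mem_nhds ht] with t' ht'
    rw [bs_eq hσ hK hs ht'.le]; rfl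
  · intro s hs
    refine ((Mk0_deriv_s hσ hτ hs A).const_mul _).congr_of_eventuallyEq ?_
    filter_upwards [lt_mem_nhds hs] with s' hs'
    rw [bs_eq hσ hK hs' ht.le]
  · intro s hs
    exact (D1_deriv hσ hτ hs A).const_mul _
  · simp only
    rw [V_eq _ hσ hτ hs, bs_eq hσ hK hs ht.le]; ring

lemma core {r σ K T C L B t s y : ℝ} {q : ℝ → ℝ → ℝ} {g g' F : ℝ → ℝ} (hr : 0 ≤ r) (hσ : 0 < σ)
    (hK : 0 < K) (ht : 0 < t) (htT : t < T) (hs : 0 < s) (hy : 0 < y) (hyT : y < T)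
    (S : Src C q) (hL : ∀ u, LogLip L (q u)) (hq : ContinuousOn (fun u => q u s) (Set.Ioo 0 T))
    (hg : Continuous g) (hg' : Measurable g') (hgd : ∀ x > 0, HasDerivAt g (g' x) x)
    (hgB : ∀ x, 0 < x → x ≤ 3 * T → |g x| ≤ B) (hgB' : ∀ x, 0 < x → x ≤ 3 * T → |g' x| ≤ B)
    (hF : ∀ x > 0, HasDerivAt F (g x) x) (hF1 : ∀ x ≥ 0, F x < 1) :
    ∃ a b c d, HasDerivAt (fun t => Rf r σ K T g F q t s y) a t ∧
      HasDerivAt (fun s => Rf r σ K T g F q t s y) b s ∧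
      HasDerivAt (deriv fun s => Rf r σ K T g F q t s y) c s ∧
      HasDerivAt (fun y => Rf r σ K T g F q t s y) d y ∧
      a + d + r * s * b + 1 / 2 * σ ^ 2 * s ^ 2 * c - r * Rf r σ K T g F q t s y
        = g y / (1 - F y) * (Rf r σ K T g F q t s y - q t s) := by
  have hT : 0 < T := ht.trans htT
  have hB0 : 0 ≤ B := (abs_nonneg _).trans (hgB T hT (by linarith))
  have hexp : ∀ v, 0 ≤ v → |exp (-r * v)| ≤ 1 := by
    intro v hv; rw [abs_exp]; apply exp_le_one_iff.2; nlinarith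
  obtain ⟨ηs, ηss, ηt, h1, h2, h3, hpde⟩ := bs_derivs (r := r) hσ hK hs htT
  set c : ℝ → ℝ → ℝ := fun y v => exp (-r * v) * g (y + v) with hc
  set cy : ℝ → ℝ → ℝ := fun y v => exp (-r * v) * g' (y + v) with hcy
  set cv : ℝ → ℝ := fun v => exp (-r * v) * g' (y + v) - r * (exp (-r * v) * g (y + v)) with hcv
  have mc : ∀ y, Measurable (c y) := fun y => by
    have := hg.measurable; fun_prop
  have mcy : ∀ y, Measurable (cy y) := fun y => by fun_prop
  have mcv : Measurable cv := by have := hg.measurable; fun_prop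
  have bc : ∀ x v, 0 < x → x ≤ 2 * T → 0 ≤ v → v ≤ T → |c x v| ≤ B := by
    intro x v hx hxT hv hvT
    simp only [hc]; rw [abs_mul]
    calc _ ≤ 1 * B := mul_le_mul (hexp v hv) (hgB _ (by linarith) (by linarith)) (abs_nonneg _) zero_le_one
      _ = B := one_mul B
  have bcy : ∀ x v, 0 < x → x ≤ 2 * T → 0 ≤ v → v ≤ T → |cy x v| ≤ B := by
    intro x v hx hxT hv hvT
    simp only [hcy]; rw [abs_mul]
    calc _ ≤ 1 * B := mul_le_mul (hexp v hv) (hgB' _ (by linarith) (by linarith)) (abs_nonneg _) zero_le_one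
      _ = B := one_mul B
  have bcv : ∀ v, 0 ≤ v → v ≤ T → |cv v| ≤ B + r * B := by
    intro v hv hvT
    have e1 := bc y v hy (by linarith) hv hvT
    have e2 := bcy y v hy (by linarith) hv hvT
    have e3 := abs_sub (cy y v) (r * c y v)
    rw [abs_mul r, abs_of_nonneg hr] at e3
    have e4 : r * |c y v| ≤ r * B := by gcongr
    show |cy y v - r * c y v| ≤ _
    linarith
  have hdcv : ∀ v, 0 ≤ v → HasDerivAt (c y) (cv v) v := by
    intro v hv
    have e1 : HasDerivAt (fun v => exp (-r * v)) (exp (-r * v) * (-r)) v := by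
      have := ((hasDerivAt_id v).const_mul (-r)).exp
      simpa using this
    have e2 : HasDerivAt (fun v => g (y + v)) (g' (y + v)) v := (hgd (y + v) (by linarith)).comp_const_add y v
    convert! e1.mul e2 using 1
    simp only [hcv]; ring
  have hdcy : ∀ x v, 0 < x → 0 ≤ v → HasDerivAt (fun x => c x v) (cy x v) x := by
    intro x v hx hv
    exact ((hgd (x + v) (by linarith)).comp_add_const x v).const_mul _
  have hcL : ∀ v v', 0 ≤ v → v ≤ T → 0 ≤ v' → v' ≤ T → |c y v - c y v'| ≤ (B + r * B) * |v - v'| := by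
    intro v v' hv hvT hv' hvT'
    exact (convex_Icc 0 T).norm_image_sub_le_of_norm_hasDerivWithin_le
      (fun x hx => (hdcv x hx.1).hasDerivWithinAt) (fun x hx => bcv x hx.1 hx.2) ⟨hv', hvT'⟩ ⟨hv, hvT⟩
  have hrB : B ≤ B + r * B := by nlinarith
  have hJt := J_deriv_t (r := r) (B := B + r * B) hσ ht htT hs S hL hq (mc y) mcv
    (fun v hv hvT => (bc y v hy (by linarith) hv hvT).trans hrB)
    (fun v hv hvT => bcv v hv.le hvT.le) hcL (fun v hv _ => hdcv v hv.le)
  have hbcI : ∀ v ∈ Set.Ioo 0 (T - t), |c y v| ≤ B := fun v hv =>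
    bc y v hy (by linarith) hv.1.le (by linarith [hv.2])
  have hJs : ∀ s > 0, HasDerivAt (fun s => Jf r σ T g q t s y)
      (∫ v in Set.Ioo 0 (T - t), c y v * D1 (r - σ^2/2) σ (q (t + v)) s v) s := fun s hs => (J_deriv_s (m := r - σ^2/2) (t := t) (T := T) (τ := T - t) hσ (by linarith) hs S (mc y) hbcI).2
  have hJss := J_deriv_ss (m := r - σ^2/2) (t := t) (T := T) (τ := T - t) hσ (by linarith) hs S hL (mc y) hbcI
  have hJy := J_deriv_y (m := r - σ^2/2) (t := t) (T := T) (τ := T - t) (y := y) (δ := y) hσ (by linarith)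
    hy hs S mc mcy hbcI
    (fun x hx v hv => bcy x v (by linarith [hx.1]) (by linarith [hx.2]) hv.1.le (by linarith [hv.2]))
    (fun x hx v hv => hdcy x v (by linarith [hx.1]) hv.1.le)
  have hcvI : ∫ v in Set.Ioo 0 (T - t), cv v * Mk (r - σ^2/2) σ 0 (q (t + v)) s v
      = (∫ v in Set.Ioo 0 (T - t), cy y v * Mk (r - σ^2/2) σ 0 (q (t + v)) s v)
        - r * ∫ v in Set.Ioo 0 (T - t), c y v * Mk (r - σ^2/2) σ 0 (q (t + v)) s v := by
    rw [← integral_const_mul, ← integral_sub hJy.1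
      ((cMk_int (m := r - σ^2/2) (t := t) (T := T) (τ := T - t) hσ (by linarith) hs S (mc y) hbcI).const_mul r)]
    congr 1; ext v; simp only [hcv, hcy, hc]; ring
  rw [hcvI] at hJt
  have hJ : ∀ t s y, Jf r σ T g q t s y = ∫ v in Set.Ioo 0 (T - t), c y v * Mk (r - σ^2/2) σ 0 (q (t + v)) s v :=
    fun _ _ _ => rfl
  simp only [← hJ] at hJt hJy
  set Js : ℝ → ℝ := fun s => ∫ v in Set.Ioo 0 (T - t), c y v * D1 (r - σ^2/2) σ (q (t + v)) s v with hJsdef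
  set Jss := ∫ v in Set.Ioo 0 (T - t), c y v * D2 (r - σ^2/2) σ (q (t + v)) s v with hJssdef
  set Jy := ∫ v in Set.Ioo 0 (T - t), cy y v * Mk (r - σ^2/2) σ 0 (q (t + v)) s v with hJydef
  have hG : 1 - F y ≠ 0 := by have := hF1 y hy.le; linarith
  have hGd : HasDerivAt (fun y => 1 - F y) (-(g y)) y := (hF y hy).const_sub 1
  have hτy : 0 < T - t + y := by linarith
  have hdT : HasDerivAt (fun t => T - t + y) (-1) t := by
    simpa using ((hasDerivAt_id t).const_sub T).add_const y
  have hFt : HasDerivAt (fun t => 1 - F (T - t + y)) (g (T - t + y)) t := by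
    have := ((hF _ hτy).comp t hdT).const_sub 1
    convert! this using 1; ring
  have hFy : HasDerivAt (fun y => 1 - F (T - t + y)) (-(g (T - t + y))) y := by
    exact ((hF _ hτy).comp_const_add (T - t) y).const_sub 1
  have hJss0 : Js s = ∫ v in Set.Ioo 0 (T - t), c y v * D1 (r - σ^2/2) σ (q (t + v)) s v := rfl
  rw [← hJss0] at hJt
  have hRs : ∀ s > 0, HasDerivAt (fun s => Rf r σ K T g F q t s y)
      ((1 - F (T - t + y)) / (1 - F y) * ηs s + Js s / (1 - F y)) s := by
    intro s hs
    exact ((h2 s hs).const_mul _).add ((hJs s hs).div_const _)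
  refine ⟨_, _, (1 - F (T - t + y)) / (1 - F y) * ηss s + Jss / (1 - F y), _, ((hFt.div_const (1 - F y)).mul h1).add (hJt.div_const (1 - F y)), hRs s hs, ?_,
    ((hFy.div hGd hG).mul_const _).add (hJy.2.div hGd hG), ?_⟩
  · refine (((h3 s hs).const_mul _).add (hJss.2.div_const _)).congr_of_eventuallyEq ?_
    filter_upwards [lt_mem_nhds hs] with s' hs'
    exact (hRs s' hs').deriv
  · simp only [Rf]
    have hηt : ηt = r * bsPrice r σ K T t s - r * s * ηs s - 1 / 2 * σ ^ 2 * s ^ 2 * ηss s := by linarith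
    rw [hηt]
    have e0 : c y 0 = g y := by simp [hc]
    simp only [e0]
    generalize 1 - F y = G at *
    field_simp
    ring

end Part8

section Part9
open ProbabilityTheory Filter Topology

structure Dat (T B : ℝ) (g g' F : ℝ → ℝ) : Prop where
  cont : Continuous g
  meas' : Measurable g'
  der : ∀ x > 0, HasDerivAt g (g' x) x
  bd : ∀ x, 0 < x → x ≤ 3 * T → |g x| ≤ B
  bd' : ∀ x, 0 < x → x ≤ 3 * T → |g' x| ≤ B
  derF : ∀ x > 0, HasDerivAt F (g x) x
  F0 : ∀ x ≥ 0, 0 ≤ F x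
  F1 : ∀ x ≥ 0, F x < 1
  mono : ∀ x ≥ 0, x ≤ T → F x ≤ F T

lemma mkDat {T : ℝ} {f F : ℝ → ℝ} (hT : 0 < T) (hf : ContDiffOn ℝ 1 f (Set.Ici 0))
    (hnn : ∀ y, 0 ≤ y → 0 ≤ f y) (hF : ∀ y, F y = ∫ u in (0 : ℝ)..y, f u)
    (hF1 : ∀ y, 0 ≤ y → F y < 1) : ∃ B, Dat T B (fun x => f (max x 0)) (deriv f) F := by
  have hfc : ContinuousOn f (Set.Ici 0) := hf.continuousOn
  have hc : Continuous (fun x => f (max x 0)) :=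
    hfc.comp_continuous (by fun_prop) (fun x => Set.mem_Ici.2 (le_max_right x 0))
  have hd : ContinuousOn (derivWithin f (Set.Ici 0)) (Set.Ici 0) :=
    hf.continuousOn_derivWithin (uniqueDiffOn_Ici 0) le_rfl
  obtain ⟨B1, hB1⟩ := (isCompact_Icc (a := 0) (b := 3 * T)).exists_bound_of_continuousOn
    (hfc.mono Set.Icc_subset_Ici_self)
  obtain ⟨B2, hB2⟩ := (isCompact_Icc (a := 0) (b := 3 * T)).exists_bound_of_continuousOn
    (hd.mono Set.Icc_subset_Ici_self)
  have hFe : ∀ x, 0 ≤ x → F x = ∫ u in (0 : ℝ)..x, f (max u 0) := by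
    intro x hx
    rw [hF]
    refine intervalIntegral.integral_congr fun u hu => ?_
    rw [Set.uIcc_of_le hx] at hu
    rw [max_eq_left hu.1]
  refine ⟨max B1 B2, hc, measurable_deriv f, ?_, ?_, ?_, ?_, ?_, hF1, ?_⟩
  · intro x hx
    have h1 : DifferentiableAt ℝ f x :=
      (hf.differentiableOn one_ne_zero).differentiableAt (Ici_mem_nhds hx)
    refine h1.hasDerivAt.congr_of_eventuallyEq ?_
    filter_upwards [lt_mem_nhds hx] with z hz
    rw [max_eq_left hz.le]
  · intro x hx hx3
    rw [max_eq_left hx.le]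
    exact (hB1 x ⟨hx.le, hx3⟩).trans (le_max_left _ _)
  · intro x hx hx3
    rw [← derivWithin_of_mem_nhds (Ici_mem_nhds hx)]
    exact (hB2 x ⟨hx.le, hx3⟩).trans (le_max_right _ _)
  · intro x hx
    have h1 : HasDerivAt (fun x => ∫ u in (0 : ℝ)..x, f (max u 0)) (f (max x 0)) x :=
      intervalIntegral.integral_hasDerivAt_right (hc.intervalIntegrable _ _)
        hc.stronglyMeasurable.stronglyMeasurableAtFilter hc.continuousAt
    refine h1.congr_of_eventuallyEq ?_
    filter_upwards [lt_mem_nhds hx] with z hz using hFe z hz.le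
  · intro x hx
    rw [hFe x hx]
    exact intervalIntegral.integral_nonneg hx (fun u hu => hnn _ (le_max_right _ _))
  · intro x hx hxT
    rw [hFe x hx, hFe T hT.le, ← sub_nonneg,
      intervalIntegral.integral_interval_sub_left (hc.intervalIntegrable _ _) (hc.intervalIntegrable _ _)]
    exact intervalIntegral.integral_nonneg hxT (fun u hu => hnn _ (le_max_right _ _))

lemma exp_bd {r v : ℝ} (hr : 0 ≤ r) (hv : 0 ≤ v) : |exp (-r * v)| ≤ 1 := by
  rw [abs_exp]; apply exp_le_one_iff.2; nlinarith

lemma Dat.c_bd {T B r y v : ℝ} {g g' F : ℝ → ℝ} (D : Dat T B g g' F) (hr : 0 ≤ r) (hy : 0 < y) (hyT : y ≤ T)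
    (hv : 0 ≤ v) (hvT : v ≤ T) : |exp (-r * v) * g (y + v)| ≤ B := by
  rw [abs_mul]
  calc _ ≤ 1 * B := mul_le_mul (exp_bd hr hv) (D.bd _ (by linarith) (by linarith)) (abs_nonneg _) zero_le_one
    _ = B := one_mul B

lemma Dat.inv_le {T B y : ℝ} {g g' F : ℝ → ℝ} (D : Dat T B g g' F) (hy : 0 ≤ y) (hyT : y ≤ T) :
    0 < 1 - F y ∧ (1 - F y)⁻¹ ≤ (1 - F T)⁻¹ := by
  have h1 := D.F1 y hy
  have h2 := D.F1 T (hy.trans hyT)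
  have h3 := D.mono y hy hyT
  refine ⟨by linarith, ?_⟩
  apply inv_anti₀ <;> linarith

lemma Dat.B0 {T B : ℝ} {g g' F : ℝ → ℝ} (hT : 0 < T) (D : Dat T B g g' F) : 0 ≤ B :=
  (abs_nonneg _).trans (D.bd T hT (by linarith))

lemma Rf_lip {r σ K T C B : ℝ} {q : ℝ → ℝ → ℝ} {g g' F : ℝ → ℝ} (hT : 0 < T) (hr : 0 ≤ r) (hσ : 0 < σ)
    (hK : 0 < K) (D : Dat T B g g' F) (S : Src C q) :
    ∃ L, 0 ≤ L ∧ ∀ t y s s', 0 < t → t < T → 0 < y → y ≤ T → 0 < s → 0 < s' →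
      |Rf r σ K T g F q t s y - Rf r σ K T g F q t s' y| ≤ L * |log s - log s'| * (1 + max s s') := by
  set m := r - σ^2/2 with hm
  set I := ∫ v in Set.Ioo 0 T, (√v)⁻¹ with hI
  have hI0 : 0 ≤ I := integral_nonneg (fun v => by positivity)
  have hB0 := D.B0 hT
  have b0 := Bk_nonneg m σ T 0
  have b1 := Bk_nonneg m σ T 1
  have hC := S.hC
  have hGT : 0 < 1 - F T := (D.inv_le hT.le le_rfl).1
  set L1 := Bk m σ T 0
  set L2 := B * (C * Bk m σ T 1 / σ) * I
  have hL2 : 0 ≤ L2 := by positivity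
  refine ⟨(1 - F T)⁻¹ * (L1 + L2), by positivity, ?_⟩
  intro t y s s' ht htT hy hyT hs hs'
  obtain ⟨hG, hGi⟩ := D.inv_le hy.le hyT
  set Λ := |log s - log s'| * (1 + max s s') with hΛ
  have hΛ0 : 0 ≤ Λ := by positivity
  have hη : |bsPrice r σ K T t s - bsPrice r σ K T t s'| ≤ L1 * Λ := by
    rw [bs_eq hσ hK hs htT.le, bs_eq hσ hK hs' htT.le, ← mul_sub, abs_mul]
    have h1 := Mk_lip_s (m := m) (T := T) hσ (by linarith : 0 ≤ T - t) (by linarith) hs hs'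
      (payoff_adm hK) (payoff_lip K)
    calc _ ≤ 1 * _ := mul_le_mul (exp_bd hr (by linarith)) h1 (abs_nonneg _) zero_le_one
      _ = L1 * Λ := by rw [hΛ]; ring
  have hcm : Measurable (fun v => exp (-r * v) * g (y + v)) := by
    have := D.cont.measurable; fun_prop
  have hcb : ∀ v ∈ Set.Ioo 0 (T - t), |exp (-r * v) * g (y + v)| ≤ B := fun v hv =>
    D.c_bd hr hy hyT hv.1.le (by linarith [hv.2])
  have hJ : |Jf r σ T g q t s y - Jf r σ T g q t s' y| ≤ L2 * Λ := by
    unfold Jf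
    rw [← integral_sub (cMk_int (T := T) hσ (by linarith) hs S hcm hcb)
      (cMk_int (T := T) hσ (by linarith) hs' S hcm hcb), ← Real.norm_eq_abs]
    have hii : IntegrableOn (fun v => (B * (C * Bk m σ T 1 / σ) * Λ) * (√v)⁻¹) (Set.Ioo 0 T) :=
      (inv_sqrt_integrableOn T).const_mul _
    have hsub : Set.Ioo 0 (T - t) ⊆ Set.Ioo 0 T := Set.Ioo_subset_Ioo le_rfl (by linarith)
    refine (norm_integral_le_of_norm_le (hii.mono_set hsub) ?_).trans ?_
    · refine (ae_restrict_iff' measurableSet_Ioo).2 (ae_of_all _ fun v hv => ?_)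
      rw [← mul_sub, norm_mul, Real.norm_eq_abs, Real.norm_eq_abs]
      have h1 := Mk_lip_growth (m := m) (T := T) hσ hv.1 (by linarith [hv.2]) hs hs' (S.adm (t + v))
      calc _ ≤ B * _ := mul_le_mul (hcb v hv) h1 (abs_nonneg _) hB0
        _ = _ := by rw [hΛ]; ring
    · refine (setIntegral_mono_set hii (ae_of_all _ fun v => by positivity) hsub.eventuallyLE).trans ?_
      rw [integral_const_mul]
      apply le_of_eq; ring
  have e : Rf r σ K T g F q t s y - Rf r σ K T g F q t s' y
      = (1 - F y)⁻¹ * ((1 - F (T - t + y)) * (bsPrice r σ K T t s - bsPrice r σ K T t s')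
        + (Jf r σ T g q t s y - Jf r σ T g q t s' y)) := by
    unfold Rf; field_simp; ring
  rw [e, abs_mul, abs_of_pos (inv_pos.2 hG)]
  have hF1 : |1 - F (T - t + y)| ≤ 1 := by
    have h1 := D.F0 (T - t + y) (by linarith)
    have h2 := D.F1 (T - t + y) (by linarith)
    rw [abs_le]; constructor <;> linarith
  have h3 : |(1 - F (T - t + y)) * (bsPrice r σ K T t s - bsPrice r σ K T t s')
        + (Jf r σ T g q t s y - Jf r σ T g q t s' y)| ≤ 1 * (L1 * Λ) + L2 * Λ := by
    refine (abs_add_le _ _).trans (add_le_add ?_ hJ)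
    rw [abs_mul]
    exact mul_le_mul hF1 hη (abs_nonneg _) zero_le_one
  calc _ ≤ (1 - F T)⁻¹ * (1 * (L1 * Λ) + L2 * Λ) := mul_le_mul hGi h3 (abs_nonneg _) (by positivity)
    _ = _ := by rw [hΛ]; ring

lemma Rf_term {r σ K T C B s : ℝ} {q : ℝ → ℝ → ℝ} {g g' F : ℝ → ℝ} (hT : 0 < T) (hr : 0 ≤ r) (hσ : 0 < σ)
    (hK : 0 < K) (D : Dat T B g g' F) (S : Src C q) (hs : 0 < s) :
    ∃ K1 K2, ∀ ε y, 0 < ε → ε < T → 0 < y → y ≤ T →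
      |Rf r σ K T g F q (T - ε) s y - payoff K s| ≤ K1 * ε + K2 * √ε := by
  set m := r - σ^2/2 with hm
  have hB0 := D.B0 hT
  have b0 := Bk_nonneg m σ T 0
  have b1 := Bk_nonneg m σ T 1
  have hC := S.hC
  have hGT : 0 < 1 - F T := (D.inv_le hT.le le_rfl).1
  set M := 1 * (1 + s) * Bk m σ T 0 with hM
  have hM0 : 0 ≤ M := by positivity
  refine ⟨(1 - F T)⁻¹ * (B * M + B * (C * (1 + s) * Bk m σ T 0)) + r * M,
    1 * (1 + s) * (2 * √T * |m| * Bk m σ T 0 + σ * Bk m σ T 1), ?_⟩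
  intro ε y hε hεT hy hyT
  obtain ⟨hG, hGi⟩ := D.inv_le hy.le hyT
  have eT : T - (T - ε) = ε := by ring
  have hMk := Mk_bound (m := m) (T := T) hσ hε.le hεT.le hs (payoff_adm hK) 0
  have hηb : |bsPrice r σ K T (T - ε) s| ≤ M := by
    rw [bs_eq hσ hK hs (by linarith), abs_mul, eT]
    calc _ ≤ 1 * M := mul_le_mul (exp_bd hr hε.le) hMk (abs_nonneg _) zero_le_one
      _ = M := one_mul _
  have hη : |bsPrice r σ K T (T - ε) s - payoff K s| ≤ r * M * ε +
      1 * (1 + s) * (2 * √T * |m| * Bk m σ T 0 + σ * Bk m σ T 1) * √ε := by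
    rw [bs_eq hσ hK hs (by linarith), eT]
    have h1 := Mk_lip_v (m := m) (T := T) hσ hε.le hεT.le le_rfl hT.le hs (payoff_adm hK) (payoff_lip K)
    rw [Mk_zero, sqrt_zero, sub_zero, abs_of_nonneg (sqrt_nonneg ε)] at h1
    have h2 : |exp (-r * ε) - 1| ≤ r * ε := by
      have h3 := one_sub_le_exp_neg (r * ε)
      have h4 := exp_bd hr hε.le
      rw [abs_exp] at h4
      rw [← neg_mul] at h3
      rw [abs_le]; constructor <;> nlinarith
    have e : exp (-r * ε) * Mk (r - σ^2/2) σ 0 (payoff K) s ε - payoff K s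
      = (exp (-r * ε) - 1) * Mk m σ 0 (payoff K) s ε + (Mk m σ 0 (payoff K) s ε - payoff K s) := by
      rw [hm]; ring
    rw [e]
    refine (abs_add_le _ _).trans (add_le_add ?_ h1)
    rw [abs_mul]
    calc _ ≤ (r * ε) * M := mul_le_mul h2 hMk (abs_nonneg _) (by positivity)
      _ = _ := by ring
  have hJ : |Jf r σ T g q (T - ε) s y| ≤ B * (C * (1 + s) * Bk m σ T 0) * ε := by
    unfold Jf
    rw [eT, ← Real.norm_eq_abs]
    refine (norm_setIntegral_le_of_norm_le_const (C := B * (C * (1 + s) * Bk m σ T 0)) (by simp) ?_).trans ?_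
    · intro v hv
      rw [norm_mul, Real.norm_eq_abs, Real.norm_eq_abs]
      exact mul_le_mul (D.c_bd hr hy hyT hv.1.le (by linarith [hv.2]))
        (Mk_bound hσ hv.1.le (by linarith [hv.2]) hs (S.adm _) 0) (abs_nonneg _) hB0
    · simp [hε.le]
  have hFd : |F (ε + y) - F y| ≤ B * ε := by
    have := (convex_Ioc 0 (3 * T)).norm_image_sub_le_of_norm_hasDerivWithin_le (f := F)
      (fun x hx => (D.derF x hx.1).hasDerivWithinAt) (fun x hx => D.bd x hx.1 hx.2)
      (⟨hy, by linarith⟩ : y ∈ Set.Ioc 0 (3 * T)) (⟨by linarith, by linarith⟩ : ε + y ∈ Set.Ioc 0 (3 * T))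
    simpa [abs_of_pos hε] using this
  have e : Rf r σ K T g F q (T - ε) s y - payoff K s
      = (1 - F y)⁻¹ * (-(F (ε + y) - F y) * bsPrice r σ K T (T - ε) s + Jf r σ T g q (T - ε) s y)
        + (bsPrice r σ K T (T - ε) s - payoff K s) := by
    unfold Rf; rw [eT]; field_simp; ring
  rw [e]
  refine (abs_add_le _ _).trans ?_
  rw [abs_mul, abs_of_pos (inv_pos.2 hG)]
  have h3 : |-(F (ε + y) - F y) * bsPrice r σ K T (T - ε) s + Jf r σ T g q (T - ε) s y|
      ≤ (B * ε) * M + B * (C * (1 + s) * Bk m σ T 0) * ε := by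
    refine (abs_add_le _ _).trans (add_le_add ?_ hJ)
    rw [abs_mul, abs_neg]
    exact mul_le_mul hFd hηb (abs_nonneg _) (by positivity)
  have h4 := mul_le_mul hGi h3 (abs_nonneg _) (by positivity)
  linarith

end Part9

section Part10
open ProbabilityTheory Filter Topology

/-- truncated boundary trace -/
noncomputable def psi {k : ℕ} (T : ℝ) (φ : ℝ → ℝ → Fin k → ℝ → ℝ) (j : Fin k) (u x : ℝ) : ℝ :=
  (Set.Ioo 0 T ×ˢ Set.Ioi (0:ℝ)).indicator (fun z : ℝ × ℝ => φ z.1 z.2 j 0) (u, x)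

lemma psi_eq {k : ℕ} {T : ℝ} {φ : ℝ → ℝ → Fin k → ℝ → ℝ} {j : Fin k} {u x : ℝ} (hu : 0 < u) (huT : u < T)
    (hx : 0 < x) : psi T φ j u x = φ u x j 0 := by
  unfold psi; rw [Set.indicator_of_mem]; exact ⟨⟨hu, huT⟩, hx⟩

lemma trace_cont {k : ℕ} {T : ℝ} {φ : ℝ → ℝ → Fin k → ℝ → ℝ} (hc : ContOnClosure T φ) (j : Fin k) :
    ContinuousOn (fun z : ℝ × ℝ => φ z.1 z.2 j 0) (Set.Ioo 0 T ×ˢ Set.Ioi (0:ℝ)) := by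
  have h := (hc j).comp (f := fun z : ℝ × ℝ => (z.1, z.2, (0:ℝ))) (s := Set.Ioo 0 T ×ˢ Set.Ioi (0:ℝ))
    (by fun_prop) ?_
  · exact h
  · rintro ⟨u, x⟩ ⟨⟨h1, h2⟩, h3⟩
    simp only [Set.mem_Ioi] at h1 h2 h3
    exact ⟨h1.le, h2.le, h3.le, le_rfl, h1.le⟩

/-- limit `y → 0+` along the domain -/
lemma y_lim {k : ℕ} {T t s : ℝ} {φ : ℝ → ℝ → Fin k → ℝ → ℝ} (hc : ContOnClosure T φ) (j : Fin k)
    (ht : 0 < t) (htT : t < T) (hs : 0 < s) :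
    Tendsto (fun y => φ t s j y) (𝓝[>] 0) (𝓝 (φ t s j 0)) := by
  have h1 : ContinuousOn (fun y => φ t s j y) (Set.Icc 0 t) := by
    have h := (hc j).comp (f := fun y : ℝ => (t, s, y)) (s := Set.Icc 0 t) (by fun_prop) ?_
    · exact h
    · intro y hy; exact ⟨ht.le, htT.le, hs.le, hy.1, hy.2⟩
  have h2 := h1 0 ⟨le_rfl, ht.le⟩
  have h3 : Tendsto (fun y => φ t s j y) (𝓝[Set.Ioo 0 t] 0) (𝓝 (φ t s j 0)) :=
    h2.mono_left (nhdsWithin_mono _ Set.Ioo_subset_Icc_self)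
  rwa [nhdsWithin_Ioo_eq_nhdsGT ht] at h3

lemma psi_src {k : ℕ} {T C : ℝ} {φ : ℝ → ℝ → Fin k → ℝ → ℝ} (hc : ContOnClosure T φ)
    (hC : 0 ≤ C) (hg : ∀ t s y : ℝ, (t, s, y) ∈ domD T → ∀ i, |φ t s i y| ≤ C * (1 + s))
    (hnn : ∀ t s y : ℝ, (t, s, y) ∈ domDbar T → ∀ i, 0 ≤ φ t s i y) (j : Fin k) :
    Src C (psi T φ j) where
  hC := hC
  meas := by
    have hms : MeasurableSet (Set.Ioo 0 T ×ˢ Set.Ioi (0:ℝ)) := measurableSet_Ioo.prod measurableSet_Ioi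
    have h := (trace_cont hc j).measurable_piecewise (g := fun _ => (0:ℝ)) continuousOn_const hms
    have e : (fun z : ℝ × ℝ => psi T φ j z.1 z.2)
        = (Set.Ioo 0 T ×ˢ Set.Ioi (0:ℝ)).piecewise (fun z : ℝ × ℝ => φ z.1 z.2 j 0) (fun _ => (0:ℝ)) := by
      ext z; simp only [psi, Set.indicator, Set.piecewise, Prod.mk.eta]
    rw [e]; exact h
  nn := fun u x => by
    unfold psi
    refine Set.indicator_apply_nonneg ?_
    rintro ⟨⟨h1, h2⟩, h3⟩
    simp only [Set.mem_Ioi] at h1 h2 h3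
    exact hnn _ _ _ ⟨h1.le, h2.le, h3.le, le_rfl, h1.le⟩ j
  gr := fun u x hx => by
    by_cases hu : 0 < u ∧ u < T
    · rw [psi_eq hu.1 hu.2 hx]
      refine le_of_tendsto (y_lim hc j hu.1 hu.2 hx) ?_
      filter_upwards [Ioo_mem_nhdsGT hu.1] with y hy
      exact (le_abs_self _).trans (hg u x y ⟨hu.1, hu.2, hx, hy.1, hy.2⟩ j)
    · unfold psi
      rw [Set.indicator_of_notMem]
      · positivity
      · rintro ⟨h, _⟩; exact hu h

noncomputable def qsum {k : ℕ} (T : ℝ) (p : Fin k → Fin k → ℝ) (φ : ℝ → ℝ → Fin k → ℝ → ℝ) (i : Fin k) (u x : ℝ) : ℝ :=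
  ∑ j, p i j * psi T φ j u x

lemma qsum_src {k : ℕ} {T C : ℝ} {φ : ℝ → ℝ → Fin k → ℝ → ℝ} {p : Fin k → Fin k → ℝ}
    (hp0 : ∀ i j, 0 ≤ p i j) (hp1 : ∀ i, ∑ j, p i j = 1) (hC : 0 ≤ C)
    (S : ∀ j, Src C (psi T φ j)) (i : Fin k) : Src C (qsum T p φ i) where
  hC := hC
  meas := by
    unfold qsum
    exact Finset.measurable_sum _ fun j _ => (S j).meas.const_mul _
  nn := fun u x => Finset.sum_nonneg fun j _ => mul_nonneg (hp0 i j) ((S j).nn u x)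
  gr := fun u x hx => by
    unfold qsum
    calc _ ≤ ∑ j, p i j * (C * (1 + x)) :=
          Finset.sum_le_sum fun j _ => mul_le_mul_of_nonneg_left ((S j).gr u x hx) (hp0 i j)
      _ = C * (1 + x) := by rw [← Finset.sum_mul, hp1, one_mul]

lemma qsum_lip {k : ℕ} {T L : ℝ} {φ : ℝ → ℝ → Fin k → ℝ → ℝ} {p : Fin k → Fin k → ℝ}
    (hp0 : ∀ i j, 0 ≤ p i j) (hp1 : ∀ i, ∑ j, p i j = 1)
    (hL : ∀ j u, LogLip L (psi T φ j u)) (i : Fin k) (u : ℝ) : LogLip L (qsum T p φ i u) := by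
  refine ⟨(hL i u).1, fun x x' hx hx' => ?_⟩
  unfold qsum
  rw [← Finset.sum_sub_distrib]
  calc _ ≤ ∑ j, |p i j * psi T φ j u x - p i j * psi T φ j u x'| := Finset.abs_sum_le_sum_abs _ _
    _ ≤ ∑ j, p i j * (L * |log x - log x'| * (1 + max x x')) := by
        refine Finset.sum_le_sum fun j _ => ?_
        rw [← mul_sub, abs_mul, abs_of_nonneg (hp0 i j)]
        exact mul_le_mul_of_nonneg_left ((hL j u).2 x x' hx hx') (hp0 i j)
    _ = _ := by rw [← Finset.sum_mul, hp1, one_mul]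

lemma ieRHS_eq {k : ℕ} {T K C t s y : ℝ} {r σ : Fin k → ℝ} {φ : ℝ → ℝ → Fin k → ℝ → ℝ} {p : Fin k → Fin k → ℝ}
    {f F : Fin k → ℝ → ℝ} (hσ : ∀ i, 0 < σ i) (S : ∀ j, Src C (psi T φ j)) (i : Fin k)
    (ht : 0 < t) (hs : 0 < s) (hy : 0 ≤ y) :
    ieRHS r σ p f F K T φ t s i y =
      Rf (r i) (σ i) K T (fun x => f i (max x 0)) (F i) (qsum T p φ i) t s y := by
  unfold ieRHS Rf Jf
  congr 1
  rw [← integral_div]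
  refine setIntegral_congr_fun measurableSet_Ioo fun v hv => ?_
  have hv0 : 0 < v := hv.1
  have hvT : t + v < T := by linarith [hv.2]
  have h1 : ∀ j, ∫ x in Set.Ioi (0 : ℝ), φ (t + v) x j 0 * lnKernel (r i) (σ i) x s v
      = Mk (r i - σ i ^2/2) (σ i) 0 (psi T φ j (t + v)) s v := by
    intro j
    rw [← kernel_eq_Mk _ (hσ i) hv0 hs]
    refine setIntegral_congr_fun measurableSet_Ioi fun x hx => ?_
    rw [psi_eq (by linarith) hvT hx]
  have h2 : ∑ j, p i j * Mk (r i - σ i ^2/2) (σ i) 0 (psi T φ j (t + v)) s v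
      = Mk (r i - σ i ^2/2) (σ i) 0 (qsum T p φ i (t + v)) s v := by
    unfold Mk qsum
    simp only [Finset.sum_mul]
    rw [integral_finsetSum]
    · refine Finset.sum_congr rfl fun j _ => ?_
      rw [← integral_const_mul]; congr 1; ext z; ring
    · intro j _
      have := (Mk_integrable (m := r i - σ i ^2/2) (hσ i) hv0.le le_rfl hs ((S j).adm (t + v)) 0).const_mul (p i j)
      refine this.congr (ae_of_all _ fun z => ?_)
      simp only; ring
  simp only [h1, h2]
  rw [max_eq_left (by linarith)]
  ring

end Part10

section Part11
open ProbabilityTheory Filter Topology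

/-- terminal value by continuity -/
lemma term_lim {T s K1 K2 c y : ℝ} {φ : ℝ × ℝ × ℝ → ℝ} (hT : 0 < T) (hs : 0 < s)
    (hc : ContinuousOn φ (domDbar T)) (hy : 0 ≤ y) (hyT : y ≤ T)
    (hb : ∀ ε y, 0 < ε → (T - ε, s, y) ∈ domD T → |φ (T - ε, s, y) - c| ≤ K1 * ε + K2 * √ε) :
    φ (T, s, y) = c := by
  set γ : ℝ → ℝ × ℝ × ℝ := fun ε => (T - ε, s, (1 - 2 * ε / T) * y + ε / 2) with hγ
  have hmem : ∀ ε, 0 < ε → ε < T / 2 → γ ε ∈ domD T := by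
    intro ε h0 h1
    have h2 : 2 * ε / T < 1 := by rw [div_lt_one hT]; linarith
    refine ⟨by simp only [hγ]; linarith, by simp only [hγ]; linarith, hs, ?_, ?_⟩
    · have : 0 ≤ (1 - 2 * ε / T) * y := mul_nonneg (by linarith) hy
      simp only [hγ]; linarith
    · have h3 : (1 - 2 * ε / T) * y ≤ (1 - 2 * ε / T) * T :=
        mul_le_mul_of_nonneg_left hyT (by linarith)
      have h4 : (1 - 2 * ε / T) * T = T - 2 * ε := by field_simp
      simp only [hγ]; linarith
  have hev : ∀ᶠ ε in 𝓝[>] (0:ℝ), 0 < ε ∧ ε < T / 2 := by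
    filter_upwards [Ioo_mem_nhdsGT (show (0:ℝ) < T / 2 by linarith)] with ε hε
    exact hε
  have hγc : Continuous γ := by simp only [hγ]; fun_prop
  have hγ0 : γ 0 = (T, s, y) := by simp [hγ]
  have hsub : ∀ z, z ∈ domD T → z ∈ domDbar T := fun z hz =>
    ⟨hz.1.le, hz.2.1.le, hz.2.2.1.le, hz.2.2.2.1.le, hz.2.2.2.2.le⟩
  have l1 : Tendsto (fun ε => φ (γ ε)) (𝓝[>] 0) (𝓝 (φ (T, s, y))) := by
    have h1 := hc (T, s, y) ⟨hT.le, le_rfl, hs.le, hy, hyT⟩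
    refine h1.tendsto.comp (tendsto_nhdsWithin_iff.2 ⟨?_, ?_⟩)
    · have := (hγc.tendsto 0).mono_left (nhdsWithin_le_nhds (s := Set.Ioi 0))
      rwa [hγ0] at this
    · filter_upwards [hev] with ε hε
      exact hsub _ (hmem ε hε.1 hε.2)
  have l2 : Tendsto (fun ε => φ (γ ε)) (𝓝[>] 0) (𝓝 c) := by
    rw [tendsto_iff_dist_tendsto_zero]
    have h0 : Tendsto (fun ε : ℝ => K1 * ε + K2 * √ε) (𝓝[>] 0) (𝓝 0) := by
      have : Continuous (fun ε : ℝ => K1 * ε + K2 * √ε) := by fun_prop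
      have := (this.tendsto 0).mono_left (nhdsWithin_le_nhds (s := Set.Ioi 0))
      simpa using this
    refine squeeze_zero' (Eventually.of_forall fun _ => dist_nonneg) ?_ h0
    filter_upwards [hev] with ε hε
    rw [Real.dist_eq]
    exact hb ε _ hε.1 (hmem ε hε.1 hε.2)
  exact tendsto_nhds_unique l1 l2

end Part11

/-- The unique continuous non-negative linear-growth solution of the Volterra
integral equation also solves the initial-boundary value problem. -/
theorem volterra_solution_solves_pde
    (k : ℕ) (hk : 1 ≤ k) (T K : ℝ) (hT : 0 < T) (hK : 0 < K)
    (r σ : Fin k → ℝ) (hr : ∀ i, 0 ≤ r i) (hσ : ∀ i, 0 < σ i)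
    (p : Fin k → Fin k → ℝ) (hp0 : ∀ i j, 0 ≤ p i j)
    (hp1 : ∀ i, ∑ j, p i j = 1) (hpd : ∀ i, p i i = 0)
    (f : Fin k → ℝ → ℝ)
    (hfC1 : ∀ i, ContDiffOn ℝ 1 (f i) (Set.Ici 0))
    (hfbd : ∀ i, ∃ M : ℝ, ∀ y, 0 ≤ y → f i y ≤ M)
    (hfpos : ∀ i y, 0 < y → 0 < f i y)
    (hfnn : ∀ i y, 0 ≤ y → 0 ≤ f i y)
    (hfdens : ∀ i, ∫ u in Set.Ioi (0 : ℝ), f i u = 1)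
    (F : Fin k → ℝ → ℝ) (hFdef : ∀ i y, F i y = ∫ u in (0 : ℝ)..y, f i u)
    (hFlt : ∀ i y, 0 ≤ y → F i y < 1)
    (φ : ℝ → ℝ → Fin k → ℝ → ℝ)
    (hφc : ContOnClosure T φ) (hφg : LinGrowth T φ)
    (hφnn : ∀ t s y : ℝ, (t, s, y) ∈ domDbar T → ∀ i, 0 ≤ φ t s i y)
    (hφIE : SolvesIE r σ p f F K T φ) :
    (∀ t y : ℝ, ∀ i, 0 ≤ t → t ≤ T → 0 ≤ y → y ≤ t → φ t 0 i y = 0) ∧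
    (∀ s : ℝ, 0 < s → ∀ y : ℝ, 0 ≤ y → y ≤ T → ∀ i, φ T s i y = max (s - K) 0) ∧
    (∀ t s y : ℝ, (t, s, y) ∈ domD T → ∀ i,
      ∃ a b c d : ℝ,
        HasDerivAt (fun τ => φ τ s i y) a t ∧
        HasDerivAt (fun w => φ t w i y) b s ∧
        HasDerivAt (deriv (fun w => φ t w i y)) c s ∧
        HasDerivAt (fun u => φ t s i u) d y ∧
        a + d + r i * s * b + (1 / 2) * (σ i) ^ 2 * s ^ 2 * c
          + (f i y / (1 - F i y)) *
              ∑ j ∈ Finset.univ.erase i, p i j * (φ t s j 0 - φ t s i y)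
          = r i * φ t s i y) := by
  obtain ⟨C0, hC0⟩ := hφg
  set C := |C0| with hCdef
  have hC : 0 ≤ C := abs_nonneg _
  have hgr : ∀ t s y : ℝ, (t, s, y) ∈ domD T → ∀ i, |φ t s i y| ≤ C * (1 + s) := by
    intro t s y h i
    refine (hC0 t s y h i).trans ?_
    have hs : 0 < s := h.2.2.1
    exact mul_le_mul_of_nonneg_right (le_abs_self _) (by linarith)
  have S := fun j => psi_src hφc hC hgr hφnn j
  have Sq := fun i => qsum_src hp0 hp1 hC S i
  have hD := fun i => mkDat hT (hfC1 i) (hfnn i) (hFdef i) (hFlt i)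
  choose B D using hD
  have hφR : ∀ t s y : ℝ, (t, s, y) ∈ domD T → ∀ i, φ t s i y =
      Rf (r i) (σ i) K T (fun x => f i (max x 0)) (F i) (qsum T p φ i) t s y := by
    intro t s y h i
    rw [hφIE.1 t s y h i]
    exact ieRHS_eq hσ S i h.1 h.2.2.1 h.2.2.2.1.le
  have hLip := fun i => Rf_lip hT (hr i) (hσ i) hK (D i) (Sq i)
  choose Lc hLc0 hLc using hLip
  have hLpsi : ∀ j u, LogLip (∑ i, Lc i) (psi T φ j u) := by
    intro j u
    have hL0 : 0 ≤ ∑ i, Lc i := Finset.sum_nonneg fun i _ => hLc0 i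
    refine ⟨hL0, fun x x' hx hx' => ?_⟩
    have hm : 0 < max x x' := lt_max_of_lt_left hx
    by_cases hu : 0 < u ∧ u < T
    · rw [psi_eq hu.1 hu.2 hx, psi_eq hu.1 hu.2 hx']
      have hlim := ((y_lim hφc j hu.1 hu.2 hx).sub (y_lim hφc j hu.1 hu.2 hx')).abs
      refine le_of_tendsto hlim ?_
      filter_upwards [Ioo_mem_nhdsGT hu.1] with y hy
      rw [hφR u x y ⟨hu.1, hu.2, hx, hy.1, hy.2⟩ j, hφR u x' y ⟨hu.1, hu.2, hx', hy.1, hy.2⟩ j]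
      refine (hLc j u y x x' hu.1 hu.2 hy.1 (hy.2.trans hu.2).le hx hx').trans ?_
      have h1 : Lc j ≤ ∑ i, Lc i :=
        Finset.single_le_sum (f := Lc) (fun i _ => hLc0 i) (Finset.mem_univ j)
      have h2 : 0 ≤ |Real.log x - Real.log x'| := abs_nonneg _
      gcongr
    · have h0 : ∀ x, psi T φ j u x = 0 := by
        intro x
        unfold psi
        rw [Set.indicator_of_notMem]
        rintro ⟨h, _⟩; exact hu h
      rw [h0, h0, sub_zero, abs_zero]
      positivity
  have hLq := fun i u => qsum_lip (φ := φ) hp0 hp1 hLpsi i u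
  have hqc : ∀ i s, 0 < s → ContinuousOn (fun u => qsum T p φ i u s) (Set.Ioo 0 T) := by
    intro i s hs
    unfold qsum
    refine continuousOn_finsetSum _ fun j _ => continuousOn_const.mul ?_
    have h := (trace_cont hφc j).comp (f := fun u : ℝ => (u, s)) (s := Set.Ioo 0 T)
      (by fun_prop) (fun u hu => ⟨hu, hs⟩)
    exact h.congr fun u hu => psi_eq hu.1 hu.2 hs
  refine ⟨hφIE.2, ?_, ?_⟩
  · intro s hs y hy hyT i
    obtain ⟨K1, K2, hK12⟩ := Rf_term hT (hr i) (hσ i) hK (D i) (Sq i) hs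
    refine term_lim (K1 := K1) (K2 := K2) (φ := fun q : ℝ × ℝ × ℝ => φ q.1 q.2.1 i q.2.2)
      hT hs (hφc i) hy hyT ?_
    intro ε y' hε hm
    have e := hφR _ _ _ hm i
    obtain ⟨h1, h2, h3, h4, h5⟩ := hm
    dsimp only at h1 h2 h3 h4 h5
    dsimp only
    rw [e]
    exact hK12 ε y' hε (by linarith) h4 (by linarith)
  · intro t s y hm i
    have hm' := hm
    obtain ⟨h1, h2, h3, h4, h5⟩ := hm'
    dsimp only at h1 h2 h3 h4 h5
    obtain ⟨a, b, c, d, ha, hb, hc, hd, heq⟩ := core (hr i) (hσ i) hK h1 h2 h3 h4 (h5.trans h2)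
      (Sq i) (hLq i) (hqc i s h3) (D i).cont (D i).meas' (D i).der (D i).bd (D i).bd' (D i).derF
      (D i).F1
    have es : Filter.EventuallyEq (nhds s) (fun w => φ t w i y) (fun w => Rf (r i) (σ i) K T
        (fun x => f i (max x 0)) (F i) (qsum T p φ i) t w y) := by
      filter_upwards [Ioi_mem_nhds h3] with w hw
      exact hφR t w y ⟨h1, h2, hw, h4, h5⟩ i
    refine ⟨a, b, c, d, ha.congr_of_eventuallyEq ?_, hb.congr_of_eventuallyEq es,
      hc.congr_of_eventuallyEq es.deriv, hd.congr_of_eventuallyEq ?_, ?_⟩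
    · filter_upwards [Ioo_mem_nhds h5 h2] with τ hτ
      exact hφR τ s y ⟨h4.trans hτ.1, hτ.2, h3, h4, hτ.1⟩ i
    · filter_upwards [Ioo_mem_nhds h4 h5] with u hu
      exact hφR t s u ⟨h1, h2, h3, hu.1, hu.2⟩ i
    · rw [← hφR t s y hm i] at heq
      rw [max_eq_left h4.le] at heq
      have hsum : ∑ j ∈ Finset.univ.erase i, p i j * (φ t s j 0 - φ t s i y)
          = qsum T p φ i t s - φ t s i y := by
        rw [Finset.sum_erase _ (by rw [hpd, zero_mul])]
        simp only [mul_sub, Finset.sum_sub_distrib, ← Finset.sum_mul, hp1, one_mul]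
        congr 1
        exact Finset.sum_congr rfl fun j _ => by rw [psi_eq h1 h2 h3]
      rw [hsum]
      linear_combination heq
end

section
/- Let φ be a classical solution with at most linear growth of the initial-boundary value problem: φ is continuous on the closure of D, of class C^{1,2,1} on D, satisfies on D the equation ∂φ/∂t + ∂φ/∂y + r(i) s ∂φ/∂s + ½ σ(i)² s² ∂²φ/∂s² + (f(y|i)/(1−F(y|i))) Σ_{j≠i} p_{ij} (φ(t,s,j,0) − φ(t,s,i,y)) = r(i) φ(t,s,i,y), and satisfies φ(t,0,i,y) = 0 for all t ∈ [0,T] and φ(T,s,i,y) = (s−K)⁺. Then φ also solves the Volterra integral equation φ(t,s,i,y) = ((1−F(T−t+y|i))/(1−F(y|i))) η_i(t,s) + ∫₀^{T−t} e^{−r(i)v} (f(y+v|i)/(1−F(y|i))) Σ_j p_{ij} ∫₀^∞ φ(t+v,x,j,0) α(x;s,i,v) dx dv on D. -/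
open MeasureTheory Real Set Finset

noncomputable def gd (z : ℝ) : ℝ := Real.exp (-z ^ 2 / 2) / Real.sqrt (2 * Real.pi)

lemma gd_pos (z : ℝ) : 0 < gd z := by unfold gd; positivity

lemma gd_cont : Continuous gd := by unfold gd; fun_prop

lemma gd_deriv (z : ℝ) : HasDerivAt gd (-z * gd z) z := by
  unfold gd
  have h : HasDerivAt (fun z : ℝ => -z ^ 2 / 2) (-z) z := by
    have := ((hasDerivAt_pow 2 z).neg).div_const 2
    refine this.congr_deriv ?_
    simp; ring
  refine (h.exp.div_const _).congr_deriv ?_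
  ring

lemma gd_integral : ∫ z, gd z = 1 := by
  unfold gd
  rw [integral_div]
  have : ∀ z : ℝ, Real.exp (-z ^ 2 / 2) = Real.exp (-(1/2) * z ^ 2) := fun z => by congr 1; ring
  simp_rw [this]
  rw [integral_gaussian]
  have : π / (1/2) = 2 * π := by ring
  rw [this]
  exact div_self (by positivity)

lemma gd_exp_integrable (c : ℝ) : Integrable (fun z => gd z * Real.exp (c * |z|)) := by
  have h := (integrable_exp_neg_mul_sq (b := 1/4) (by norm_num)).const_mul
    (Real.exp (c^2) / Real.sqrt (2 * Real.pi))
  refine h.mono' ?_ ?_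
  · exact (gd_cont.mul (by fun_prop)).aestronglyMeasurable
  · refine Filter.Eventually.of_forall fun z => ?_
    rw [Real.norm_of_nonneg (mul_nonneg (gd_pos z).le (Real.exp_pos _).le)]
    unfold gd
    rw [div_mul_eq_mul_div, div_mul_eq_mul_div, ← Real.exp_add, ← Real.exp_add]
    have : c * |z| ≤ c ^ 2 + z ^ 2 / 4 := by
      have := sq_nonneg (c - |z| / 2)
      have h2 : |z|^2 = z^2 := sq_abs z
      nlinarith
    refine div_le_div_of_nonneg_right (Real.exp_le_exp.2 ?_) (Real.sqrt_nonneg _)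
    linarith

/-- Integrability of gaussian-weighted functions of exponential growth. -/
lemma gd_integrable {h : ℝ → ℝ} (hc : Continuous h) {C c : ℝ}
    (hb : ∀ z, |h z| ≤ C * Real.exp (c * |z|)) : Integrable (fun z => gd z * h z) := by
  refine ((gd_exp_integrable c).const_mul C).mono' (gd_cont.mul hc).aestronglyMeasurable ?_
  refine Filter.Eventually.of_forall fun z => ?_
  rw [Real.norm_eq_abs, abs_mul, abs_of_pos (gd_pos z)]
  nlinarith [hb z, gd_pos z]

/-- Polynomial factor absorbed. -/
lemma gd_poly_integrable (c : ℝ) :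
    Integrable (fun z => gd z * ((16 + 4 * z ^ 2) * Real.exp (c * |z|))) := by
  refine gd_integrable (C := 16) (c := c + 1) (by fun_prop) fun z => ?_
  rw [abs_of_nonneg (by positivity)]
  have h1 := Real.quadratic_le_exp_of_nonneg (abs_nonneg z)
  rw [sq_abs] at h1
  have h0 := abs_nonneg z
  have : Real.exp ((c+1) * |z|) = Real.exp (|z|) * Real.exp (c * |z|) := by
    rw [← Real.exp_add]; ring_nf
  rw [this, ← mul_assoc]
  gcongr
  nlinarith

noncomputable def chi (R z : ℝ) : ℝ := (1 - z ^ 2 / R ^ 2) ^ 2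
noncomputable def chi1 (R z : ℝ) : ℝ := -(4 * z / R ^ 2) * (1 - z ^ 2 / R ^ 2)
noncomputable def chi2 (R z : ℝ) : ℝ := -4 / R ^ 2 + 12 * z ^ 2 / R ^ 4

lemma chi_cont (R : ℝ) : Continuous (chi R) := by unfold chi; fun_prop
lemma chi1_cont (R : ℝ) : Continuous (chi1 R) := by unfold chi1; fun_prop
lemma chi2_cont (R : ℝ) : Continuous (chi2 R) := by unfold chi2; fun_prop

lemma chi_deriv (R z : ℝ) : HasDerivAt (chi R) (chi1 R z) z := by
  unfold chi chi1
  have h : HasDerivAt (fun z : ℝ => 1 - z ^ 2 / R ^ 2) (-(2 * z / R ^ 2)) z := by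
    refine (((hasDerivAt_pow 2 z).div_const (R ^ 2)).const_sub 1).congr_deriv ?_
    simp
  refine (h.pow 2).congr_deriv ?_
  push_cast; ring

lemma chi1_deriv (R z : ℝ) : HasDerivAt (chi1 R) (chi2 R z) z := by
  unfold chi1 chi2
  have h : HasDerivAt (fun z : ℝ => 1 - z ^ 2 / R ^ 2) (-(2 * z / R ^ 2)) z := by
    refine (((hasDerivAt_pow 2 z).div_const (R ^ 2)).const_sub 1).congr_deriv ?_
    simp
  have h2 : HasDerivAt (fun z : ℝ => -(4 * z / R ^ 2)) (-(4 / R ^ 2)) z := by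
    refine ((((hasDerivAt_id z).const_mul 4).div_const (R ^ 2)).neg).congr_deriv ?_
    simp
  refine (h2.mul h).congr_deriv ?_
  ring

/-- quantitative truncation estimate -/
lemma trunc_est {h : ℝ → ℝ} (hc : Continuous h) {C c : ℝ}
    (hb : ∀ z, |h z| ≤ C * Real.exp (c * |z|)) {R : ℝ} (hR : 0 < R) :
    |(∫ z in (-R)..R, chi R z * gd z * h z) - ∫ z, gd z * h z|
      ≤ C * (∫ z, gd z * ((16 + 4 * z ^ 2) * Real.exp (c * |z|))) / R ^ 2 := by
  have hC : 0 ≤ C := by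
    have := (abs_nonneg _).trans (hb 0)
    simpa using this
  rw [intervalIntegral.integral_of_le (by linarith), ← integral_indicator measurableSet_Ioc]
  have hi : Integrable ((Set.Ioc (-R) R).indicator fun z => chi R z * gd z * h z) := by
    rw [integrable_indicator_iff measurableSet_Ioc]
    exact (((chi_cont R).mul gd_cont).mul hc).integrableOn_Ioc
  rw [← integral_sub hi (gd_integrable hc hb)]
  rw [mul_div_right_comm, ← integral_const_mul]
  rw [← Real.norm_eq_abs]
  refine (norm_integral_le_integral_norm _).trans ?_
  refine integral_mono (hi.sub (gd_integrable hc hb)).norm ((gd_poly_integrable c).const_mul _) ?_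
  intro z
  have hg := gd_pos z
  have hR2 : 0 < R ^ 2 := by positivity
  have key : ∀ q : ℝ, |q| * R ^ 2 ≤ 16 + 4 * z ^ 2 →
      |q * (gd z * h z)| ≤ C / R ^ 2 * (gd z * ((16 + 4 * z ^ 2) * Real.exp (c * |z|))) := by
    intro q hq
    rw [abs_mul, abs_mul, abs_of_pos hg]
    have : |q| ≤ (16 + 4 * z ^ 2) / R ^ 2 := by rwa [le_div_iff₀ hR2]
    calc |q| * (gd z * |h z|) ≤ ((16 + 4 * z ^ 2) / R ^ 2) * (gd z * (C * Real.exp (c * |z|))) := by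
          gcongr; exact hb z
      _ = _ := by ring
  simp only [Real.norm_eq_abs]
  by_cases hz : z ∈ Set.Ioc (-R) R
  · rw [Set.indicator_of_mem hz]
    have := key (chi R z - 1) ?_
    · rwa [show (chi R z - 1) * (gd z * h z) = chi R z * gd z * h z - gd z * h z by ring] at this
    have hzz : z ^ 2 ≤ R ^ 2 := by nlinarith [hz.1, hz.2]
    have hx : z ^ 2 / R ^ 2 ≤ 1 := by rw [div_le_one hR2]; exact hzz
    have hx0 : 0 ≤ z ^ 2 / R ^ 2 := by positivity
    have hxx : z ^ 2 / R ^ 2 * R ^ 2 = z ^ 2 := by field_simp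
    unfold chi
    rw [abs_of_nonpos (by nlinarith)]
    nlinarith
  · rw [Set.indicator_of_notMem hz]
    have := key (-1) ?_
    · rwa [show (-1) * (gd z * h z) = 0 - gd z * h z by ring] at this
    have hzz : R ^ 2 ≤ z ^ 2 := by
      by_cases h1 : -R < z
      · have : R < z := by
          by_contra h2; exact hz ⟨h1, not_lt.mp h2⟩
        nlinarith
      · nlinarith [not_lt.mp h1]
    simp; nlinarith [sq_nonneg z]

lemma err_est {h : ℝ → ℝ} (hc : Continuous h) {C c : ℝ}
    (hb : ∀ z, |h z| ≤ C * Real.exp (c * |z|)) {R : ℝ} (hR : 0 < R) :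
    |(∫ z in (-R)..R, (chi2 R z - z * chi1 R z) * gd z * h z)|
      ≤ C * (∫ z, gd z * ((16 + 4 * z ^ 2) * Real.exp (c * |z|))) / R ^ 2 := by
  have hC : 0 ≤ C := by
    have := (abs_nonneg _).trans (hb 0)
    simpa using this
  rw [intervalIntegral.integral_of_le (by linarith), ← integral_indicator measurableSet_Ioc]
  have hi : Integrable ((Set.Ioc (-R) R).indicator
      fun z => (chi2 R z - z * chi1 R z) * gd z * h z) := by
    rw [integrable_indicator_iff measurableSet_Ioc]
    exact (((((chi2_cont R).sub (continuous_id.mul (chi1_cont R))).mul gd_cont)).mul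
      hc).integrableOn_Ioc
  rw [mul_div_right_comm, ← integral_const_mul]
  rw [← Real.norm_eq_abs]
  refine (norm_integral_le_integral_norm _).trans ?_
  refine integral_mono hi.norm ((gd_poly_integrable c).const_mul _) ?_
  intro z
  have hg := gd_pos z
  have hR2 : 0 < R ^ 2 := by positivity
  simp only [Real.norm_eq_abs]
  by_cases hz : z ∈ Set.Ioc (-R) R
  · rw [Set.indicator_of_mem hz]
    have hzz : z ^ 2 ≤ R ^ 2 := by nlinarith [hz.1, hz.2]
    have hx : z ^ 2 / R ^ 2 ≤ 1 := by rw [div_le_one hR2]; exact hzz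
    have hx0 : 0 ≤ z ^ 2 / R ^ 2 := by positivity
    have hq : |chi2 R z - z * chi1 R z| ≤ (16 + 4 * z ^ 2) / R ^ 2 := by
      have e : chi2 R z - z * chi1 R z
          = (-4 + 12 * (z ^ 2 / R ^ 2) + 4 * z ^ 2 * (1 - z ^ 2 / R ^ 2)) / R ^ 2 := by
        unfold chi2 chi1; field_simp
        try ring
      rw [e, abs_div, abs_of_pos hR2]
      gcongr
      have hz2 := sq_nonneg z
      have := mul_nonneg hz2 hx0
      have := mul_nonneg hz2 (sub_nonneg.2 hx)
      rw [abs_le]; constructor <;> nlinarith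
    rw [abs_mul, abs_mul, abs_of_pos hg]
    calc |chi2 R z - z * chi1 R z| * gd z * |h z|
          ≤ ((16 + 4 * z ^ 2) / R ^ 2) * gd z * (C * Real.exp (c * |z|)) := by
          gcongr; exact hb z
      _ = _ := by ring
  · rw [Set.indicator_of_notMem hz]
    simp only [abs_zero]
    positivity

/-- integration by parts against the truncated gaussian -/
lemma ibp {h h1 h2 : ℝ → ℝ} (d1 : ∀ z, HasDerivAt h (h1 z) z) (d2 : ∀ z, HasDerivAt h1 (h2 z) z)
    (c2 : Continuous h2) {R : ℝ} (hR : 0 < R) :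
    ∫ z in (-R)..R, chi R z * gd z * (z * h1 z - h2 z)
      = - ∫ z in (-R)..R, (chi2 R z - z * chi1 R z) * gd z * h z := by
  have c0 : Continuous h := continuous_iff_continuousAt.2 fun z => (d1 z).continuousAt
  have c1 : Continuous h1 := continuous_iff_continuousAt.2 fun z => (d2 z).continuousAt
  have k0 := chi_cont R
  have k1 := chi1_cont R
  have k2 := chi2_cont R
  have kg := gd_cont
  have hd : ∀ z, HasDerivAt (fun z => - (chi R z * gd z * h1 z) + chi1 R z * gd z * h z)
      (chi R z * gd z * (z * h1 z - h2 z) + (chi2 R z - z * chi1 R z) * gd z * h z) z := by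
    intro z
    refine ((((chi_deriv R z).mul (gd_deriv z)).mul (d2 z)).neg.add
      (((chi1_deriv R z).mul (gd_deriv z)).mul (d1 z))).congr_deriv ?_
    simp only [Pi.mul_apply]
    ring
  have i1 : IntervalIntegrable (fun z => chi R z * gd z * (z * h1 z - h2 z)) volume (-R) R :=
    Continuous.intervalIntegrable (by fun_prop) _ _
  have i2 : IntervalIntegrable (fun z => (chi2 R z - z * chi1 R z) * gd z * h z) volume (-R) R :=
    Continuous.intervalIntegrable (by fun_prop) _ _
  have := intervalIntegral.integral_eq_sub_of_hasDerivAt (fun z _ => hd z) (i1.add i2)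
  rw [intervalIntegral.integral_add i1 i2] at this
  have e1 : chi R R = 0 := by unfold chi; field_simp; simp
  have e2 : chi R (-R) = 0 := by unfold chi; rw [neg_sq]; field_simp; simp
  have e3 : chi1 R R = 0 := by unfold chi1; field_simp; simp
  have e4 : chi1 R (-R) = 0 := by unfold chi1; rw [neg_sq]; field_simp; simp
  simp only [e1, e2, e3, e4] at this
  linarith

lemma gd_param_cont {V C c : ℝ} {G : ℝ → ℝ → ℝ}
    (hG : ContinuousOn (fun q : ℝ × ℝ => G q.1 q.2) (Set.Icc 0 V ×ˢ Set.univ))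
    (hGb : ∀ v ∈ Set.Icc 0 V, ∀ z, |G v z| ≤ C * Real.exp (c * |z|)) :
    ContinuousOn (fun v => ∫ z, gd z * G v z) (Set.Icc 0 V) := by
  refine continuousOn_of_dominated (bound := fun z => C * (gd z * Real.exp (c * |z|))) ?_ ?_
    ((gd_exp_integrable c).const_mul C) ?_
  · intro v hv
    have : Continuous (G v) := by
      have := hG.comp (f := fun z => (v, z)) (s := Set.univ) (by fun_prop) (fun z _ => ⟨hv, trivial⟩)
      exact continuousOn_univ.1 this
    exact (gd_cont.mul this).aestronglyMeasurable
  · intro v hv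
    refine Filter.Eventually.of_forall fun z => ?_
    rw [Real.norm_eq_abs, abs_mul, abs_of_pos (gd_pos z)]
    nlinarith [hGb v hv z, gd_pos z]
  · refine Filter.Eventually.of_forall fun z => ?_
    exact continuousOn_const.mul
      (hG.comp (f := fun v => (v, z)) (by fun_prop) (fun v hv => ⟨hv, trivial⟩))

/-- Feynman–Kac type identity in Gaussian coordinates. -/
lemma feynman_kac {V C c : ℝ} (hV : 0 < V) {H H1 H2 G : ℝ → ℝ → ℝ}
    (hH : ContinuousOn (fun q : ℝ × ℝ => H q.1 q.2) (Set.Icc 0 V ×ˢ Set.univ))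
    (hG : ContinuousOn (fun q : ℝ × ℝ => G q.1 q.2) (Set.Icc 0 V ×ˢ Set.univ))
    (hH1 : ContinuousOn (fun q : ℝ × ℝ => H1 q.1 q.2) (Set.Ioo 0 V ×ˢ Set.univ))
    (hH2 : ContinuousOn (fun q : ℝ × ℝ => H2 q.1 q.2) (Set.Ioo 0 V ×ˢ Set.univ))
    (hHb : ∀ v ∈ Set.Icc 0 V, ∀ z, |H v z| ≤ C * Real.exp (c * |z|))
    (hGb : ∀ v ∈ Set.Icc 0 V, ∀ z, |G v z| ≤ C * Real.exp (c * |z|))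
    (dv : ∀ v ∈ Set.Ioo 0 V, ∀ z,
      HasDerivAt (fun u => H u z) ((z * H1 v z - H2 v z) / (2 * v) - G v z) v)
    (d1 : ∀ v ∈ Set.Ioo 0 V, ∀ z, HasDerivAt (fun z => H v z) (H1 v z) z)
    (d2 : ∀ v ∈ Set.Ioo 0 V, ∀ z, HasDerivAt (fun z => H1 v z) (H2 v z) z) :
    ∫ z, gd z * H 0 z = (∫ z, gd z * H V z) + ∫ v in (0:ℝ)..V, ∫ z, gd z * G v z := by
  have slice : ∀ {A : ℝ → ℝ → ℝ} {S : Set ℝ},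
      ContinuousOn (fun q : ℝ × ℝ => A q.1 q.2) (S ×ˢ Set.univ) → ∀ v ∈ S, Continuous (A v) := by
    intro A S hA v hv
    have := hA.comp (f := fun z => (v, z)) (s := Set.univ) (by fun_prop) (fun z _ => ⟨hv, trivial⟩)
    exact continuousOn_univ.1 this
  set J := ∫ z, gd z * ((16 + 4 * z ^ 2) * Real.exp (c * |z|)) with hJ
  have hMc := gd_param_cont hH hHb
  have hNc := gd_param_cont hG hGb
  set M := fun v => ∫ z, gd z * H v z with hM
  set N := fun v => ∫ z, gd z * G v z with hN
  have key : ∀ a b, 0 < a → a ≤ b → b < V → M b - M a + ∫ v in a..b, N v = 0 := by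
    intro a b ha hab hbV
    have hsub : Set.Icc a b ⊆ Set.Ioo 0 V := fun v hv => ⟨by linarith [hv.1], by linarith [hv.2]⟩
    have hsub' : Set.Icc a b ⊆ Set.Icc 0 V := hsub.trans Set.Ioo_subset_Icc_self
    -- the bound
    have bnd : ∀ R : ℝ, 0 < R → |M b - M a + ∫ v in a..b, N v|
        ≤ (2 * (C * J) + (C * J / (2 * a) + C * J) * (b - a)) / R ^ 2 := by
      intro R hR
      set Φ : ℝ → ℝ → ℝ := fun z v =>
        chi R z * gd z * ((z * H1 v z - H2 v z) / (2 * v) - G v z) with hΦ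
      have hΦc : ContinuousOn (fun q : ℝ × ℝ => Φ q.1 q.2) (Set.Icc (-R) R ×ˢ Set.Icc a b) := by
        have mp : Set.MapsTo (fun q : ℝ × ℝ => (q.2, q.1)) (Set.Icc (-R) R ×ˢ Set.Icc a b)
          (Set.Ioo 0 V ×ˢ Set.univ) := fun q hq => ⟨hsub hq.2, trivial⟩
        have mp' : Set.MapsTo (fun q : ℝ × ℝ => (q.2, q.1)) (Set.Icc (-R) R ×ˢ Set.Icc a b)
          (Set.Icc 0 V ×ˢ Set.univ) := fun q hq => ⟨hsub' hq.2, trivial⟩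
        have sw : ContinuousOn (fun q : ℝ × ℝ => (q.2, q.1)) (Set.Icc (-R) R ×ˢ Set.Icc a b) := by
          fun_prop
        have c1 := hH1.comp sw mp
        have c2 := hH2.comp sw mp
        have c3 := hG.comp sw mp'
        have cg := gd_cont
        have cc := chi_cont R
        refine ContinuousOn.mul (by fun_prop) (((continuousOn_fst.mul c1).sub c2).div
          (by fun_prop) ?_ |>.sub c3)
        intro q hq
        have : 0 < q.2 := (hsub hq.2).1
        positivity
      have hRR : -R ≤ R := by linarith
      have hΦi : Integrable (Function.uncurry Φ)
          ((volume.restrict (Set.uIoc (-R) R)).prod (volume.restrict (Set.uIoc a b))) := by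
        rw [Set.uIoc_of_le hRR, Set.uIoc_of_le hab, Measure.prod_restrict]
        have : IntegrableOn (Function.uncurry Φ) (Set.Icc (-R) R ×ˢ Set.Icc a b)
            (volume.prod volume) :=
          ContinuousOn.integrableOn_compact (isCompact_Icc.prod isCompact_Icc) hΦc
        exact this.mono_set (Set.prod_mono Set.Ioc_subset_Icc_self Set.Ioc_subset_Icc_self)
      have swap := intervalIntegral_intervalIntegral_swap (F := Φ) (a := -R) (b := R) (c := a) (d := b)
        (by rwa [Measure.prod_restrict, ← Measure.volume_eq_prod] at hΦi)
      have hXint : IntervalIntegrable (fun v => ∫ z in (-R)..R, Φ z v) volume a b := by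
        have := hΦi.integral_prod_right
        rw [Set.uIoc_of_le hRR, Set.uIoc_of_le hab] at this
        rw [intervalIntegrable_iff_integrableOn_Ioc_of_le hab]
        simpa [IntegrableOn, intervalIntegral.integral_of_le hRR] using this
      have hNint : IntervalIntegrable N volume a b :=
        (hNc.mono hsub').intervalIntegrable_of_Icc hab
      have left : ∫ z in (-R)..R, ∫ v in a..b, Φ z v
          = (∫ z in (-R)..R, chi R z * gd z * H b z) - ∫ z in (-R)..R, chi R z * gd z * H a z := by
        have ca := slice hH a (hsub' ⟨le_rfl, hab⟩)
        have cb := slice hH b (hsub' ⟨hab, le_rfl⟩)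
        have k0 := chi_cont R
        have kg := gd_cont
        rw [← intervalIntegral.integral_sub
          (Continuous.intervalIntegrable (by fun_prop) _ _)
          (Continuous.intervalIntegrable (by fun_prop) _ _)]
        refine intervalIntegral.integral_congr fun z hz => ?_
        rw [Set.uIcc_of_le hRR] at hz
        have hi : IntervalIntegrable (fun v => Φ z v) volume a b := by
          refine ContinuousOn.intervalIntegrable_of_Icc hab ?_
          exact hΦc.comp (f := fun v => (z, v)) (by fun_prop) (fun v hv => ⟨hz, hv⟩)
        have := intervalIntegral.integral_eq_sub_of_hasDerivAt
          (f := fun v => chi R z * gd z * H v z) (f' := fun v => Φ z v) (a := a) (b := b)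
          (fun v hv => (dv v (hsub (by rwa [Set.uIcc_of_le hab] at hv)) z).const_mul _) hi
        exact this
      have Xv : ∀ v ∈ Set.Icc a b, |(∫ z in (-R)..R, Φ z v) + N v|
          ≤ (C * J / (2 * a) + C * J) / R ^ 2 := by
        intro v hv
        have hv0 := hsub hv
        have hv1 := hsub' hv
        have b1 := slice hH1 v hv0
        have b2 := slice hH2 v hv0
        have b3 := slice hG v hv1
        have k0 := chi_cont R
        have kg := gd_cont
        have e : (∫ z in (-R)..R, Φ z v)
            = (∫ z in (-R)..R, chi R z * gd z * (z * H1 v z - H2 v z)) / (2 * v)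
              - ∫ z in (-R)..R, chi R z * gd z * G v z := by
          rw [← intervalIntegral.integral_div, ← intervalIntegral.integral_sub
            (Continuous.intervalIntegrable (by fun_prop) _ _)
            (Continuous.intervalIntegrable (by fun_prop) _ _)]
          refine intervalIntegral.integral_congr fun z _ => ?_
          simp only [hΦ]; ring
        rw [e, ibp (d1 v hv0) (d2 v hv0) b2 hR]
        have t1 := err_est (slice hH v hv1) (hHb v hv1) hR
        have t2 := trunc_est b3 (hGb v hv1) hR
        rw [← hJ] at t1 t2
        set E := ∫ z in (-R)..R, (chi2 R z - z * chi1 R z) * gd z * H v z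
        set Q := ∫ z in (-R)..R, chi R z * gd z * G v z
        have : -E / (2 * v) - Q + N v = -(E / (2 * v)) - (Q - N v) := by ring
        rw [this]
        refine (abs_sub _ _).trans ?_
        rw [abs_neg, add_div]
        refine add_le_add ?_ t2
        rw [abs_div, abs_of_pos (show 0 < 2 * v by linarith [hv0.1])]
        have : C * J / (2 * a) / R ^ 2 = C * J / R ^ 2 / (2 * a) := by ring
        rw [this]
        have hp := (abs_nonneg _).trans t1
        exact div_le_div₀ hp t1 (by linarith) (by linarith [hv.1])
      have I2 : |(∫ v in a..b, ∫ z in (-R)..R, Φ z v) + ∫ v in a..b, N v|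
          ≤ (C * J / (2 * a) + C * J) / R ^ 2 * (b - a) := by
        rw [← intervalIntegral.integral_add hXint hNint]
        have := intervalIntegral.norm_integral_le_of_norm_le_const (a := a) (b := b)
          (f := fun v => (∫ z in (-R)..R, Φ z v) + N v)
          (C := (C * J / (2 * a) + C * J) / R ^ 2) (fun v hv => by
            rw [Set.uIoc_of_le hab] at hv
            exact Xv v (Set.Ioc_subset_Icc_self hv))
        rwa [abs_of_nonneg (sub_nonneg.2 hab)] at this
      rw [← swap, left] at I2
      have ha1 : a ∈ Set.Icc 0 V := hsub' ⟨le_rfl, hab⟩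
      have hb1 : b ∈ Set.Icc 0 V := hsub' ⟨hab, le_rfl⟩
      have ta := trunc_est (slice hH a ha1) (hHb a ha1) hR
      have tb := trunc_est (slice hH b hb1) (hHb b hb1) hR
      rw [← hJ] at ta tb
      have hMa : M a = ∫ z, gd z * H a z := rfl
      have hMb : M b = ∫ z, gd z * H b z := rfl
      rw [← hMa] at ta
      rw [← hMb] at tb
      have e : (2 * (C * J) + (C * J / (2 * a) + C * J) * (b - a)) / R ^ 2
        = 2 * (C * J / R ^ 2) + (C * J / (2 * a) + C * J) / R ^ 2 * (b - a) := by ring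
      rw [e]
      rw [abs_le] at *
      constructor <;> linarith [ta.1, ta.2, tb.1, tb.2, I2.1, I2.2]
    have lim : Filter.Tendsto (fun R : ℝ =>
        (2 * (C * J) + (C * J / (2 * a) + C * J) * (b - a)) / R ^ 2) Filter.atTop (nhds 0) :=
      Filter.Tendsto.div_atTop tendsto_const_nhds (Filter.tendsto_pow_atTop (by norm_num))
    have := ge_of_tendsto lim (Filter.eventually_atTop.2 ⟨1, fun R hR => bnd R (by linarith)⟩)
    exact abs_eq_zero.1 (le_antisymm this (abs_nonneg _))
  have hNi : ∀ a b, a ∈ Set.Icc 0 V → b ∈ Set.Icc 0 V → IntervalIntegrable N volume a b := by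
    intro a b ha hb
    refine ContinuousOn.intervalIntegrable (hNc.mono ?_)
    exact Set.uIcc_subset_Icc ha hb
  have hΨ : ContinuousOn (fun v => M v + ∫ u in (0:ℝ)..v, N u) (Set.Icc 0 V) := by
    refine hMc.add ?_
    have := intervalIntegral.continuousOn_primitive_interval' (μ := volume)
      (hNi 0 V ⟨le_rfl, hV.le⟩ ⟨hV.le, le_rfl⟩) (Set.left_mem_uIcc)
    rwa [Set.uIcc_of_le hV.le] at this
  have hEq : Set.EqOn (fun v => M v + ∫ u in (0:ℝ)..v, N u)
      (fun _ => M (V/2) + ∫ u in (0:ℝ)..(V/2), N u) (Set.Ioo 0 V) := by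
    intro v hv
    have h0 : (0:ℝ) ∈ Set.Icc 0 V := ⟨le_rfl, hV.le⟩
    have hv' := Set.Ioo_subset_Icc_self hv
    have h2 : V/2 ∈ Set.Icc 0 V := ⟨by linarith, by linarith⟩
    have s := intervalIntegral.integral_add_adjacent_intervals (hNi 0 v h0 hv') (hNi v (V/2) hv' h2)
    simp only
    rcases le_total v (V/2) with h | h
    · have := key v (V/2) hv.1 h (by linarith)
      linarith
    · have := key (V/2) v (by linarith) h hv.2
      rw [intervalIntegral.integral_symm] at this
      linarith
  have hcl : Set.EqOn (fun v => M v + ∫ u in (0:ℝ)..v, N u)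
      (fun _ => M (V/2) + ∫ u in (0:ℝ)..(V/2), N u) (Set.Icc 0 V) :=
    hEq.of_subset_closure hΨ continuousOn_const Set.Ioo_subset_Icc_self
      (by rw [closure_Ioo hV.ne])
  have z0 := hcl (⟨le_rfl, hV.le⟩ : (0:ℝ) ∈ Set.Icc 0 V)
  have zV := hcl (⟨hV.le, le_rfl⟩ : V ∈ Set.Icc 0 V)
  simp only [intervalIntegral.integral_same, add_zero] at z0 zV
  rw [← zV] at z0
  exact z0

lemma lnKernel_integral {r σ s v : ℝ} (hσ : 0 < σ) (hs : 0 < s) (hv : 0 < v) (g : ℝ → ℝ) :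
    ∫ x in Set.Ioi (0 : ℝ), g x * lnKernel r σ x s v
      = ∫ z, gd z * g (s * Real.exp ((r - σ ^ 2 / 2) * v + σ * Real.sqrt v * z)) := by
  set e : ℝ → ℝ := fun z => s * Real.exp ((r - σ ^ 2 / 2) * v + σ * Real.sqrt v * z) with he
  have hm : 0 < σ * Real.sqrt v := by positivity
  have hed : ∀ z, HasDerivAt e (e z * (σ * Real.sqrt v)) z := by
    intro z
    have h1 : HasDerivAt (fun z => (r - σ ^ 2 / 2) * v + σ * Real.sqrt v * z)
        (σ * Real.sqrt v) z := by
      simpa using ((hasDerivAt_id z).const_mul (σ * Real.sqrt v)).const_add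
        ((r - σ ^ 2 / 2) * v)
    refine (h1.exp.const_mul s).congr_deriv ?_
    simp only [he]; ring
  have hepos : ∀ z, 0 < e z := fun z => by simp only [he]; positivity
  have hlog : ∀ z, lnL r σ (e z) s v = z := by
    intro z
    unfold lnL
    simp only [he]
    rw [mul_div_cancel_left₀ _ hs.ne', Real.log_exp]
    field_simp
    ring
  have hinj : Set.InjOn e Set.univ := by
    intro z _ z' _ h
    rw [← hlog z, ← hlog z', h]
  have himg : e '' Set.univ = Set.Ioi 0 := by
    ext x
    constructor
    · rintro ⟨z, _, rfl⟩; exact hepos z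
    · intro hx
      have hx : 0 < x := hx
      refine ⟨lnL r σ x s v, trivial, ?_⟩
      simp only [he]
      unfold lnL
      rw [mul_div_cancel₀ _ hm.ne', add_sub_cancel, Real.exp_log (by positivity)]
      field_simp
  have := integral_image_eq_integral_abs_deriv_smul (s := Set.univ) MeasurableSet.univ
    (fun z _ => (hed z).hasDerivWithinAt) hinj (fun x => g x * lnKernel r σ x s v)
  rw [himg] at this
  rw [this, Measure.restrict_univ]
  refine integral_congr_ae (Filter.Eventually.of_forall fun z => ?_)
  change |e z * (σ * Real.sqrt v)| • (g (e z) * lnKernel r σ (e z) s v) = gd z * g (e z)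
  simp only [smul_eq_mul]
  have h0 := hepos z
  rw [abs_of_pos (by positivity)]
  unfold lnKernel
  rw [hlog z]
  unfold gd
  generalize e z = w at *
  have h2 : 0 < Real.sqrt (2 * Real.pi) := by positivity
  have h3 : 0 < Real.sqrt v := by positivity
  field_simp

lemma gd_even (z : ℝ) : gd (-z) = gd z := by unfold gd; rw [neg_sq]

lemma gd_integrable' : Integrable gd := by
  have := gd_exp_integrable 0
  simpa using this

lemma gd_tail (d m : ℝ) : ∫ z in Set.Ioi (-d), gd (z - m) = stdNormalCDF (d + m) := by
  rw [← integral_comp_neg_Iic]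
  have h1 : ∀ z, gd (-z - m) = gd (z + m) := fun z => by
    rw [← gd_even]; congr 1; ring
  simp_rw [h1]
  rw [← integral_indicator measurableSet_Iic]
  have h2 : (Set.Iic d).indicator (fun z => gd (z + m))
      = fun z => (Set.Iic (d + m)).indicator gd (z + m) := by
    ext z
    by_cases hz : z ≤ d
    · rw [Set.indicator_of_mem (by exact hz), Set.indicator_of_mem (by simpa using hz)]
    · rw [Set.indicator_of_notMem (by exact hz), Set.indicator_of_notMem (by simpa using hz)]
  rw [h2, integral_add_right_eq_self (fun z => (Set.Iic (d + m)).indicator gd z),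
    integral_indicator measurableSet_Iic]
  rfl

lemma bs_formula {r σ K T t s : ℝ} (hσ : 0 < σ) (hs : 0 < s) (hK : 0 < K) (ht : t < T) :
    Real.exp (-r * (T - t)) * ∫ z, gd z *
        max (s * Real.exp ((r - σ ^ 2 / 2) * (T - t) + σ * Real.sqrt (T - t) * z) - K) 0
      = bsPrice r σ K T t s := by
  unfold bsPrice
  rw [if_neg (not_le.2 hs), if_pos ht]
  set V := T - t with hV
  have hVp : 0 < V := by linarith
  set m := σ * Real.sqrt V with hm
  have hmp : 0 < m := by positivity
  have hm2 : m ^ 2 = σ ^ 2 * V := by rw [hm, mul_pow, Real.sq_sqrt hVp.le]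
  set d := (Real.log (s / K) + (r - σ ^ 2 / 2) * V) / m with hd
  have hd1 : (Real.log (s / K) + (r + σ ^ 2 / 2) * V) / m = d + m := by
    rw [hd]; field_simp; rw [hm2]; ring
  rw [hd1]
  have hdm : d * m = Real.log (s / K) + (r - σ ^ 2 / 2) * V := by rw [hd]; field_simp
  have e1 : ∀ z, Real.exp (-r * V) * (gd z *
      max (s * Real.exp ((r - σ ^ 2 / 2) * V + m * z) - K) 0)
      = (Set.Ioi (-d)).indicator (fun z => s * gd (z - m) - K * Real.exp (-r * V) * gd z) z := by
    intro z
    have hK' : K = s * Real.exp (- Real.log (s / K)) := by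
      rw [Real.exp_neg, Real.exp_log (by positivity)]; field_simp
    by_cases hz : -d < z
    · rw [Set.indicator_of_mem (by exact hz), max_eq_left]
      · have hg : gd (z - m) = Real.exp (-r * V) * gd z *
            Real.exp ((r - σ ^ 2 / 2) * V + m * z) := by
          unfold gd
          rw [mul_div_assoc', div_mul_eq_mul_div, ← Real.exp_add, ← Real.exp_add]
          congr 2
          nlinarith
        rw [hg]; ring
      · rw [sub_nonneg]
        conv_lhs => rw [hK']
        gcongr
        nlinarith
    · rw [Set.indicator_of_notMem (by exact hz), max_eq_right]
      · ring
      · rw [sub_nonpos]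
        conv_rhs => rw [hK']
        gcongr
        nlinarith [not_lt.1 hz]
  rw [← integral_const_mul]
  simp_rw [e1]
  rw [integral_indicator measurableSet_Ioi]
  have i1 : Integrable (fun z => gd (z - m)) := gd_integrable'.comp_sub_right m
  have i2 := gd_integrable'
  rw [integral_sub (i1.const_mul s).integrableOn (i2.const_mul _).integrableOn,
    integral_const_mul, integral_const_mul, gd_tail]
  have := gd_tail d 0
  simp only [sub_zero, add_zero] at this
  rw [this, add_sub_cancel_right]

lemma domD_open (T : ℝ) : IsOpen (domD T) := by
  unfold domD
  simp only [Set.ofPred_and]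
  refine IsOpen.inter ?_ (IsOpen.inter ?_ (IsOpen.inter ?_ (IsOpen.inter ?_ ?_)))
  all_goals exact isOpen_lt (by fun_prop) (by fun_prop)

lemma growth_closure {T C : ℝ} (hT : 0 < T) {φ : ℝ → ℝ → ℝ → ℝ}
    (hc : ContinuousOn (fun q : ℝ × ℝ × ℝ => φ q.1 q.2.1 q.2.2) (domDbar T))
    (hg : ∀ t s y, (t, s, y) ∈ domD T → |φ t s y| ≤ C * (1 + s)) :
    ∀ t s y, (t, s, y) ∈ domDbar T → |φ t s y| ≤ C * (1 + s) := by
  intro t s y hq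
  have hsub : domD T ⊆ domDbar T := fun q h =>
    ⟨h.1.le, h.2.1.le, h.2.2.1.le, h.2.2.2.1.le, h.2.2.2.2.le⟩
  set c : ℝ → ℝ × ℝ × ℝ := fun ε =>
    (t + ε * (T/2 - t), s + ε * (1 - s), y + ε * (T/4 - y)) with hcdef
  have hcD : ∀ ε ∈ Set.Ioo (0:ℝ) 1, c ε ∈ domD T := by
    rintro ε ⟨h0, h1⟩
    obtain ⟨a1, a2, a3, a4, a5⟩ := hq
    simp only at a1 a2 a3 a4 a5
    have h1' : 0 < 1 - ε := by linarith
    refine ⟨?_, ?_, ?_, ?_, ?_⟩ <;> simp only [hcdef]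
    · nlinarith [mul_nonneg h1'.le a1, mul_pos h0 hT]
    · nlinarith [mul_nonneg h1'.le (sub_nonneg.2 a2), mul_pos h0 hT]
    · nlinarith [mul_nonneg h1'.le a3]
    · nlinarith [mul_nonneg h1'.le a4, mul_pos h0 hT]
    · nlinarith [mul_nonneg h1'.le (sub_nonneg.2 a5), mul_pos h0 hT]
  have hev : ∀ᶠ ε in nhdsWithin (0:ℝ) (Set.Ioi 0), ε ∈ Set.Ioo (0:ℝ) 1 :=
    Ioo_mem_nhdsGT one_pos
  have hcc : Continuous c := by rw [hcdef]; fun_prop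
  have c0 : c 0 = (t, s, y) := by simp [hcdef]
  have ht : Filter.Tendsto c (nhdsWithin 0 (Set.Ioi 0)) (nhdsWithin (t, s, y) (domDbar T)) := by
    refine tendsto_nhdsWithin_iff.2 ⟨?_, hev.mono fun ε h => hsub (hcD ε h)⟩
    rw [← c0]
    exact (hcc.tendsto 0).mono_left nhdsWithin_le_nhds
  have t1 := ((hc (t, s, y) hq).tendsto.comp ht).abs
  have t2 : Filter.Tendsto (fun ε : ℝ => C * (1 + (s + ε * (1 - s))))
      (nhdsWithin 0 (Set.Ioi 0)) (nhds (C * (1 + s))) := by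
    have : Continuous (fun ε : ℝ => C * (1 + (s + ε * (1 - s)))) := by fun_prop
    have := this.tendsto 0
    simp only [zero_mul, add_zero] at this
    exact this.mono_left nhdsWithin_le_nhds
  exact le_of_tendsto_of_tendsto t1 t2 (hev.mono fun ε h => hg _ _ _ (hcD ε h))

lemma chain3 {T : ℝ} {φ Dt Ds Dy : ℝ → ℝ → ℝ → ℝ}
    (hDt : ∀ t s y : ℝ, (t, s, y) ∈ domD T → HasDerivAt (fun τ => φ τ s y) (Dt t s y) t)
    (hDs : ∀ t s y : ℝ, (t, s, y) ∈ domD T → HasDerivAt (fun w => φ t w y) (Ds t s y) s)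
    (hDy : ∀ t s y : ℝ, (t, s, y) ∈ domD T → HasDerivAt (fun u => φ t s u) (Dy t s y) y)
    (hDtc : ContinuousOn (fun q : ℝ × ℝ × ℝ => Dt q.1 q.2.1 q.2.2) (domD T))
    (hDsc : ContinuousOn (fun q : ℝ × ℝ × ℝ => Ds q.1 q.2.1 q.2.2) (domD T))
    (hDyc : ContinuousOn (fun q : ℝ × ℝ × ℝ => Dy q.1 q.2.1 q.2.2) (domD T))
    {a b c : ℝ → ℝ} {a' b' c' v : ℝ} (ha : HasDerivAt a a' v) (hb : HasDerivAt b b' v)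
    (hc : HasDerivAt c c' v) (hq : (a v, b v, c v) ∈ domD T) :
    HasDerivAt (fun u => φ (a u) (b u) (c u))
      (Dt (a v) (b v) (c v) * a' + Ds (a v) (b v) (c v) * b' + Dy (a v) (b v) (c v) * c') v := by
  have hO := domD_open T
  let one : ℝ → (ℝ →L[ℝ] ℝ) := fun x => ContinuousLinearMap.toSpanSingleton ℝ x
  have hone : Continuous one := by
    have : one = fun x => (ContinuousLinearMap.toSpanSingletonCLE (𝕜 := ℝ) (E := ℝ)) x := rfl
    rw [this]; exact ContinuousLinearEquiv.continuous _
  -- two-variable derivative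
  have h2 : ∀ t s y, (t, s, y) ∈ domD T →
      HasFDerivAt (fun w : ℝ × ℝ => φ t w.1 w.2)
        ((one (Ds t s y)).coprod (one (Dy t s y))) (s, y) := by
    intro t s y h
    have hmap : ContinuousAt (fun w : ℝ × ℝ => (t, w.1, w.2)) (s, y) := by fun_prop
    have hev : ∀ᶠ w : ℝ × ℝ in nhds (s, y), (t, w.1, w.2) ∈ domD T :=
      hmap.eventually (hO.mem_nhds h)
    have := hasStrictFDerivAt_uncurry_coprod (𝕜 := ℝ) (u := (s, y)) (f := fun s y => φ t s y)
      (f₁ := fun s y => one (Ds t s y)) (f₂ := fun s y => one (Dy t s y))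
      (hev.mono fun w hw => (hDs _ _ _ hw).hasFDerivAt)
      (hev.mono fun w hw => (hDy _ _ _ hw).hasFDerivAt)
      (hone.continuousAt.comp
        (ContinuousAt.comp (f := fun w : ℝ × ℝ => (t, w.1, w.2)) (x := (s, y))
          (hDsc.continuousAt (hO.mem_nhds h)) hmap))
      (hone.continuousAt.comp
        (ContinuousAt.comp (f := fun w : ℝ × ℝ => (t, w.1, w.2)) (x := (s, y))
          (hDyc.continuousAt (hO.mem_nhds h)) hmap))
    exact this.hasFDerivAt
  have hev : ∀ᶠ q : ℝ × ℝ × ℝ in nhds (a v, b v, c v), q ∈ domD T := hO.mem_nhds hq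
  have h3 := hasStrictFDerivAt_uncurry_coprod (𝕜 := ℝ) (u := (a v, (b v, c v)))
      (f := fun t (w : ℝ × ℝ) => φ t w.1 w.2)
      (f₁ := fun t w => one (Dt t w.1 w.2))
      (f₂ := fun t w => (one (Ds t w.1 w.2)).coprod (one (Dy t w.1 w.2)))
      (hev.mono fun w hw => (hDt _ _ _ hw).hasFDerivAt)
      (hev.mono fun w hw => h2 _ _ _ hw)
      (hone.continuousAt.comp (hDtc.continuousAt (hO.mem_nhds hq)))
      (by
        have k1 := hone.continuousAt.comp (hDsc.continuousAt (hO.mem_nhds hq))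
        have k2 := hone.continuousAt.comp (hDyc.continuousAt (hO.mem_nhds hq))
        have e : (fun q : ℝ × ℝ × ℝ => (one (Ds q.1 q.2.1 q.2.2)).coprod (one (Dy q.1 q.2.1 q.2.2)))
          = fun q : ℝ × ℝ × ℝ => (one (Ds q.1 q.2.1 q.2.2)).comp (ContinuousLinearMap.fst ℝ ℝ ℝ)
            + (one (Dy q.1 q.2.1 q.2.2)).comp (ContinuousLinearMap.snd ℝ ℝ ℝ) := by
          funext q; ext <;> simp
        change ContinuousAt (fun q : ℝ × ℝ × ℝ =>
          (one (Ds q.1 q.2.1 q.2.2)).coprod (one (Dy q.1 q.2.1 q.2.2))) _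
        rw [e]
        exact (k1.clm_comp continuousAt_const).add (k2.clm_comp continuousAt_const))
  have h4 := h3.hasFDerivAt.comp_hasDerivAt v (ha.prodMk (hb.prodMk hc))
  refine h4.congr_deriv ?_
  simp [one, Function.HasUncurry.uncurry]
  ring

/-- A classical `C^{1,2,1}` solution of the initial-boundary value problem with at
most linear growth also solves the Volterra integral equation on `D`. -/
theorem pde_solution_solves_volterra
    (k : ℕ) (hk : 1 ≤ k) (T K : ℝ) (hT : 0 < T) (hK : 0 < K)
    (r σ : Fin k → ℝ) (hr : ∀ i, 0 ≤ r i) (hσ : ∀ i, 0 < σ i)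
    (p : Fin k → Fin k → ℝ) (hp0 : ∀ i j, 0 ≤ p i j)
    (hp1 : ∀ i, ∑ j, p i j = 1) (hpd : ∀ i, p i i = 0)
    (f : Fin k → ℝ → ℝ)
    (hfC1 : ∀ i, ContDiffOn ℝ 1 (f i) (Set.Ici 0))
    (hfbd : ∀ i, ∃ M : ℝ, ∀ y, 0 ≤ y → f i y ≤ M)
    (hfpos : ∀ i y, 0 < y → 0 < f i y)
    (hfnn : ∀ i y, 0 ≤ y → 0 ≤ f i y)
    (hfdens : ∀ i, ∫ u in Set.Ioi (0 : ℝ), f i u = 1)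
    (F : Fin k → ℝ → ℝ) (hFdef : ∀ i y, F i y = ∫ u in (0 : ℝ)..y, f i u)
    (hFlt : ∀ i y, 0 ≤ y → F i y < 1)
    (hirr : ∀ i j : Fin k, ∃ n : ℕ, 0 < n ∧ 0 < ((Matrix.of p) ^ n) i j)
    (φ Dt Ds Dss Dy : ℝ → ℝ → Fin k → ℝ → ℝ)
    (hφc : ContOnClosure T φ) (hφg : LinGrowth T φ)
    (hDt : ∀ t s y : ℝ, (t, s, y) ∈ domD T → ∀ i,
      HasDerivAt (fun τ => φ τ s i y) (Dt t s i y) t)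
    (hDs : ∀ t s y : ℝ, (t, s, y) ∈ domD T → ∀ i,
      HasDerivAt (fun w => φ t w i y) (Ds t s i y) s)
    (hDss : ∀ t s y : ℝ, (t, s, y) ∈ domD T → ∀ i,
      HasDerivAt (fun w => Ds t w i y) (Dss t s i y) s)
    (hDy : ∀ t s y : ℝ, (t, s, y) ∈ domD T → ∀ i,
      HasDerivAt (fun u => φ t s i u) (Dy t s i y) y)
    (hDtc : ∀ i, ContinuousOn (fun q : ℝ × ℝ × ℝ => Dt q.1 q.2.1 i q.2.2) (domD T))
    (hDsc : ∀ i, ContinuousOn (fun q : ℝ × ℝ × ℝ => Ds q.1 q.2.1 i q.2.2) (domD T))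
    (hDssc : ∀ i, ContinuousOn (fun q : ℝ × ℝ × ℝ => Dss q.1 q.2.1 i q.2.2) (domD T))
    (hDyc : ∀ i, ContinuousOn (fun q : ℝ × ℝ × ℝ => Dy q.1 q.2.1 i q.2.2) (domD T))
    (hbd0 : ∀ t y : ℝ, ∀ i, 0 ≤ t → t ≤ T → 0 ≤ y → y ≤ t → φ t 0 i y = 0)
    (hbdT : ∀ s : ℝ, 0 < s → ∀ y : ℝ, 0 ≤ y → y ≤ T → ∀ i, φ T s i y = max (s - K) 0)
    (hPDE : ∀ t s y : ℝ, (t, s, y) ∈ domD T → ∀ i,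
      Dt t s i y + Dy t s i y + r i * s * Ds t s i y
        + (1 / 2) * (σ i) ^ 2 * s ^ 2 * Dss t s i y
        + (f i y / (1 - F i y)) *
            ∑ j ∈ Finset.univ.erase i, p i j * (φ t s j 0 - φ t s i y)
        = r i * φ t s i y) :
    ∀ t s y : ℝ, (t, s, y) ∈ domD T → ∀ i,
      φ t s i y = ieRHS r σ p f F K T φ t s i y := by
  intro t s y hq i
  obtain ⟨C, hC⟩ := hφg
  obtain ⟨ht0, htT, hs, hy0, hyt⟩ := hq
  simp only at ht0 htT hs hy0 hyt
  have hgr : ∀ j, ∀ t s y, (t, s, y) ∈ domDbar T → |φ t s j y| ≤ C * (1 + s) := fun j =>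
    growth_closure (φ := fun t s y => φ t s j y) hT (hφc j) (fun t s y h => hC t s y h j)
  have hC0 : 0 ≤ C := by
    have h1 := hC t s y ⟨ht0, htT, hs, hy0, hyt⟩ i
    have h2 := (abs_nonneg _).trans h1
    by_contra h3
    nlinarith [not_le.1 h3]
  obtain ⟨V, hVdef⟩ : ∃ V, V = T - t := ⟨_, rfl⟩
  have hV : 0 < V := by linarith
  obtain ⟨ρ, hρ⟩ : ∃ ρ, ρ = r i := ⟨_, rfl⟩
  obtain ⟨ς, hς⟩ : ∃ ς, ς = σ i := ⟨_, rfl⟩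
  have hςp : 0 < ς := by rw [hς]; exact hσ i
  obtain ⟨μ, hμ⟩ : ∃ μ, μ = ρ - ς ^ 2 / 2 := ⟨_, rfl⟩
  have hA : 0 < 1 - F i y := by linarith [hFlt i y hy0.le]
  set A := 1 - F i y with hAdef
  set S : ℝ → ℝ → ℝ := fun v z => s * Real.exp (μ * v + ς * Real.sqrt v * z) with hS
  have hSpos : ∀ v z, 0 < S v z := fun v z => by simp only [hS]; positivity
  have hSc : Continuous (fun q : ℝ × ℝ => S q.1 q.2) := by simp only [hS]; fun_prop
  set cf : ℝ → ℝ := fun v => Real.exp (-ρ * v) * ((1 - F i (y + v)) / A) with hcf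
  set gf : ℝ → ℝ := fun v => Real.exp (-ρ * v) * (f i (y + v) / A) with hgf
  set H : ℝ → ℝ → ℝ := fun v z => cf v * φ (t + v) (S v z) i (y + v) with hH
  set H1 : ℝ → ℝ → ℝ := fun v z =>
    cf v * (Ds (t + v) (S v z) i (y + v) * (S v z * (ς * Real.sqrt v))) with hH1
  set H2 : ℝ → ℝ → ℝ := fun v z =>
    cf v * (Dss (t + v) (S v z) i (y + v) * (S v z * (ς * Real.sqrt v)) *
        (S v z * (ς * Real.sqrt v))
      + Ds (t + v) (S v z) i (y + v) * (S v z * (ς * Real.sqrt v) * (ς * Real.sqrt v))) with hH2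
  set G : ℝ → ℝ → ℝ := fun v z => gf v * ∑ j, p i j * φ (t + v) (S v z) j 0 with hG
  have hfc : ContinuousOn (f i) (Set.Ici 0) := (hfC1 i).continuousOn
  have hFd : ∀ u, 0 < u → HasDerivAt (F i) (f i u) u := by
    intro u hu
    have e : F i = fun u => ∫ x in (0:ℝ)..u, f i x := funext fun u => hFdef i u
    rw [e]
    refine intervalIntegral.integral_hasDerivAt_right ?_ ?_ ?_
    · refine ContinuousOn.intervalIntegrable (hfc.mono ?_)
      rw [Set.uIcc_of_le hu.le]
      exact fun x hx => hx.1
    · exact (hfc.mono Set.Ioi_subset_Ici_self).stronglyMeasurableAtFilter isOpen_Ioi u hu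
    · exact hfc.continuousAt (Ici_mem_nhds hu)
  have hcfd : ∀ v, 0 ≤ v → HasDerivAt cf (-ρ * cf v - gf v) v := by
    intro v hv
    have h1 : HasDerivAt (fun v => Real.exp (-ρ * v)) (-ρ * Real.exp (-ρ * v)) v := by
      have := ((hasDerivAt_id v).const_mul (-ρ)).exp
      refine this.congr_deriv ?_
      simp; ring
    have h2 : HasDerivAt (fun v => (1 - F i (y + v)) / A) (-f i (y + v) / A) v :=
      (((hFd (y + v) (by linarith)).comp_const_add y v).const_sub 1).div_const A
    refine (h1.mul h2).congr_deriv ?_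
    simp only [hcf, hgf]; ring
  have hcfc : ContinuousOn cf (Set.Icc 0 V) := fun v hv =>
    (hcfd v hv.1).continuousAt.continuousWithinAt
  have hgfc : ContinuousOn gf (Set.Icc 0 V) := by
    refine ContinuousOn.mul (by fun_prop) (ContinuousOn.div_const ?_ A)
    exact hfc.comp (by fun_prop) (fun v hv => by
      have := hv.1
      simp only [Set.mem_Ici]; linarith)
  obtain ⟨B1, hB1⟩ := isCompact_Icc.exists_bound_of_continuousOn hcfc
  obtain ⟨B2, hB2⟩ := isCompact_Icc.exists_bound_of_continuousOn hgfc
  simp only [Real.norm_eq_abs] at hB1 hB2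
  -- domain facts
  have mbar : ∀ v ∈ Set.Icc 0 V, ∀ z, (t + v, S v z, y + v) ∈ domDbar T := by
    intro v hv z
    have := hSpos v z
    refine ⟨?_, ?_, ?_, ?_, ?_⟩ <;> simp only <;> linarith [hv.1, hv.2]
  have mbar0 : ∀ v ∈ Set.Icc 0 V, ∀ z, (t + v, S v z, (0:ℝ)) ∈ domDbar T := by
    intro v hv z
    have := hSpos v z
    refine ⟨?_, ?_, ?_, ?_, ?_⟩ <;> simp only <;> linarith [hv.1, hv.2]
  have mD : ∀ v ∈ Set.Ioo 0 V, ∀ x, 0 < x → (t + v, x, y + v) ∈ domD T := by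
    intro v hv x hx
    refine ⟨?_, ?_, ?_, ?_, ?_⟩ <;> simp only <;> linarith [hv.1, hv.2]
  -- growth of S
  set c := ς * Real.sqrt V with hc
  set s1 := s * Real.exp (|μ| * V) with hs1
  have hs1p : 0 < s1 := by positivity
  have hSb : ∀ v ∈ Set.Icc 0 V, ∀ z, 1 + S v z ≤ (1 + s1) * Real.exp (c * |z|) := by
    intro v hv z
    have e1 : 1 ≤ Real.exp (c * |z|) := Real.one_le_exp (by positivity)
    have e2 : S v z ≤ s1 * Real.exp (c * |z|) := by
      simp only [hS, hs1]
      rw [mul_assoc s (Real.exp (|μ| * V)), ← Real.exp_add]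
      refine mul_le_mul_of_nonneg_left (Real.exp_le_exp.2 (add_le_add ?_ ?_)) hs.le
      · calc μ * v ≤ |μ| * v := mul_le_mul_of_nonneg_right (le_abs_self _) hv.1
          _ ≤ |μ| * V := mul_le_mul_of_nonneg_left hv.2 (abs_nonneg _)
      · calc ς * Real.sqrt v * z ≤ ς * Real.sqrt v * |z| :=
              mul_le_mul_of_nonneg_left (le_abs_self _) (by positivity)
          _ ≤ c * |z| := by
              rw [hc]; gcongr; exact hv.2
    linarith
  have hφS : ∀ j, ∀ v ∈ Set.Icc 0 V, ∀ z, |φ (t + v) (S v z) j 0|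
      ≤ C * (1 + s1) * Real.exp (c * |z|) := by
    intro j v hv z
    refine (hgr j _ _ _ (mbar0 v hv z)).trans ?_
    rw [mul_assoc]
    exact mul_le_mul_of_nonneg_left (hSb v hv z) hC0
  have hsum : ∀ v ∈ Set.Icc 0 V, ∀ z, |∑ j, p i j * φ (t + v) (S v z) j 0|
      ≤ C * (1 + s1) * Real.exp (c * |z|) := by
    intro v hv z
    refine (Finset.abs_sum_le_sum_abs _ _).trans ?_
    calc ∑ j, |p i j * φ (t + v) (S v z) j 0|
        ≤ ∑ j, p i j * (C * (1 + s1) * Real.exp (c * |z|)) := by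
          refine Finset.sum_le_sum fun j _ => ?_
          rw [abs_mul, abs_of_nonneg (hp0 i j)]
          exact mul_le_mul_of_nonneg_left (hφS j v hv z) (hp0 i j)
      _ = _ := by rw [← Finset.sum_mul, hp1, one_mul]
  set B := max B1 B2 with hB
  have h0V : (0:ℝ) ∈ Set.Icc 0 V := ⟨le_rfl, hV.le⟩
  have hB0 : 0 ≤ B := ((abs_nonneg _).trans (hB1 0 h0V)).trans (le_max_left _ _)
  have hHb : ∀ v ∈ Set.Icc 0 V, ∀ z, |H v z| ≤ B * (C * (1 + s1)) * Real.exp (c * |z|) := by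
    intro v hv z
    simp only [hH]
    rw [abs_mul, mul_assoc]
    refine mul_le_mul ((hB1 v hv).trans (le_max_left _ _)) ?_ (abs_nonneg _) hB0
    refine (hgr i _ _ _ (mbar v hv z)).trans ?_
    rw [mul_assoc]
    exact mul_le_mul_of_nonneg_left (hSb v hv z) hC0
  have hGb : ∀ v ∈ Set.Icc 0 V, ∀ z, |G v z| ≤ B * (C * (1 + s1)) * Real.exp (c * |z|) := by
    intro v hv z
    simp only [hG]
    rw [abs_mul, mul_assoc]
    exact mul_le_mul ((hB2 v hv).trans (le_max_right _ _)) (hsum v hv z) (abs_nonneg _) hB0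
  -- continuity
  have hφ0c : ∀ j, ContinuousOn (fun q : ℝ × ℝ => φ (t + q.1) (S q.1 q.2) j 0)
      (Set.Icc 0 V ×ˢ Set.univ) := by
    intro j
    exact (hφc j).comp (f := fun q : ℝ × ℝ => (t + q.1, S q.1 q.2, (0:ℝ)))
      (by fun_prop) (fun q hq => mbar0 q.1 hq.1 q.2)
  have fstIcc : Set.MapsTo (Prod.fst : ℝ × ℝ → ℝ) (Set.Icc 0 V ×ˢ Set.univ) (Set.Icc 0 V) :=
    fun q hq => hq.1
  have fstIoo : Set.MapsTo (Prod.fst : ℝ × ℝ → ℝ) (Set.Ioo 0 V ×ˢ Set.univ) (Set.Icc 0 V) :=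
    fun q hq => Set.Ioo_subset_Icc_self hq.1
  have hHc : ContinuousOn (fun q : ℝ × ℝ => H q.1 q.2) (Set.Icc 0 V ×ˢ Set.univ) := by
    refine (hcfc.comp continuousOn_fst fstIcc).mul ?_
    exact (hφc i).comp (f := fun q : ℝ × ℝ => (t + q.1, S q.1 q.2, y + q.1))
      (by fun_prop) (fun q hq => mbar q.1 hq.1 q.2)
  have hGc : ContinuousOn (fun q : ℝ × ℝ => G q.1 q.2) (Set.Icc 0 V ×ˢ Set.univ) := by
    refine (hgfc.comp continuousOn_fst fstIcc).mul ?_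
    exact continuousOn_finsetSum _ fun j _ => continuousOn_const.mul (hφ0c j)
  have hDsS : ContinuousOn (fun q : ℝ × ℝ => Ds (t + q.1) (S q.1 q.2) i (y + q.1))
      (Set.Ioo 0 V ×ˢ Set.univ) :=
    (hDsc i).comp (f := fun q : ℝ × ℝ => (t + q.1, S q.1 q.2, y + q.1))
      (by fun_prop) (fun q hq => mD q.1 hq.1 _ (hSpos _ _))
  have hDssS : ContinuousOn (fun q : ℝ × ℝ => Dss (t + q.1) (S q.1 q.2) i (y + q.1))
      (Set.Ioo 0 V ×ˢ Set.univ) :=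
    (hDssc i).comp (f := fun q : ℝ × ℝ => (t + q.1, S q.1 q.2, y + q.1))
      (by fun_prop) (fun q hq => mD q.1 hq.1 _ (hSpos _ _))
  have hSm : ContinuousOn (fun q : ℝ × ℝ => S q.1 q.2 * (ς * Real.sqrt q.1))
      (Set.Ioo 0 V ×ˢ Set.univ) := by fun_prop
  have hm : ContinuousOn (fun q : ℝ × ℝ => ς * Real.sqrt q.1)
      (Set.Ioo 0 V ×ˢ Set.univ) := by fun_prop
  have hH1c : ContinuousOn (fun q : ℝ × ℝ => H1 q.1 q.2) (Set.Ioo 0 V ×ˢ Set.univ) :=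
    (hcfc.comp continuousOn_fst fstIoo).mul (hDsS.mul hSm)
  have hH2c : ContinuousOn (fun q : ℝ × ℝ => H2 q.1 q.2) (Set.Ioo 0 V ×ˢ Set.univ) :=
    (hcfc.comp continuousOn_fst fstIoo).mul
      (((hDssS.mul hSm).mul hSm).add (hDsS.mul (hSm.mul hm)))
  -- derivatives
  have hSz : ∀ v z, HasDerivAt (fun z => S v z) (S v z * (ς * Real.sqrt v)) z := by
    intro v z
    have h1 : HasDerivAt (fun z => μ * v + ς * Real.sqrt v * z) (ς * Real.sqrt v) z := by
      simpa using ((hasDerivAt_id z).const_mul (ς * Real.sqrt v)).const_add (μ * v)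
    refine (h1.exp.const_mul s).congr_deriv ?_
    simp only [hS]; ring
  have d1 : ∀ v ∈ Set.Ioo 0 V, ∀ z, HasDerivAt (fun z => H v z) (H1 v z) z := by
    intro v hv z
    have := (hDs _ _ _ (mD v hv _ (hSpos v z)) i).comp z (hSz v z)
    exact this.const_mul (cf v)
  have d2 : ∀ v ∈ Set.Ioo 0 V, ∀ z, HasDerivAt (fun z => H1 v z) (H2 v z) z := by
    intro v hv z
    have h1 := (hDss _ _ _ (mD v hv _ (hSpos v z)) i).comp z (hSz v z)
    have h2 := (hSz v z).mul_const (ς * Real.sqrt v)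
    exact (h1.mul h2).const_mul (cf v)
  have dv : ∀ v ∈ Set.Ioo 0 V, ∀ z,
      HasDerivAt (fun u => H u z) ((z * H1 v z - H2 v z) / (2 * v) - G v z) v := by
    intro v hv z
    have hv0 : 0 < v := hv.1
    have hin := mD v hv _ (hSpos v z)
    have hSv : HasDerivAt (fun u => S u z) (S v z * (μ + ς * (1 / (2 * Real.sqrt v)) * z)) v := by
      have h1 : HasDerivAt (fun u => μ * u + ς * Real.sqrt u * z)
          (μ + ς * (1 / (2 * Real.sqrt v)) * z) v := by
        have := ((hasDerivAt_id v).const_mul μ).add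
          (((Real.hasDerivAt_sqrt hv0.ne').const_mul ς).mul_const z)
        refine this.congr_deriv ?_
        simp
      refine (h1.exp.const_mul s).congr_deriv ?_
      simp only [hS]; ring
    have ha : HasDerivAt (fun u => t + u) 1 v := by simpa using (hasDerivAt_id v).const_add t
    have hcc : HasDerivAt (fun u => y + u) 1 v := by simpa using (hasDerivAt_id v).const_add y
    have hch := chain3 (φ := fun t s y => φ t s i y) (Dt := fun t s y => Dt t s i y)
      (Ds := fun t s y => Ds t s i y) (Dy := fun t s y => Dy t s i y)
      (fun t s y h => hDt t s y h i) (fun t s y h => hDs t s y h i) (fun t s y h => hDy t s y h i)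
      (hDtc i) (hDsc i) (hDyc i) ha hSv hcc hin
    have hprod := (hcfd v hv0.le).mul hch
    refine hprod.congr_deriv ?_
    have pde := hPDE _ _ _ hin i
    have hse : ∑ j ∈ Finset.univ.erase i, p i j * (φ (t + v) (S v z) j 0 - φ (t + v) (S v z) i (y + v))
        = (∑ j, p i j * φ (t + v) (S v z) j 0) - φ (t + v) (S v z) i (y + v) := by
      have e1 : ∑ j ∈ Finset.univ.erase i,
          p i j * (φ (t + v) (S v z) j 0 - φ (t + v) (S v z) i (y + v))
          = ∑ j, p i j * (φ (t + v) (S v z) j 0 - φ (t + v) (S v z) i (y + v)) := by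
        refine Finset.sum_erase _ ?_
        rw [hpd, zero_mul]
      rw [e1]
      simp_rw [mul_sub]
      rw [Finset.sum_sub_distrib, ← Finset.sum_mul, hp1, one_mul]
    rw [hse, ← hρ, ← hς] at pde
    have hFp : 0 < 1 - F i (y + v) := by linarith [hFlt i (y + v) (by linarith)]
    have hgc : gf v = cf v * (f i (y + v) / (1 - F i (y + v))) := by
      simp only [hgf, hcf]; field_simp
    simp only [hH1, hH2, hG]
    rw [hgc]
    obtain ⟨w, hw, hwv⟩ : ∃ w, 0 < w ∧ v = w ^ 2 :=
      ⟨Real.sqrt v, by positivity, (Real.sq_sqrt hv0.le).symm⟩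
    have hsq : Real.sqrt v = w := by rw [hwv, Real.sqrt_sq hw.le]
    rw [hsq]
    rw [hμ]
    generalize (∑ j, p i j * φ (t + v) (S v z) j 0) = gg at *
    generalize φ (t + v) (S v z) i (y + v) = ph at *
    generalize Dt (t + v) (S v z) i (y + v) = xt at *
    generalize Ds (t + v) (S v z) i (y + v) = xs at *
    generalize Dss (t + v) (S v z) i (y + v) = xss at *
    generalize Dy (t + v) (S v z) i (y + v) = xy at *
    generalize f i (y + v) / (1 - F i (y + v)) = hz at *
    generalize S v z = ss at *
    generalize cf v = cv at *
    have hxt : xt = ρ * ph - xy - ρ * ss * xs - (1 / 2) * ς ^ 2 * ss ^ 2 * xss - hz * (gg - ph) := by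
      linarith
    rw [hxt, hwv]
    field_simp
    ring
  have fk := feynman_kac hV hHc hGc hH1c hH2c hHb hGb dv d1 d2
  -- left side
  have L0 : ∫ z, gd z * H 0 z = φ t s i y := by
    have e : ∀ z, H 0 z = φ t s i y := by
      intro z
      simp only [hH, hS, hcf]
      simp [← hAdef, div_self hA.ne']
    simp_rw [e]
    rw [integral_mul_const, gd_integral, one_mul]
  have LV : ∫ z, gd z * H V z = (1 - F i (T - t + y)) / A * bsPrice (r i) (σ i) K T t s := by
    have e : ∀ z, gd z * H V z = ((1 - F i (T - t + y)) / A * Real.exp (-ρ * (T - t))) *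
        (gd z * max (s * Real.exp ((ρ - ς ^ 2 / 2) * (T - t) + ς * Real.sqrt (T - t) * z) - K) 0) := by
      intro z
      simp only [hH]
      have e1 : t + V = T := by linarith
      rw [e1, hbdT _ (hSpos V z) (y + V) (by linarith) (by linarith)]
      simp only [hcf, hS, hμ, hVdef]
      rw [add_comm y (T - t)]
      ring
    simp_rw [e]
    rw [integral_const_mul, mul_assoc, bs_formula hςp hs hK htT, hρ, hς]
  have LG : ∫ v in (0:ℝ)..V, ∫ z, gd z * G v z = ∫ v in Set.Ioo (0 : ℝ) (T - t),
        Real.exp (-(r i) * v) * (f i (y + v) / (1 - F i y)) *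
          ∑ j, p i j * ∫ x in Set.Ioi (0 : ℝ), φ (t + v) x j 0 * lnKernel (r i) (σ i) x s v := by
    rw [intervalIntegral.integral_of_le hV.le, integral_Ioc_eq_integral_Ioo, hVdef]
    refine setIntegral_congr_fun measurableSet_Ioo fun v hv => ?_
    rw [← hVdef] at hv
    have hv' := Set.Ioo_subset_Icc_self hv
    have e : ∀ z, gd z * G v z = gf v * ∑ j, p i j * (gd z * φ (t + v) (S v z) j 0) := by
      intro z
      simp only [hG]
      rw [mul_left_comm, Finset.mul_sum]
      congr 1
      exact Finset.sum_congr rfl fun j _ => by ring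
    simp_rw [e]
    rw [integral_const_mul, integral_finsetSum]
    · simp only [hgf, ← hρ, ← hς]
      congr 1
      refine Finset.sum_congr rfl fun j _ => ?_
      rw [integral_const_mul, lnKernel_integral hςp hs hv.1 (fun x => φ (t + v) x j 0)]
      simp only [hS, hμ]
    · intro j _
      refine Integrable.const_mul (gd_integrable ?_ (hφS j v hv')) _
      have := (hφ0c j).comp (f := fun z => (v, z)) (s := Set.univ) (by fun_prop)
        (fun z _ => ⟨hv', trivial⟩)
      exact continuousOn_univ.1 this
  unfold ieRHS
  rw [← L0, fk, LV, LG]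
end
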